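/- arXiv:2501.03660 — 6 statements merged into one kernel-verified Lean document; each statement's English description precedes it below -/
import Mathlib

section
/- Let p be a prime number and let X be a finite latin non-degenerate cycle set with |X| = p². Then p = 2 (so |X| = 4); in particular, there is no latin cycle set of cardinality p² for any odd prime p. -/
/-- The permutation group `G(X)` of a left quasigroup, generated by the left translations. -/
def permGroup {X : Type*} (σ : X → Equiv.Perm X) : Subgroup (Equiv.Perm X) :=
  Subgroup.closure (Set.range σ)

/-- The left translation `σ_x` as an element of `G(X)`. -/
def sigmaG {X : Type*} (σ : X → Equiv.Perm X) (x : X) : permGroup σ :=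
  ⟨σ x, Subgroup.subset_closure ⟨x, rfl⟩⟩

/-- The displacement group `Dis(X)`: the normal closure in `G(X)` of the
elements `σ_x ∘ σ_y⁻¹`. -/
def dis {X : Type*} (σ : X → Equiv.Perm X) : Subgroup ↥(permGroup σ) :=
  Subgroup.normalClosure {g : ↥(permGroup σ) | ∃ x y : X, (g : Equiv.Perm X) = σ x * (σ y)⁻¹}

/-- A left quasigroup is indecomposable if `G(X)` acts transitively. -/
def Indecomposable {X : Type*} (σ : X → Equiv.Perm X) : Prop :=
  ∀ x y : X, ∃ g ∈ permGroup σ, g x = y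

/-- A left quasigroup is irretractable if `σ_x = σ_y` implies `x = y`. -/
def Irretractable {X : Type*} (σ : X → Equiv.Perm X) : Prop :=
  ∀ x y : X, σ x = σ y → x = y

/-- A left quasigroup is latin if every right translation is bijective. -/
def LatinLQ {X : Type*} (σ : X → Equiv.Perm X) : Prop :=
  ∀ x : X, Function.Bijective fun y => σ y x

/-- A congruence of a left quasigroup. -/
def IsCongruence {X : Type*} (σ : X → Equiv.Perm X) (r : X → X → Prop) : Prop :=
  Equivalence r ∧
  (∀ x x' y y' : X, r x x' → r y y' → r (σ x y) (σ x' y')) ∧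
  (∀ x x' y y' : X, r x x' → r y y' → r ((σ x).symm y) ((σ x').symm y'))

/-- A left quasigroup is simple if it is indecomposable and its only congruences are
the equality relation and the total relation. -/
def SimpleLQ {X : Type*} (σ : X → Equiv.Perm X) : Prop :=
  Indecomposable σ ∧ ∀ r : X → X → Prop, IsCongruence σ r →
    (∀ a b : X, r a b ↔ a = b) ∨ (∀ a b : X, r a b)

/-- The cycle set identity `(x·y)·(x·z) = (y·x)·(y·z)`. -/
def CycleSetLaw {X : Type*} (σ : X → Equiv.Perm X) : Prop :=
  ∀ x y z : X, σ (σ x y) (σ x z) = σ (σ y x) (σ y z)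

/-- Non-degeneracy: the squaring map `x ↦ x·x` is bijective. -/
def Nondeg {X : Type*} (σ : X → Equiv.Perm X) : Prop :=
  Function.Bijective fun x : X => σ x x

/-- The displacement group acts transitively. -/
def DisTransitive {X : Type*} (σ : X → Equiv.Perm X) : Prop :=
  ∀ x y : X, ∃ g ∈ dis σ, (g : Equiv.Perm X) x = y

/-- A system of `p` blocks of size `p`, indexed by `b`, on which `G` acts by translations
given by `c`; the kernel of `c` is elementary abelian and acts on each block through a cyclic group
of order dividing `p`. -/
structure BlockSystem (p : ℕ) (G X : Type*) [Group G] [MulAction G X] where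
  b : X → ZMod p
  c : G → ZMod p
  c_mul : ∀ g h, c (g * h) = c g + c h
  b_smul : ∀ g x, b (g • x) = b x + c g
  surj : Function.Surjective c
  comm : ∀ g h, c g = 0 → c h = 0 → g * h = h * g
  pow_eq_one : ∀ g, c g = 0 → g ^ p = 1
  exists_pow_smul : ∀ g x y, c g = 0 → b x = b y → g • x ≠ x → ∃ k : ℕ, g ^ k • x = y

theorem Subgroup.normal_of_index_eq_of_card_prime_pow {G : Type*} [Group G] {p n : ℕ}
    (hp : p.Prime) (hG : Nat.card G = p ^ n) (H : Subgroup G) (hH : H.index = p) : H.Normal := by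
  apply Subgroup.normal_of_index_eq_minFac_card
  have hn : n ≠ 0 := by
    rintro rfl
    have := H.index_dvd_card
    rw [hH, hG, pow_zero, Nat.dvd_one] at this
    exact hp.one_lt.ne' this
  rw [hH, hG, hp.pow_minFac hn]

/-- A transitive `p`-group of degree `p ^ 2` has a system of `p` blocks of size `p`. -/
theorem exists_blockSystem {G X : Type*} [Group G] [Finite G] [MulAction G X] [FaithfulSMul G X]
    [MulAction.IsPretransitive G X] {p α : ℕ} [hp : Fact p.Prime] (hG : Nat.card G = p ^ α)
    (hX : Nat.card X = p ^ 2) : Nonempty (BlockSystem p G X) := by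
  have hp0 := hp.out.pos
  have : Nonempty X := (Nat.card_pos_iff.1 (hX ▸ pow_pos hp0 2)).1
  obtain ⟨z⟩ := this
  have hst (x : X) : Nat.card (MulAction.stabilizer G x) * p ^ 2 = p ^ α := by
    rw [← hX, ← MulAction.index_stabilizer_of_transitive G x, Subgroup.card_mul_index, hG]
  have hα : 2 ≤ α := (Nat.pow_dvd_pow_iff_le_right hp.out.one_lt).1
    (Dvd.intro_left _ (hst z))
  obtain ⟨β, rfl⟩ := Nat.exists_eq_add_of_le' hα
  have hst' (x : X) : Nat.card (MulAction.stabilizer G x) = p ^ β := by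
    have := hst x
    rw [pow_add] at this
    exact Nat.eq_of_mul_eq_mul_right (pow_pos hp0 2) this
  obtain ⟨K, hK, hzK⟩ := Sylow.exists_subgroup_card_pow_prime_le p
    (by rw [hG]; exact pow_dvd_pow _ (by lia)) (MulAction.stabilizer G z) (hst' z)
    (Nat.le_succ β)
  have hKi : K.index = p := by
    have := K.card_mul_index
    rw [hK, hG, pow_succ p (β + 1)] at this
    exact Nat.eq_of_mul_eq_mul_left (pow_pos hp0 _) this
  have hKn : K.Normal := Subgroup.normal_of_index_eq_of_card_prime_pow hp.out hG K hKi
  have e : G ⧸ K ≃* Multiplicative (ZMod p) :=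
    mulEquivOfPrimeCardEq (p := p) (by rw [← hKi]; rfl) (by simp)
  let c : G → ZMod p := fun g => (e (QuotientGroup.mk g)).toAdd
  have c_mul (g h : G) : c (g * h) = c g + c h := by simp [c]
  have c_ker (g : G) : c g = 0 ↔ g ∈ K := by
    simp [c]
  have hex (x : X) : ∃ g : G, g • z = x := MulAction.exists_smul_eq G z x
  choose r hr using hex
  have c_inv (g : G) : c g⁻¹ = - c g := by
    have := c_mul g⁻¹ g
    rw [inv_mul_cancel, (c_ker 1).2 K.one_mem] at this
    exact eq_neg_of_add_eq_zero_left this.symm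
  have hb (g : G) : c (r (g • z)) = c g := by
    have h1 : g⁻¹ * r (g • z) ∈ K := hzK (by
      rw [MulAction.mem_stabilizer_iff, mul_smul, hr, inv_smul_smul])
    rw [← c_ker, c_mul, c_inv] at h1
    exact (neg_add_eq_zero.1 h1).symm
  have b_smul (g : G) (x : X) : c (r (g • x)) = c (r x) + c g := by
    conv_lhs => rw [← hr x, ← mul_smul, hb, c_mul, add_comm]
  have stab_le (x : X) : MulAction.stabilizer G x ≤ K := by
    intro g hg
    have := b_smul g x
    rw [MulAction.mem_stabilizer_iff.1 hg] at this
    exact (c_ker g).1 (by simpa using this)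
  have hidx (x : X) : ((MulAction.stabilizer G x).subgroupOf K).index = p := by
    have := Subgroup.relIndex_mul_index (stab_le x)
    rw [MulAction.index_stabilizer_of_transitive, hX, hKi, sq] at this
    exact Nat.eq_of_mul_eq_mul_right hp0 this
  have hnorm (x : X) : ((MulAction.stabilizer G x).subgroupOf K).Normal :=
    Subgroup.normal_of_index_eq_of_card_prime_pow hp.out hK _ (hidx x)
  have hcard (x : X) : Nat.card (K ⧸ (MulAction.stabilizer G x).subgroupOf K) = p := hidx x
  have key (x : X) (g h : K) : (QuotientGroup.mk g : K ⧸ (MulAction.stabilizer G x).subgroupOf K)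
      = QuotientGroup.mk h ↔ (g : G) • x = (h : G) • x := by
    rw [QuotientGroup.eq, Subgroup.mem_subgroupOf, MulAction.mem_stabilizer_iff]
    push_cast
    rw [mul_smul, inv_smul_eq_iff, eq_comm]
  refine ⟨⟨fun x => c (r x), c, c_mul, b_smul, ?_, ?_, ?_, ?_⟩⟩
  · intro i
    obtain ⟨q, hq⟩ := e.surjective (Multiplicative.ofAdd i)
    obtain ⟨g, rfl⟩ := QuotientGroup.mk_surjective q
    exact ⟨g, by simp [c, hq]⟩
  · intro g h hg hh
    rw [c_ker] at hg hh
    apply FaithfulSMul.eq_of_smul_eq_smul (α := X)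
    intro x
    have := (key x (⟨g, hg⟩ * ⟨h, hh⟩) (⟨h, hh⟩ * ⟨g, hg⟩)).1 (by
      have : IsCyclic (K ⧸ (MulAction.stabilizer G x).subgroupOf K) :=
        isCyclic_of_prime_card (hcard x)
      have := this.isMulCommutative
      rw [QuotientGroup.mk_mul, QuotientGroup.mk_mul]
      exact mul_comm' _ _)
    exact this
  · intro g hg
    rw [c_ker] at hg
    apply FaithfulSMul.eq_of_smul_eq_smul (α := X)
    intro x
    have := (key x (⟨g, hg⟩ ^ p) 1).1 (by
      rw [QuotientGroup.mk_pow]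
      conv_lhs => rw [← hcard x]
      exact pow_card_eq_one')
    exact this
  · intro g x y hg hxy hgx
    rw [c_ker] at hg
    obtain ⟨h, rfl⟩ := MulAction.exists_smul_eq G x y
    have hh : h ∈ K := by
      rw [b_smul] at hxy
      exact (c_ker h).1 (by simpa using hxy.symm)
    have h1 : (QuotientGroup.mk ⟨g, hg⟩ : K ⧸ (MulAction.stabilizer G x).subgroupOf K) ≠ 1 := by
      intro h
      exact hgx (by simpa using (key x ⟨g, hg⟩ 1).1 h)
    obtain ⟨k, hk⟩ := mem_powers_of_prime_card (hcard x) (g' := QuotientGroup.mk ⟨h, hh⟩) h1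
    exact ⟨k, (key x (⟨g, hg⟩ ^ k) ⟨h, hh⟩).1 (by rw [QuotientGroup.mk_pow]; exact hk)⟩

/-- The brace-like structure attached to a cycle set: a group `G` acting on a set `X`, an abelian
group `A` with a `G`-action, a bijective cocycle `s : A → G`, and an equivariant map `ι : X → A`
whose image generates `A`. -/
structure BraceAction (G A X : Type*) [Group G] [AddCommGroup A] [MulAction G X]
    [DistribMulAction G A] where
  s : A → G
  ι : X → A
  bij : Function.Bijective s
  s_add : ∀ a b, s (a + b) = s (s a • b) * s a
  smul_ι : ∀ (g : G) (x : X), g • ι x = ι (g • x)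
  closure_ι : AddSubgroup.closure (Set.range ι) = ⊤

theorem smul_nsmul_comm {G A : Type*} [Monoid G] [AddCommGroup A] [DistribMulAction G A] (g : G)
    (k : ℕ) (a : A) : g • k • a = k • g • a :=
  map_nsmul (DistribSMul.toAddMonoidHom A g) k a

theorem ZMod.exists_natCast_mul_eq {p : ℕ} [Fact p.Prime] {u : ZMod p} (hu : u ≠ 0)
    (x : ZMod p) : ∃ k : ℕ, (k : ZMod p) * u = x :=
  ⟨(x * u⁻¹).val, by rw [ZMod.natCast_zmod_val, mul_assoc, inv_mul_cancel₀ hu, mul_one]⟩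

theorem ZMod.eq_of_periodic {p : ℕ} [Fact p.Prime] {α : Type*} {f : ZMod p → α} {d : ZMod p}
    (hd : d ≠ 0) (hf : Function.Periodic f d) (i j : ZMod p) : f i = f j := by
  obtain ⟨k, hk⟩ := ZMod.exists_natCast_mul_eq hd (i - j)
  have := hf.nat_mul k j
  rwa [hk, add_sub_cancel] at this

/-- A function on `ZMod p` defining a cycle set `i · j = j + f i` is constant, unless it
vanishes. -/
theorem eq_of_cycleSet_translations {p : ℕ} [Fact p.Prime] {f : ZMod p → ZMod p}
    (hf : ∀ i j, f (j + f i) + f i = f (i + f j) + f j) {i₀ : ZMod p} (h₀ : f i₀ ≠ 0)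
    (j : ZMod p) : f j = f i₀ := by
  have hstep (j j' : ZMod p) (h : f j = f j') : f (j + f i₀) = f (j' + f i₀) := by
    have h1 := hf i₀ j
    have h2 := hf i₀ j'
    rw [h, ← h2] at h1
    exact add_right_cancel h1
  by_cases hinj : Function.Injective f
  · exfalso
    have hsurj := Finite.surjective_of_injective hinj
    obtain ⟨k, hk⟩ := hsurj 0
    obtain ⟨i, hi⟩ := hsurj (i₀ - k)
    have := hf i k
    rw [hk, hi] at this
    simp only [add_sub_cancel, add_zero, hi] at this
    exact h₀ (by simpa using this)
  · simp only [Function.Injective, not_forall] at hinj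
    obtain ⟨k, k', hkk, hne⟩ := hinj
    have h1 (m : ℕ) : f (k + m * f i₀) = f (k' + m * f i₀) := by
      induction m with
      | zero => simpa using hkk
      | succ m ih =>
        have := hstep _ _ ih
        push_cast
        ring_nf at this ⊢
        exact this
    have h2 (x : ZMod p) : f (x + (k' - k)) = f x := by
      obtain ⟨m, hm⟩ := ZMod.exists_natCast_mul_eq h₀ (x - k)
      have := h1 m
      rw [hm] at this
      ring_nf at this ⊢
      exact this.symm
    exact ZMod.eq_of_periodic (sub_ne_zero.2 (Ne.symm hne)) h2 _ _

namespace BraceAction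

variable {G A X : Type*} [Group G] [AddCommGroup A] [MulAction G X] [DistribMulAction G A]

theorem s_zero (B : BraceAction G A X) : B.s 0 = 1 := by
  have := B.s_add 0 0
  rw [smul_zero, add_zero] at this
  exact (mul_eq_left.1 this.symm)

theorem s_comm (B : BraceAction G A X) (a b : A) :
    B.s (B.s a • b) * B.s a = B.s (B.s b • a) * B.s b := by
  rw [← B.s_add, ← B.s_add, add_comm]

theorem s_add_of_smul_eq (B : BraceAction G A X) {a b : A} (h : B.s b • a = a) :
    B.s (a + b) = B.s a * B.s b := by
  rw [add_comm, B.s_add, h]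

theorem s_smul_of_smul_eq (B : BraceAction G A X) {a b : A} (h : B.s b • a = a) :
    B.s (B.s a • b) = B.s a * B.s b * (B.s a)⁻¹ := by
  rw [← B.s_add_of_smul_eq h, B.s_add, mul_inv_cancel_right]

theorem s_nsmul_add (B : BraceAction G A X) {a : A} (h : ∀ g : G, g • a = a) (k : ℕ) (b : A) :
    B.s (k • a + b) = B.s a ^ k * B.s b := by
  induction k with
  | zero => simp
  | succ k ih => rw [succ_nsmul', add_assoc, B.s_add_of_smul_eq (h _), ih, pow_succ', mul_assoc]

theorem s_nsmul (B : BraceAction G A X) {a : A} (h : ∀ g : G, g • a = a) (k : ℕ) :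
    B.s (k • a) = B.s a ^ k := by
  simpa [B.s_zero] using B.s_nsmul_add h k 0

@[elab_as_elim]
theorem induction_on [Finite A] (B : BraceAction G A X) {motive : A → Prop} (a : A)
    (zero : motive 0) (add_ι : ∀ a x, motive a → motive (a + B.ι x)) : motive a := by
  have ha : a ∈ AddSubmonoid.closure (Set.range B.ι) := by
    rw [← AddSubgroup.closure_toAddSubmonoid_of_finite, B.closure_ι]
    trivial
  induction ha using AddSubmonoid.closure_induction_right with
  | zero => exact zero
  | add_right x hx y hy ih =>
    obtain ⟨z, rfl⟩ := hy
    exact add_ι _ _ ih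

/-- An additive character `A → ZMod p` which is constant and nonzero on `X` and vanishes on
stabilizers of points. -/
def HasCharacter (p : ℕ) (B : BraceAction G A X) : Prop :=
  ∃ (f : A →+ ZMod p) (u : ZMod p), u ≠ 0 ∧ (∀ x, f (B.ι x) = u) ∧
    ∀ a (z : X), B.s a • z = z → f a = 0

/-- A function `f` such that `f (a + ι x) - f a` does not depend on `a` is additive. -/
theorem exists_addMonoidHom [Finite A] (B : BraceAction G A X) {R : Type*} [AddCommGroup R]
    {f : A → R} {u : X → R} (hf0 : f 0 = 0) (hf : ∀ a x, f (a + B.ι x) = f a + u x) :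
    ∃ F : A →+ R, ∀ a, F a = f a := by
  refine ⟨⟨⟨f, hf0⟩, fun a b => ?_⟩, fun a => rfl⟩
  induction b using B.induction_on with
  | zero => simp [hf0]
  | add_ι b x ih => simp only at ih ⊢; rw [← add_assoc, hf, hf, ih, add_assoc]

section BlockSystem

variable {p : ℕ} [hp : Fact p.Prime] (B : BraceAction G A X) (S : BlockSystem p G X)

theorem _root_.BlockSystem.c_one : S.c 1 = 0 := by
  simpa using S.c_mul 1 1

theorem c_smul_comm (a b : A) :
    S.c (B.s (B.s a • b)) + S.c (B.s a) = S.c (B.s (B.s b • a)) + S.c (B.s b) := by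
  rw [← S.c_mul, B.s_comm, S.c_mul]

theorem c_add (a b : A) : S.c (B.s (a + b)) = S.c (B.s (B.s a • b)) + S.c (B.s a) := by
  rw [B.s_add, S.c_mul]

theorem _root_.BlockSystem.smul_eq_self [MulAction.IsPretransitive G X] {g : G} (hg : S.c g = 0)
    {x y : X} (hxy : S.b x = S.b y) (h : g • x = x) : g • y = y := by
  obtain ⟨k, rfl⟩ := MulAction.exists_smul_eq G x y
  have hk : S.c k = 0 := by simpa [S.b_smul] using hxy
  rw [← mul_smul, S.comm _ _ hg hk, mul_smul, h]

/-- A nonzero fixed vector acting trivially on the blocks yields a character. -/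
theorem hasCharacter_of_fixed [Finite A] [FaithfulSMul G X] [MulAction.IsPretransitive G X]
    {a₀ : A} (h0 : a₀ ≠ 0) (hfix : ∀ g : G, g • a₀ = a₀) (hc : S.c (B.s a₀) = 0) :
    B.HasCharacter p := by
  have hn1 : B.s a₀ ≠ 1 := fun h => h0 (B.bij.1 (by rw [h, B.s_zero]))
  have hinv (y : A) : S.c (B.s (B.s a₀ • y)) = S.c (B.s y) := by
    have := B.c_smul_comm S a₀ y
    rwa [hfix, hc, add_zero, zero_add] at this
  have hpow (k : ℕ) (x : X) : S.c (B.s (B.ι (B.s a₀ ^ k • x))) = S.c (B.s (B.ι x)) := by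
    induction k with
    | zero => simp
    | succ k ih => rw [pow_succ', mul_smul, ← B.smul_ι, hinv, ih]
  have hzero (x : X) (hx : B.s a₀ • x = x) : S.c (B.s (B.ι x)) = 0 := by
    by_contra hne
    apply hn1
    have hcomm : B.s (B.ι x) * B.s a₀ = B.s a₀ * B.s (B.ι x) := by
      have := B.s_smul_of_smul_eq (hfix (B.s (B.ι x)))
      rw [B.smul_ι, hx] at this
      exact eq_mul_inv_iff_mul_eq.1 this
    have hk (k : ℕ) : B.s a₀ • (B.s (B.ι x) ^ k • x) = B.s (B.ι x) ^ k • x ∧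
        S.b (B.s (B.ι x) ^ k • x) = S.b x + k * S.c (B.s (B.ι x)) := by
      induction k with
      | zero => simpa using hx
      | succ k ih =>
        refine ⟨?_, ?_⟩
        · rw [pow_succ', mul_smul, ← mul_smul (B.s a₀), ← hcomm, mul_smul, ih.1]
        · rw [pow_succ', mul_smul, S.b_smul, ih.2]
          push_cast
          ring
    apply FaithfulSMul.eq_of_smul_eq_smul (α := X)
    intro y
    obtain ⟨k, hk'⟩ := ZMod.exists_natCast_mul_eq hne (S.b y - S.b x)
    rw [one_smul]
    refine S.smul_eq_self hc ?_ (hk k).1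
    rw [(hk k).2, hk', add_sub_cancel]
  have hdep (x y : X) (hxy : S.b x = S.b y) : S.c (B.s (B.ι x)) = S.c (B.s (B.ι y)) := by
    by_cases hx : B.s a₀ • x = x
    · rw [hzero x hx, hzero y (S.smul_eq_self hc hxy hx)]
    · obtain ⟨k, rfl⟩ := S.exists_pow_smul _ x y hc hxy hx
      rw [hpow]
  have hbsurj (x : X) (i : ZMod p) : ∃ y, S.b y = i := by
    obtain ⟨g, hg⟩ := S.surj (i - S.b x)
    exact ⟨g • x, by rw [S.b_smul, hg, add_sub_cancel]⟩
  have hc0 : S.c (B.s 0) = 0 := by rw [B.s_zero, S.c_one]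
  obtain ⟨x₀, hx₀⟩ : ∃ x, S.c (B.s (B.ι x)) ≠ 0 := by
    by_contra! hall
    have : ∀ a, S.c (B.s a) = 0 := by
      intro a
      induction a using B.induction_on with
      | zero => exact hc0
      | add_ι a x ih => rw [B.c_add, B.smul_ι, hall, ih, add_zero]
    obtain ⟨g, hg⟩ := S.surj 1
    obtain ⟨a, rfl⟩ := B.bij.2 g
    rw [this] at hg
    exact zero_ne_one hg
  choose r hr using hbsurj x₀
  have hf (x : X) : S.c (B.s (B.ι x)) = S.c (B.s (B.ι (r (S.b x)))) := hdep _ _ (hr _).symm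
  have hconst (x : X) : S.c (B.s (B.ι x)) = S.c (B.s (B.ι x₀)) := by
    rw [hf x, hf x₀]
    refine eq_of_cycleSet_translations (f := fun i => S.c (B.s (B.ι (r i)))) (fun i j => ?_)
      (i₀ := S.b x₀) (by simpa only [← hf x₀] using hx₀) _
    have := B.c_smul_comm S (B.ι (r i)) (B.ι (r j))
    rw [B.smul_ι, B.smul_ι, hf (B.s (B.ι (r i)) • r j), hf (B.s (B.ι (r j)) • r i), S.b_smul,
      S.b_smul, hr, hr] at this
    exact this
  obtain ⟨F, hF⟩ := B.exists_addMonoidHom (f := fun a => S.c (B.s a)) (u := fun _ => S.c (B.s (B.ι x₀)))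
    hc0 (fun a x => by rw [B.c_add, B.smul_ι, hconst, add_comm])
  refine ⟨F, _, hx₀, fun x => by rw [hF, hconst], fun a z haz => ?_⟩
  have := S.b_smul (B.s a) z
  rw [haz] at this
  rw [hF]
  simpa using this

end BlockSystem

end BraceAction

theorem IsPGroup.exists_fixed_ne_zero {G A : Type*} [Group G] [AddCommGroup A]
    [DistribMulAction G A] [Finite A] {p : ℕ} [Fact p.Prime] (hG : IsPGroup p G)
    (hA : p ∣ Nat.card A) : ∃ a : A, a ≠ 0 ∧ ∀ g : G, g • a = a := by
  obtain ⟨a, ha, h0⟩ := hG.exists_fixed_point_of_prime_dvd_card_of_fixed_point A hA (a := 0)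
    (fun g => smul_zero g)
  exact ⟨a, h0.symm, ha⟩

/-- A `p`-group acting on an abelian `p`-group `A` fixes a nontrivial coset of any proper invariant
subgroup of `A`. -/
theorem IsPGroup.exists_smul_sub_mem {G A : Type*} [Group G] [AddCommGroup A]
    [DistribMulAction G A] [Finite A] {p : ℕ} [Fact p.Prime] (hG : IsPGroup p G)
    (Z : AddSubgroup A) (hZ : ∀ (g : G), ∀ a ∈ Z, g • a ∈ Z) (hA : p ∣ Z.index) :
    ∃ a ∉ Z, ∀ g : G, g • a - a ∈ Z := by
  let f (g : G) : A ⧸ Z →+ A ⧸ Z :=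
    QuotientAddGroup.map Z Z (DistribSMul.toAddMonoidHom A g) (hZ g)
  let _ : DistribMulAction G (A ⧸ Z) :=
    { smul g := f g
      one_smul q := by
        induction q using QuotientAddGroup.induction_on with | H a => ?_
        exact congrArg _ (one_smul G a)
      mul_smul g h q := by
        induction q using QuotientAddGroup.induction_on with | H a => ?_
        exact congrArg _ (mul_smul g h a)
      smul_zero g := map_zero (f g)
      smul_add g := map_add (f g) }
  obtain ⟨q, hq, hfix⟩ := hG.exists_fixed_ne_zero (A := A ⧸ Z) hA
  induction q using QuotientAddGroup.induction_on with | H a => ?_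
  refine ⟨a, fun h => hq ((QuotientAddGroup.eq_zero_iff a).2 h), fun g => ?_⟩
  rw [← QuotientAddGroup.eq_zero_iff, QuotientAddGroup.mk_sub, sub_eq_zero]
  exact hfix g

namespace BraceAction

variable {G A X : Type*} [Group G] [AddCommGroup A] [MulAction G X] [DistribMulAction G A]

/-- Coordinates `(b, c)` on `X` in which the elements of `G` act by
`(i, j) ↦ (i + c, j + T i)`. -/
structure Coordinates (p : ℕ) (B : BraceAction G A X) extends BlockSystem p G X where
  e : ZMod p →+ A
  smul_e : ∀ (g : G) (i : ZMod p), g • e i = e i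
  c_e : ∀ i, c (B.s (e i)) = i
  coord_ext : ∀ x y, b x = b y → c (B.s (B.ι x)) = c (B.s (B.ι y)) → x = y
  exists_coord : ∀ i j, ∃ x, b x = i ∧ c (B.s (B.ι x)) = j
  T : A →+ (ZMod p → ZMod p)
  c_smul : ∀ a x, c (B.s (B.ι (B.s a • x))) = c (B.s (B.ι x)) + T a (b x)
  T_e : ∀ i, T (e i) = 0
  τ : ZMod p → ZMod p
  T_ι : ∀ x i, T (B.ι x) i = τ (i - b x)
  τ_neg : ∀ i, τ (-i) = τ i
  τ_ne : ∃ i j, τ i ≠ τ j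
  a₁ : A
  w : ZMod p
  w_ne : w ≠ 0
  T_a₁ : ∀ i, T a₁ i = w

section

variable {p : ℕ} [hp : Fact p.Prime] (B : BraceAction G A X) (S : BlockSystem p G X)

theorem exists_fixed_embedding [Finite A] [FaithfulSMul G X] [MulAction.IsPretransitive G X]
    (hG : IsPGroup p G) (hA : p ∣ Nat.card A) (hB : ¬ B.HasCharacter p) :
    ∃ e : ZMod p →+ A, (∀ (g : G) i, g • e i = e i) ∧ ∀ i, S.c (B.s (e i)) = i := by
  obtain ⟨a, ha, hfix⟩ := hG.exists_fixed_ne_zero (A := A) hA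
  have hpow (k : ℕ) (g : G) : S.c (g ^ k) = k * S.c g := by
    induction k with
    | zero => simp [S.c_one]
    | succ k ih => rw [pow_succ, S.c_mul, ih]; push_cast; ring
  have hca : S.c (B.s a) ≠ 0 := fun h => hB (B.hasCharacter_of_fixed S ha hfix h)
  obtain ⟨k, hk⟩ := ZMod.exists_natCast_mul_eq hca 1
  have hfix' (l : ℕ) (g : G) : g • (l • a) = l • a := by
    rw [smul_nsmul_comm, hfix]
  have hc (l : ℕ) : S.c (B.s (l • a)) = l * S.c (B.s a) := by rw [B.s_nsmul hfix, hpow]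
  have hp0 : p • (k • a) = 0 := by
    by_contra hne
    rw [← mul_nsmul'] at hne
    exact hB (B.hasCharacter_of_fixed S hne (hfix' _) (by rw [hc]; simp))
  let e : ZMod p →+ A := ZMod.lift p ⟨zmultiplesHom A (k • a), by simpa using hp0⟩
  have he (l : ℕ) : e l = (l * k) • a := by
    have := ZMod.lift_coe p ⟨zmultiplesHom A (k • a), by simpa using hp0⟩ (l : ℤ)
    rw [mul_nsmul']
    simpa using this
  refine ⟨e, fun g i => ?_, fun i => ?_⟩
  · rw [← ZMod.natCast_zmod_val i, he, hfix']
  · rw [← ZMod.natCast_zmod_val i, he, hc]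
    push_cast
    rw [mul_assoc, hk, mul_one]

theorem c_e_add {e : ZMod p →+ A} (hfix : ∀ (g : G) i, g • e i = e i)
    (hce : ∀ i, S.c (B.s (e i)) = i) (i : ZMod p) (a : A) :
    S.c (B.s (e i + a)) = i + S.c (B.s a) := by
  rw [B.s_add_of_smul_eq (hfix _ _), S.c_mul, hce]

theorem exists_fixed_modulo [Finite A] (hG : IsPGroup p G) (hA : p ^ 2 ∣ Nat.card A)
    {e : ZMod p →+ A} (hfix : ∀ (g : G) i, g • e i = e i) (hce : ∀ i, S.c (B.s (e i)) = i) :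
    ∃ a, a ≠ 0 ∧ S.c (B.s a) = 0 ∧ ∀ g : G, g • a = a + e (S.c (B.s (g • a))) := by
  have heinj : Function.Injective e := fun i j h => by rw [← hce i, h, hce]
  have hcard : Nat.card e.range = p :=
    (Nat.card_congr (AddMonoidHom.ofInjective heinj).toEquiv).symm.trans (Nat.card_zmod p)
  have hidx : p ∣ e.range.index := by
    rw [← e.range.card_mul_index, hcard, sq] at hA
    exact Nat.dvd_of_mul_dvd_mul_left hp.out.pos hA
  obtain ⟨a, ha, hga⟩ := hG.exists_smul_sub_mem e.range (by
    rintro g _ ⟨i, rfl⟩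
    exact ⟨i, (hfix g i).symm⟩) hidx
  have hc0 : S.c (B.s (e (-S.c (B.s a)) + a)) = 0 := by
    rw [B.c_e_add S hfix hce, neg_add_cancel]
  refine ⟨e (-S.c (B.s a)) + a, fun h => ha ⟨S.c (B.s a), ?_⟩, hc0, fun g => ?_⟩
  · rw [map_neg, neg_add_eq_zero] at h
    exact h
  · obtain ⟨i, hi⟩ := hga g
    have h1 : g • (e (-S.c (B.s a)) + a) = e i + (e (-S.c (B.s a)) + a) := by
      rw [smul_add, hfix, hi]
      abel
    rw [h1, B.c_e_add S hfix hce, hc0, add_zero, add_comm]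

end

end BraceAction

namespace BraceAction

variable {G A X : Type*} [Group G] [AddCommGroup A] [MulAction G X] [DistribMulAction G A]
  {p : ℕ} [hp : Fact p.Prime] (B : BraceAction G A X) (S : BlockSystem p G X)

theorem c_smul_e {e : ZMod p →+ A} (hfix : ∀ (g : G) i, g • e i = e i) (i : ZMod p) (a : A) :
    S.c (B.s (B.s (e i) • a)) = S.c (B.s a) := by
  have := B.c_smul_comm S (e i) a
  rw [hfix, add_comm] at this
  exact add_left_cancel this

theorem exists_b_smul_e_eq {e : ZMod p →+ A} (hce : ∀ i, S.c (B.s (e i)) = i) (x : X)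
    (i : ZMod p) : ∃ j, S.b (B.s (e j) • x) = i :=
  ⟨i - S.b x, by rw [S.b_smul, hce, add_sub_cancel]⟩

theorem c_smul_of_c_eq_zero {a₁ : A} (h₁ : S.c (B.s a₁) = 0) (y : A) :
    S.c (B.s (B.s a₁ • y)) = S.c (B.s y) + S.c (B.s (B.s y • a₁)) := by
  have := B.c_smul_comm S a₁ y
  rw [h₁, add_zero] at this
  rw [this, add_comm]

/-- An almost fixed vector `a₁` is moved by the same amount by all `s (ι x)`. -/
theorem exists_smul_eq_add_const [Finite A] [FaithfulSMul G X] [MulAction.IsPretransitive G X]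
    [Nonempty X] (hB : ¬ B.HasCharacter p) {e : ZMod p →+ A} (hfix : ∀ (g : G) i, g • e i = e i)
    (hce : ∀ i, S.c (B.s (e i)) = i) {a₁ : A} (h0 : a₁ ≠ 0) (h₁ : S.c (B.s a₁) = 0)
    (hmod : ∀ g : G, g • a₁ = a₁ + e (S.c (B.s (g • a₁)))) :
    ∃ w : ZMod p, w ≠ 0 ∧ (∀ x, S.c (B.s (B.s (B.ι x) • a₁)) = w) ∧
      ∃ F : A →+ ZMod p, ∀ x, F (B.ι x) = w := by
  obtain ⟨φ, hφ⟩ : ∃ φ : A → ZMod p, ∀ a, φ a = S.c (B.s (B.s a • a₁)) := ⟨_, fun _ => rfl⟩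
  have hφ_add (a b : A) : φ (a + b) = φ (B.s a • b) + φ a := by
    rw [hφ, B.s_add, mul_smul, hmod (B.s a), smul_add, hfix, add_comm, B.c_e_add S hfix hce,
      ← hφ, ← hφ, add_comm]
  have hφ_e (i : ZMod p) : φ (e i) = 0 := by rw [hφ, B.c_smul_e S hfix, h₁]
  have hφ_smul_e (i : ZMod p) (y : A) : φ (B.s (e i) • y) = φ y := by
    have h := hφ_add (e i) y
    rw [add_comm, hφ_add, hfix, hφ_e] at h
    simpa using h.symm
  have hφ_smul (y : A) : φ (B.s a₁ • y) = φ y := by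
    have h := hφ_add a₁ y
    have h2 : φ (a₁ + e (φ y)) = φ a₁ := by
      rw [add_comm, hφ_add, hφ_smul_e, hφ_e, add_zero]
    rw [add_comm a₁, hφ_add, hmod, ← hφ, h2, add_comm] at h
    exact (add_right_cancel h).symm
  have hpow (k : ℕ) (x : X) : φ (B.ι (B.s a₁ ^ k • x)) = φ (B.ι x) := by
    induction k with
    | zero => simp
    | succ k ih => rw [pow_succ', mul_smul, ← B.smul_ι, hφ_smul, ih]
  have hn1 : B.s a₁ ≠ 1 := fun h => h0 (B.bij.1 (by rw [h, B.s_zero]))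
  have hφ0 : φ 0 = 0 := by simpa using hφ_e 0
  have hconst (x₀ : X) (hx₀ : B.s a₁ • x₀ ≠ x₀) (x : X) : φ (B.ι x) = φ (B.ι x₀) := by
    obtain ⟨j, hj⟩ := B.exists_b_smul_e_eq S hce x (S.b x₀)
    obtain ⟨k, hk⟩ := S.exists_pow_smul _ x₀ _ h₁ hj.symm hx₀
    rw [← hφ_smul_e j, B.smul_ι, ← hk, hpow]
  obtain ⟨x₀, hx₀⟩ : ∃ x₀ : X, B.s a₁ • x₀ ≠ x₀ := by
    by_contra! hall
    exact hn1 (FaithfulSMul.eq_of_smul_eq_smul (α := X) fun x => by rw [hall, one_smul])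
  have hw : φ (B.ι x₀) ≠ 0 := by
    intro hzero
    have hall (a : A) : φ a = 0 := by
      induction a using B.induction_on with
      | zero => exact hφ0
      | add_ι a x ih => rw [hφ_add, B.smul_ι, hconst x₀ hx₀, hzero, ih, add_zero]
    refine hB (B.hasCharacter_of_fixed S h0 (fun g => ?_) h₁)
    obtain ⟨a, rfl⟩ := B.bij.2 g
    rw [hmod, ← hφ, hall, map_zero, add_zero]
  obtain ⟨F, hF⟩ := B.exists_addMonoidHom (f := φ) (u := fun _ => φ (B.ι x₀)) hφ0
    (fun a x => by rw [hφ_add, B.smul_ι, hconst x₀ hx₀, add_comm])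
  exact ⟨_, hw, fun x => by rw [← hφ, hconst x₀ hx₀], F, fun x => by rw [hF, hconst x₀ hx₀]⟩

/-- If `a₁` shifts the coordinate `c` on `X`, then `S.b` and `c` are coordinates on `X`. -/
theorem coord_bijective [Nonempty X] {a₁ : A} (h₁ : S.c (B.s a₁) = 0) {w : ZMod p} (hw : w ≠ 0)
    (hn : ∀ x, S.c (B.s (B.ι (B.s a₁ • x))) = S.c (B.s (B.ι x)) + w) :
    (∀ x y, S.b x = S.b y → ∃ k : ℕ, B.s a₁ ^ k • x = y) ∧
    (∀ x y, S.b x = S.b y → S.c (B.s (B.ι x)) = S.c (B.s (B.ι y)) → x = y) ∧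
    ∀ i j, ∃ x, S.b x = i ∧ S.c (B.s (B.ι x)) = j := by
  have hne (x : X) : B.s a₁ • x ≠ x := fun h => hw (by simpa [h] using hn x)
  have hpow (k : ℕ) (x : X) :
      S.b (B.s a₁ ^ k • x) = S.b x ∧
      S.c (B.s (B.ι (B.s a₁ ^ k • x))) = S.c (B.s (B.ι x)) + k * w := by
    induction k with
    | zero => simp
    | succ k ih =>
      rw [pow_succ', mul_smul, S.b_smul, h₁, hn, ih.1, ih.2]
      push_cast
      exact ⟨add_zero _, by ring⟩
  have hex (x y : X) (hxy : S.b x = S.b y) : ∃ k : ℕ, B.s a₁ ^ k • x = y :=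
    S.exists_pow_smul _ x y h₁ hxy (hne x)
  refine ⟨hex, fun x y hxy hc => ?_, fun i j => ?_⟩
  · obtain ⟨k, rfl⟩ := hex x y hxy
    rw [(hpow k x).2, left_eq_add, mul_eq_zero, or_iff_left hw,
      ZMod.natCast_eq_zero_iff] at hc
    obtain ⟨l, rfl⟩ := hc
    rw [pow_mul, S.pow_eq_one _ h₁, one_pow, one_smul]
  · obtain ⟨x⟩ := ‹Nonempty X›
    obtain ⟨g, hg⟩ := S.surj (i - S.b x)
    obtain ⟨k, hk⟩ := ZMod.exists_natCast_mul_eq hw (j - S.c (B.s (B.ι (g • x))))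
    refine ⟨B.s a₁ ^ k • (g • x), ?_, ?_⟩
    · rw [(hpow _ _).1, S.b_smul, hg, add_sub_cancel]
    · rw [(hpow _ _).2, hk, add_sub_cancel]

/-- The displacement of the coordinate `c` only depends on the difference of the blocks, and is an
even function of it. -/
theorem exists_even_displacement [Nonempty X] {e : ZMod p →+ A}
    (hfix : ∀ (g : G) i, g • e i = e i) (hce : ∀ i, S.c (B.s (e i)) = i) {a₁ : A}
    (h₁ : S.c (B.s a₁) = 0) (hmod : ∀ g : G, g • a₁ = a₁ + e (S.c (B.s (g • a₁))))
    {w : ZMod p} (hw : w ≠ 0) (hφ : ∀ x, S.c (B.s (B.s (B.ι x) • a₁)) = w) :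
    ∃ τ : ZMod p → ZMod p, (∀ i, τ (-i) = τ i) ∧
      ∀ x y, S.c (B.s (B.ι (B.s (B.ι x) • y))) = S.c (B.s (B.ι y)) + τ (S.b y - S.b x) := by
  have hn (x : X) : S.c (B.s (B.ι (B.s a₁ • x))) = S.c (B.s (B.ι x)) + w := by
    rw [← B.smul_ι, B.c_smul_of_c_eq_zero S h₁, hφ]
  have hg (i : ZMod p) (x : X) : S.c (B.s (B.ι (B.s (e i) • x))) = S.c (B.s (B.ι x)) := by
    rw [← B.smul_ι, B.c_smul_e S hfix]
  obtain ⟨hex, hext, hcoord⟩ := B.coord_bijective S h₁ hw hn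
  obtain ⟨D, hD⟩ : ∃ D : X → X → ZMod p, ∀ x y, D x y =
      S.c (B.s (B.ι (B.s (B.ι x) • y))) - S.c (B.s (B.ι y)) := ⟨_, fun _ _ => rfl⟩
  have hsymm (x y : X) : D x y = D y x := by
    have := B.c_smul_comm S (B.ι x) (B.ι y)
    rw [hD, hD, ← B.smul_ι, ← B.smul_ι]
    linear_combination this
  have hDg (i : ZMod p) (x y : X) : D (B.s (e i) • x) (B.s (e i) • y) = D x y := by
    have h := B.s_comm (e i) (B.ι x)
    rw [hfix, B.smul_ι] at h
    rw [hD, hD, ← mul_smul, h, mul_smul, hg, hg]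
  have hDn (x y : X) : D (B.s a₁ • x) (B.s a₁ • y) = D x y := by
    have h := B.s_comm a₁ (B.ι x)
    rw [hmod, hφ, B.smul_ι, add_comm, B.s_add_of_smul_eq (hfix _ _)] at h
    rw [hD, hD, ← mul_smul, h, mul_smul, mul_smul, hg, hn, hn]
    ring
  have hDk (k : ℕ) (x : X) (hx : S.c (B.s (B.ι x)) = 0) (y : X) :
      D (B.s a₁ ^ k • x) (B.s a₁ • y) = D (B.s a₁ ^ k • x) y := by
    induction k generalizing y with
    | zero =>
      rw [pow_zero, one_smul, hD, hD, ← mul_smul, S.comm _ _ hx h₁, mul_smul, hn, hn]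
      ring
    | succ k ih =>
      rw [pow_succ', mul_smul, hDn]
      conv_rhs => rw [← smul_inv_smul (B.s a₁) y, hDn, ← ih, smul_inv_smul]
  have hDn' (x y : X) : D x (B.s a₁ • y) = D x y := by
    obtain ⟨x₀, hb, hc⟩ := hcoord (S.b x) 0
    obtain ⟨k, rfl⟩ := hex x₀ x hb
    exact hDk k x₀ hc y
  have hDb (x y y' : X) (h : S.b y = S.b y') : D x y = D x y' := by
    obtain ⟨k, rfl⟩ := hex y y' h
    clear h
    induction k with
    | zero => simp
    | succ k ih => rw [pow_succ', mul_smul, hDn', ih]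
  choose r hr _ using hcoord
  have hτ (x y : X) : D x y = D (r 0 0) (r (S.b y - S.b x) 0) := by
    rw [← hDg (- S.b x) x y, hsymm, hDb _ _ (r 0 0), hsymm, hDb]
    · rw [S.b_smul, hce, hr, sub_eq_add_neg]
    · rw [S.b_smul, hce, hr, add_neg_cancel]
  refine ⟨fun i => D (r 0 0) (r i 0), fun i => ?_, fun x y => ?_⟩
  · beta_reduce
    rw [hsymm, hτ, hr, hr, zero_sub, neg_neg]
  · beta_reduce
    rw [← hτ, hD, add_sub_cancel]

theorem hasCharacter_or_coordinates [Finite G] [FaithfulSMul G X]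
    [MulAction.IsPretransitive G X] {α : ℕ} (hcard : Nat.card G = p ^ α)
    (hX : Nat.card X = p ^ 2) : B.HasCharacter p ∨ Nonempty (Coordinates p B) := by
  obtain ⟨S⟩ := exists_blockSystem hcard hX
  have : Nonempty X := (Nat.card_pos_iff.1 (hX ▸ pow_pos hp.out.pos 2)).1
  have : Finite A := Finite.of_injective _ B.bij.1
  have hG : IsPGroup p G := IsPGroup.of_card hcard
  have hA : p ^ 2 ∣ Nat.card A := by
    obtain ⟨z⟩ := ‹Nonempty X›
    rw [Nat.card_eq_of_bijective _ B.bij, ← hX, ← MulAction.index_stabilizer_of_transitive G z]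
    exact Subgroup.index_dvd_card _
  rw [or_iff_not_imp_left]
  intro hB
  obtain ⟨e, hfix, hce⟩ := B.exists_fixed_embedding S hG ((dvd_pow_self p two_ne_zero).trans hA) hB
  obtain ⟨a₁, h0, h₁, hmod⟩ := B.exists_fixed_modulo S hG hA hfix hce
  obtain ⟨w, hw, hφ, F, hF⟩ := B.exists_smul_eq_add_const S hB hfix hce h0 h₁ hmod
  have hn (x : X) : S.c (B.s (B.ι (B.s a₁ • x))) = S.c (B.s (B.ι x)) + w := by
    rw [← B.smul_ι, B.c_smul_of_c_eq_zero S h₁, hφ]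
  obtain ⟨-, hext, hcoord⟩ := B.coord_bijective S h₁ hw hn
  obtain ⟨τ, hneg, hτ⟩ := B.exists_even_displacement S hfix hce h₁ hmod hw hφ
  have hstep (a : A) (t : ZMod p → ZMod p) (x : X)
      (ha : ∀ y, S.c (B.s (B.ι (B.s a • y))) = S.c (B.s (B.ι y)) + t (S.b y)) (y : X) :
      S.c (B.s (B.ι (B.s (a + B.ι x) • y))) =
        S.c (B.s (B.ι y)) + (t (S.b y) + τ (S.b y - S.b x)) := by
    rw [B.s_add, mul_smul, B.smul_ι, hτ, ha, S.b_smul, S.b_smul, add_sub_add_right_eq_sub,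
      add_assoc]
  have hex (a : A) : ∃ t : ZMod p → ZMod p,
      ∀ y, S.c (B.s (B.ι (B.s a • y))) = S.c (B.s (B.ι y)) + t (S.b y) := by
    induction a using B.induction_on with
    | zero => exact ⟨0, fun y => by simp [B.s_zero]⟩
    | add_ι a x ih =>
      obtain ⟨t, ht⟩ := ih
      exact ⟨fun i => t i + τ (i - S.b x), hstep a t x ht⟩
  choose t ht using hex
  have huniq (a : A) (t' : ZMod p → ZMod p)
      (h : ∀ y, S.c (B.s (B.ι (B.s a • y))) = S.c (B.s (B.ι y)) + t' (S.b y)) : t a = t' := by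
    funext i
    obtain ⟨y, rfl, -⟩ := hcoord i 0
    exact add_left_cancel ((ht a y).symm.trans (h y))
  obtain ⟨T, hT⟩ := B.exists_addMonoidHom (f := t) (u := fun x i => τ (i - S.b x))
    (huniq 0 0 fun y => by simp [B.s_zero]) (fun a x => huniq _ _ (hstep a _ x (ht a)))
  by_cases hconst : ∃ i j, τ i ≠ τ j
  · exact ⟨{ S with
      e := e
      smul_e := hfix
      c_e := hce
      coord_ext := hext
      exists_coord := hcoord
      T := T
      c_smul := fun a x => by rw [hT, ht]
      T_e := fun i => by
        rw [hT]
        exact huniq _ _ fun y => by rw [← B.smul_ι, B.c_smul_e S hfix]; simp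
      τ := τ
      T_ι := fun x i => by
        rw [hT, huniq (B.ι x) (fun i => τ (i - S.b x)) (hτ x)]
      τ_neg := hneg
      τ_ne := hconst
      a₁ := a₁
      w := w
      w_ne := hw
      T_a₁ := fun i => by
        rw [hT, huniq a₁ (fun _ => w) hn] }⟩
  · push Not at hconst
    refine absurd ⟨F, w, hw, hF, fun a z haz => ?_⟩ hB
    have hTa (i j : ZMod p) : T a i = T a j := by
      clear haz
      induction a using B.induction_on with
      | zero => simp
      | add_ι a x ih =>
        have := huniq (B.ι x) (fun i => τ (i - S.b x)) (hτ x)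
        rw [map_add, Pi.add_apply, Pi.add_apply, ih, hT (B.ι x), this]
        exact congrArg _ (hconst _ _)
    have hca : S.c (B.s a) = 0 := by
      have := S.b_smul (B.s a) z
      rw [haz] at this
      simpa using this
    have hTz : T a (S.b z) = 0 := by
      have := ht a z
      rw [haz, ← hT] at this
      simpa using this
    have : B.s a = 1 := FaithfulSMul.eq_of_smul_eq_smul (α := X) fun x => by
      rw [one_smul]
      refine hext _ _ (by rw [S.b_smul, hca, add_zero]) ?_
      rw [ht, ← hT, hTa _ (S.b z), hTz, add_zero]
    rw [← B.s_zero] at this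
    rw [B.bij.1 this, map_zero]

end BraceAction

namespace BraceAction.Coordinates

variable {G A X : Type*} [Group G] [AddCommGroup A] [MulAction G X] [DistribMulAction G A]
  {p : ℕ} {B : BraceAction G A X} (C : B.Coordinates p)

theorem e_injective : Function.Injective C.e := fun i j h => by rw [← C.c_e i, h, C.c_e]

theorem eq_of_c_eq_of_T_eq [FaithfulSMul G X] {a a' : A} (hc : C.c (B.s a) = C.c (B.s a'))
    (hT : C.T a = C.T a') : a = a' := by
  refine B.bij.1 (FaithfulSMul.eq_of_smul_eq_smul (α := X) fun x => C.coord_ext _ _ ?_ ?_)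
  · rw [C.b_smul, C.b_smul, hc]
  · rw [C.c_smul, C.c_smul, hT]

variable [hp : Fact p.Prime]

theorem not_periodic {d : ZMod p} (hd : d ≠ 0) : ¬ Function.Periodic C.τ d := by
  obtain ⟨i, j, hij⟩ := C.τ_ne
  exact fun h => hij (ZMod.eq_of_periodic hd h i j)

theorem eq_zero_of_relation (hp2 : p ≠ 2) {j u v : ZMod p}
    (h : ∀ k, j * C.w + u * C.τ k + v * C.τ (k - 1) = 0) : j = 0 ∧ u = 0 ∧ v = 0 := by
  have h' (k : ZMod p) : j * C.w + u * C.τ (k - 1) + v * C.τ k = 0 := by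
    have := h (1 - k)
    rwa [← neg_sub k 1, C.τ_neg, show -(k - 1) - 1 = -k by ring, C.τ_neg] at this
  have huv : u = v := by
    by_contra hne
    refine C.not_periodic one_ne_zero fun k => ?_
    have h1 := h (k + 1)
    have h2 := h' (k + 1)
    rw [add_sub_cancel_right] at h1 h2
    exact sub_eq_zero.1 ((mul_eq_zero_iff_left (sub_ne_zero.2 hne)).1
      (by linear_combination h1 - h2))
  subst huv
  have hu : u = 0 := by
    by_contra hne
    have h2 : (2 : ZMod p) ≠ 0 := by
      intro h
      have : ((2 : ℕ) : ZMod p) = 0 := by exact_mod_cast h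
      rw [ZMod.natCast_eq_zero_iff] at this
      exact hp2 ((Nat.prime_dvd_prime_iff_eq hp.out Nat.prime_two).1 this)
    refine C.not_periodic h2 fun k => ?_
    have h3 := h (k + 2)
    have h4 := h (k + 1)
    rw [show k + 2 - 1 = k + 1 by ring] at h3
    rw [add_sub_cancel_right] at h4
    exact sub_eq_zero.1 ((mul_eq_zero_iff_left hne).1 (by linear_combination h3 - h4))
  subst hu
  exact ⟨by simpa [C.w_ne] using h 0, rfl, rfl⟩

theorem pow_four_le_card (C : B.Coordinates p) [Finite A] (hp2 : p ≠ 2) : p ^ 4 ≤ Nat.card A := by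
  obtain ⟨x, hx, -⟩ := C.exists_coord 0 0
  obtain ⟨y, hy, -⟩ := C.exists_coord 1 0
  let f : ZMod p × ZMod p × ZMod p × ZMod p → A := fun q =>
    C.e q.1 + q.2.1.val • C.a₁ + q.2.2.1.val • B.ι x + q.2.2.2.val • B.ι y
  have hf : Function.Injective f := by
    rintro ⟨i, j, u, v⟩ ⟨i', j', u', v'⟩ h
    simp only [f] at h
    have := C.eq_zero_of_relation hp2 (j := j - j') (u := u - u') (v := v - v') fun k => by
      have := congrFun (congrArg C.T h) k
      simp only [map_add, map_nsmul, C.T_e, Pi.add_apply, Pi.mul_apply, Pi.natCast_apply, C.T_a₁, C.T_ι,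
        hx, hy, nsmul_eq_mul, ZMod.natCast_zmod_val, Pi.zero_apply, sub_zero] at this
      linear_combination this
    simp only [sub_eq_zero] at this
    obtain ⟨rfl, rfl, rfl⟩ := this
    simp only [add_left_inj] at h
    rw [C.e_injective h]
  have := Nat.card_le_card_of_injective f hf
  simp only [Nat.card_prod, Nat.card_zmod] at this
  calc p ^ 4 = _ := by ring
    _ ≤ _ := this

theorem ι_sub_ι_mem_range_iff [FaithfulSMul G X] (x y : X) :
    B.ι x - B.ι y ∈ C.e.range ↔ C.b x = C.b y := by
  constructor
  · rintro ⟨i, hi⟩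
    by_contra hne
    refine C.not_periodic (sub_ne_zero.2 hne) fun k => ?_
    have h := congrFun (congrArg C.T hi) (k + C.b x)
    rw [C.T_e, map_sub, Pi.sub_apply, C.T_ι, C.T_ι, Pi.zero_apply, add_sub_cancel_right,
      add_sub_assoc, eq_comm, sub_eq_zero] at h
    exact h.symm
  · intro h
    refine ⟨C.c (B.s (B.ι x)) - C.c (B.s (B.ι y)), eq_sub_iff_add_eq.2 (C.eq_of_c_eq_of_T_eq ?_ ?_)⟩
    · rw [B.c_e_add C.toBlockSystem C.smul_e C.c_e, sub_add_cancel]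
    · funext i
      rw [map_add, C.T_e, zero_add, C.T_ι, C.T_ι, h]

theorem smul_sub_mem_range [Finite A] [FaithfulSMul G X] {g : G} (hg : C.c g = 0) (v : A) :
    g • v - v ∈ C.e.range := by
  induction v using B.induction_on with
  | zero => simp
  | add_ι a x ih =>
    rw [smul_add, add_sub_add_comm, B.smul_ι]
    exact add_mem ih ((C.ι_sub_ι_mem_range_iff _ _).2 (by rw [C.b_smul, hg, add_zero]))

end BraceAction.Coordinates

/-- The projection of a finite abelian group onto its `p`-primary part is multiplication by an
integer. -/
theorem AddCommGroup.exists_nsmul_projection {A : Type*} [AddCommGroup A] [Finite A] {p α m : ℕ}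
    (hp : p.Prime) (hA : Nat.card A = p ^ α * m) (hm : ¬ p ∣ m) :
    ∃ k : ℕ, (∀ a : A, k • k • a = k • a) ∧
      Nat.card (nsmulAddMonoidHom k : A →+ A).range = p ^ α ∧
      ¬ p ∣ Nat.card (nsmulAddMonoidHom k : A →+ A).ker := by
  have hcop : (p ^ α).Coprime m := Nat.Coprime.pow_left _ ((hp.coprime_iff_not_dvd).2 hm)
  obtain ⟨k, hk1, hk0⟩ := Nat.chineseRemainder hcop 1 0
  have hkm : m ∣ k := (Nat.modEq_zero_iff_dvd).1 hk0
  have hcard (a : A) : (p ^ α * m) • a = 0 := by rw [← hA]; exact card_nsmul_eq_zero'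
  have hkill (a : A) : p ^ α • k • a = 0 := by
    obtain ⟨l, rfl⟩ := hkm
    rw [← mul_nsmul', ← mul_assoc, mul_nsmul, hcard, nsmul_zero]
  have hone (a : A) (ha : p ^ α • a = 0) : k • a = a := by
    have := (nsmul_eq_nsmul_iff_modEq (x := a)).2 (hk1.of_dvd (addOrderOf_dvd_of_nsmul_eq_zero ha))
    rwa [one_nsmul] at this
  have hker : ¬ p ∣ Nat.card (nsmulAddMonoidHom k : A →+ A).ker := by
    intro h
    have := Fact.mk hp
    obtain ⟨⟨a, ha⟩, hpa⟩ := exists_prime_addOrderOf_dvd_card' p h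
    rw [AddSubgroup.addOrderOf_mk] at hpa
    have ha' : k • a = 0 := ha
    have hdvd : p ∣ p ^ α * m := hpa.symm.dvd.trans (addOrderOf_dvd_of_nsmul_eq_zero (hcard a))
    have hpα : p ∣ p ^ α := ((hp.dvd_mul).1 hdvd).resolve_right hm
    have : a = 0 := by
      rw [← hone a (addOrderOf_dvd_iff_nsmul_eq_zero.1 (hpa ▸ hpα)), ha']
    rw [this, addOrderOf_zero] at hpa
    exact hp.one_lt.ne hpa
  have hran : (Nat.card (nsmulAddMonoidHom k : A →+ A).range).Coprime m := by
    refine Nat.coprime_of_dvd fun q hq h1 h2 => ?_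
    have := Fact.mk hq
    obtain ⟨⟨b, hb⟩, hqa⟩ := exists_prime_addOrderOf_dvd_card' q h1
    rw [AddSubgroup.addOrderOf_mk] at hqa
    obtain ⟨a, rfl⟩ := hb
    have : q ∣ p ^ α := hqa ▸ addOrderOf_dvd_of_nsmul_eq_zero (hkill a)
    exact hq.one_lt.ne' (Nat.dvd_one.1 (hcop ▸ Nat.dvd_gcd this h2))
  have hprod := AddSubgroup.card_mul_index (nsmulAddMonoidHom k : A →+ A).ker
  rw [AddSubgroup.index_ker, hA] at hprod
  refine ⟨k, fun a => hone _ (hkill a), Nat.dvd_antisymm ?_ ?_, hker⟩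
  · exact hran.dvd_of_dvd_mul_right (hprod ▸ dvd_mul_left _ _)
  · exact (Nat.Coprime.pow_left α ((hp.coprime_iff_not_dvd).2 hker)).dvd_of_dvd_mul_left
      (hprod ▸ dvd_mul_right _ _)

namespace BraceAction

variable {G A X : Type*} [Group G] [AddCommGroup A] [MulAction G X] [DistribMulAction G A]

/-- The image under `s` of an invariant additive subgroup. -/
def image (B : BraceAction G A X) (H : AddSubgroup A) (hH : ∀ (g : G), ∀ a ∈ H, g • a ∈ H) :
    Subgroup G where
  carrier := B.s '' H
  one_mem' := ⟨0, H.zero_mem, B.s_zero⟩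
  mul_mem' := by
    rintro _ _ ⟨a, ha, rfl⟩ ⟨b, hb, rfl⟩
    exact ⟨b + (B.s b)⁻¹ • a, H.add_mem hb (hH _ _ ha), by rw [B.s_add, smul_inv_smul]⟩
  inv_mem' := by
    rintro _ ⟨a, ha, rfl⟩
    refine ⟨B.s a • -a, hH _ _ (H.neg_mem ha), ?_⟩
    rw [eq_inv_iff_mul_eq_one, ← B.s_add, add_neg_cancel, B.s_zero]

theorem s_mem_image (B : BraceAction G A X) {H : AddSubgroup A}
    {hH : ∀ (g : G), ∀ a ∈ H, g • a ∈ H} {a : A} : B.s a ∈ B.image H hH ↔ a ∈ H :=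
  B.bij.1.mem_set_image

theorem card_image (B : BraceAction G A X) (H : AddSubgroup A)
    (hH : ∀ (g : G), ∀ a ∈ H, g • a ∈ H) : Nat.card (B.image H hH) = Nat.card H :=
  Nat.card_image_of_injective B.bij.1 _

theorem smul_mem_range_nsmul {k : ℕ} (g : G) (a : A)
    (ha : a ∈ (nsmulAddMonoidHom k : A →+ A).range) :
    g • a ∈ (nsmulAddMonoidHom k : A →+ A).range := by
  obtain ⟨b, rfl⟩ := ha
  exact ⟨g • b, (smul_nsmul_comm g k b).symm⟩

theorem smul_mem_ker_nsmul {k : ℕ} (g : G) (a : A)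
    (ha : a ∈ (nsmulAddMonoidHom k : A →+ A).ker) :
    g • a ∈ (nsmulAddMonoidHom k : A →+ A).ker := by
  change k • g • a = 0
  rw [← smul_nsmul_comm, show k • a = 0 from ha, smul_zero]

/-- The subgroup corresponding to `k • A`. -/
abbrev nsmulSubgroup (B : BraceAction G A X) (k : ℕ) : Subgroup G :=
  B.image (nsmulAddMonoidHom k : A →+ A).range smul_mem_range_nsmul

instance (P : Subgroup G) (k : ℕ) : DistribMulAction P (nsmulAddMonoidHom k : A →+ A).range where
  smul g a := ⟨(g : G) • (a : A), smul_mem_range_nsmul _ _ a.2⟩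
  one_smul a := Subtype.ext (one_smul G (a : A))
  mul_smul g h a := Subtype.ext (mul_smul (g : G) (h : G) (a : A))
  smul_zero g := Subtype.ext (smul_zero (g : G))
  smul_add g a b := Subtype.ext (smul_add (g : G) (a : A) (b : A))

/-- The restriction of a brace action to the invariant subgroup `k • A`. -/
def restrict (B : BraceAction G A X) (k : ℕ) :
    BraceAction (B.nsmulSubgroup k) (nsmulAddMonoidHom k : A →+ A).range X where
  s a := ⟨B.s a, B.s_mem_image.2 a.2⟩
  ι x := ⟨k • B.ι x, B.ι x, rfl⟩
  bij := by
    refine ⟨fun a b h => Subtype.ext (B.bij.1 (Subtype.ext_iff.1 h)), ?_⟩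
    rintro ⟨_, a, ha, rfl⟩
    exact ⟨⟨a, ha⟩, rfl⟩
  s_add a b := Subtype.ext (B.s_add a b)
  smul_ι g x := Subtype.ext (by
    change (g : G) • k • B.ι x = k • B.ι ((g : G) • x)
    rw [smul_nsmul_comm, B.smul_ι])
  closure_ι := by
    have h := congrArg (AddSubgroup.map (nsmulAddMonoidHom k : A →+ A).rangeRestrict) B.closure_ι
    rw [AddMonoidHom.map_closure, ← Set.range_comp, ← AddMonoidHom.range_eq_map,
      AddMonoidHom.range_eq_top.2 (AddMonoidHom.rangeRestrict_surjective _)] at h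
    exact h

end BraceAction

/-- A Sylow-sized subgroup acts transitively on a set of prime power order. -/
theorem Subgroup.isPretransitive_of_card_eq {G X : Type*} [Group G] [Finite G] [MulAction G X]
    [MulAction.IsPretransitive G X] {p α β m : ℕ} (hp : p.Prime) (hG : Nat.card G = p ^ α * m)
    (hm : ¬ p ∣ m) (hX : Nat.card X = p ^ β) (P : Subgroup G) (hP : Nat.card P = p ^ α) :
    MulAction.IsPretransitive P X := by
  have hpos : 0 < p ^ β := pow_pos hp.pos _
  obtain ⟨⟨z⟩, hfin⟩ := Nat.card_pos_iff.1 (hX ▸ hpos)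
  rw [MulAction.isPretransitive_iff_orbit_eq_univ z]
  set S := MulAction.stabilizer P z
  have h1 : Nat.card S ∣ Nat.card (MulAction.stabilizer G z) := by
    have hle : S.map P.subtype ≤ MulAction.stabilizer G z := by
      rintro _ ⟨g, hg, rfl⟩
      exact hg
    rw [← S.card_map_of_injective P.subtype_injective]
    exact Subgroup.card_dvd_of_le hle
  have h2 : Nat.card (MulAction.stabilizer G z) * p ^ β = p ^ α * m := by
    rw [← hX, ← MulAction.index_stabilizer_of_transitive G z, Subgroup.card_mul_index, hG]
  have h3 : Nat.card S * Nat.card (MulAction.orbit P z) = p ^ α := by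
    rw [← hP, ← S.card_mul_index, MulAction.index_stabilizer]
    rfl
  have h4 : Nat.card S * p ^ β ∣ p ^ α := by
    refine Nat.Coprime.dvd_of_dvd_mul_right (n := m) ?_ (h2 ▸ mul_dvd_mul_right h1 _)
    have hcop : p.Coprime m := hp.coprime_iff_not_dvd.2 hm
    exact Nat.Coprime.mul_left ((hcop.pow_left α).coprime_dvd_left (h3 ▸ dvd_mul_right _ _))
      (hcop.pow_left β)
  have h5 : Nat.card X ≤ Nat.card (MulAction.orbit P z) := by
    rw [hX]
    refine Nat.le_of_mul_le_mul_left ?_ (Nat.card_pos (α := S))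
    rw [h3]
    exact Nat.le_of_dvd (pow_pos hp.pos _) h4
  exact Set.eq_of_subset_of_ncard_le (Set.subset_univ _) (by
    rw [Set.ncard_univ]
    exact h5)

/-- A group of order prime to `p` acting on `ZMod p` and normalized by the translations acts
trivially. -/
theorem smul_eq_self_of_normalized {Q : Type*} [Group Q] {p : ℕ} [hp : Fact p.Prime]
    [MulAction Q (ZMod p)] (hQ : ¬ p ∣ Nat.card Q)
    (hnorm : ∀ (i : ZMod p) (q : Q), ∃ q' : Q, ∀ j : ZMod p, q' • j = q • (j - i) + i) (q : Q)
    (j : ZMod p) : q • j = j := by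
  let R : AddSubgroup (ZMod p) :=
    { carrier := MulAction.orbit Q 0
      zero_mem' := MulAction.mem_orbit_self 0
      add_mem' := by
        rintro _ _ ⟨q, rfl⟩ ⟨q', rfl⟩
        obtain ⟨r, hr⟩ := hnorm (q • (0 : ZMod p)) q'
        refine ⟨r * q, ?_⟩
        change (r * q) • (0 : ZMod p) = q • (0 : ZMod p) + q' • (0 : ZMod p)
        rw [mul_smul, hr, sub_self, add_comm]
      neg_mem' := by
        rintro _ ⟨q, rfl⟩
        obtain ⟨r, hr⟩ := hnorm (-(q • (0 : ZMod p))) q⁻¹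
        refine ⟨r, ?_⟩
        change r • (0 : ZMod p) = -(q • (0 : ZMod p))
        rw [hr, zero_sub, neg_neg, inv_smul_smul, zero_add] }
  have : Fact (Nat.card (ZMod p)).Prime := by rwa [Nat.card_zmod]
  rcases R.eq_bot_or_eq_top_of_prime_card with h | h
  · have hzero (r : Q) : r • (0 : ZMod p) = 0 := by
      have : r • (0 : ZMod p) ∈ R := ⟨r, rfl⟩
      rwa [h] at this
    obtain ⟨r, hr⟩ := hnorm (-j) q
    have := hr 0
    rw [hzero, zero_sub, neg_neg] at this
    exact (eq_neg_of_add_eq_zero_left this.symm).trans (neg_neg j)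
  · refine absurd ?_ hQ
    have horb : MulAction.orbit Q (0 : ZMod p) = Set.univ := by
      have := congrArg (fun K : AddSubgroup (ZMod p) => (K : Set (ZMod p))) h
      exact this
    have hidx := MulAction.index_stabilizer Q (0 : ZMod p)
    rw [horb, Set.ncard_univ, Nat.card_zmod] at hidx
    have := Subgroup.index_dvd_card (MulAction.stabilizer Q (0 : ZMod p))
    rwa [hidx] at this

section Unipotent

variable {G A : Type*} [Group G] [AddCommGroup A] [DistribMulAction G A]

/-- The subgroup of elements acting trivially on the factors of a chain `E ≤ M ≤ V`. -/
def unipotentSubgroup {E M : AddSubgroup A} (hEM : E ≤ M) (V : AddSubgroup A) : Subgroup G where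
  carrier := {g | (∀ a ∈ E, g • a = a) ∧ (∀ a ∈ M, g • a - a ∈ E) ∧ ∀ a ∈ V, g • a - a ∈ M}
  one_mem' := by simp
  mul_mem' := by
    rintro g h ⟨g1, g2, g3⟩ ⟨h1, h2, h3⟩
    have hgh (a : A) : (g * h) • a - a = g • (h • a - a) + (g • a - a) := by
      rw [mul_smul, smul_sub]
      abel
    refine ⟨fun a ha => by rw [mul_smul, h1 a ha, g1 a ha], fun a ha => ?_, fun a ha => ?_⟩
    · rw [hgh, g1 _ (h2 a ha)]
      exact add_mem (h2 a ha) (g2 a ha)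
    · rw [hgh, ← sub_add_cancel (g • (h • a - a)) (h • a - a)]
      exact add_mem (add_mem (hEM (g2 _ (h3 a ha))) (h3 a ha)) (g3 a ha)
  inv_mem' := by
    rintro g ⟨g1, g2, g3⟩
    have hg (a : A) : g⁻¹ • a - a = -(g⁻¹ • (g • a - a)) := by
      rw [smul_sub, inv_smul_smul, neg_sub]
    have i1 : ∀ a ∈ E, g⁻¹ • a = a := fun a ha => by rw [inv_smul_eq_iff, g1 a ha]
    have i2 : ∀ a ∈ M, g⁻¹ • a - a ∈ E := fun a ha => by
      rw [hg, i1 _ (g2 a ha)]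
      exact neg_mem (g2 a ha)
    refine ⟨i1, i2, fun a ha => ?_⟩
    rw [hg, ← sub_add_cancel (g⁻¹ • (g • a - a)) (g • a - a)]
    exact neg_mem (add_mem (hEM (i2 _ (g3 a ha))) (g3 a ha))

theorem pow_smul_of_mem_unipotentSubgroup {E M V : AddSubgroup A} (hEM : E ≤ M) {p : ℕ}
    (hp : p.Prime) (hp2 : p ≠ 2) (hM : ∀ a ∈ M, p • a = 0) {g : G}
    (hg : g ∈ unipotentSubgroup hEM V) {v : A} (hv : v ∈ V) : g ^ p • v = v := by
  obtain ⟨g1, g2, g3⟩ := hg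
  obtain ⟨u, hu⟩ : ∃ u, u = g • v - v := ⟨_, rfl⟩
  obtain ⟨ε, hε⟩ : ∃ ε, ε = g • u - u := ⟨_, rfl⟩
  have huM : u ∈ M := hu ▸ g3 v hv
  have hεE : ε ∈ E := hε ▸ g2 u huM
  have hpow (n : ℕ) : g ^ n • v = v + n • u + n.choose 2 • ε := by
    induction n with
    | zero => simp
    | succ n ih =>
      rw [pow_succ', mul_smul, ih, smul_add, smul_add, smul_nsmul_comm, smul_nsmul_comm,
        g1 ε hεE, ← eq_sub_iff_add_eq.1 hu, ← eq_sub_iff_add_eq.1 hε,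
        Nat.choose_succ_succ' n 1, Nat.choose_one_right, succ_nsmul, add_nsmul, nsmul_add]
      abel
  have h2 : 2 < p := lt_of_le_of_ne hp.two_le hp2.symm
  obtain ⟨l, hl⟩ := hp.dvd_choose_self two_ne_zero h2
  rw [hpow, hM u huM, hl, mul_nsmul, hM ε (hEM hεE), nsmul_zero, add_zero, add_zero]

end Unipotent

namespace BraceAction

variable {G A X : Type*} [Group G] [AddCommGroup A] [MulAction G X] [DistribMulAction G A]

/-- A character of a brace action which is constant on `X` is invariant. -/
theorem map_smul_of_const (B : BraceAction G A X) {R : Type*} [AddCommGroup R] {F : A →+ R} {u : R}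
    (hF : ∀ x, F (B.ι x) = u) (g : G) (a : A) : F (g • a) = F a := by
  have h : F.comp (DistribSMul.toAddMonoidHom A g) = F := by
    refine AddMonoidHom.eq_of_eqOn_dense B.closure_ι ?_
    rintro _ ⟨x, rfl⟩
    change F (g • B.ι x) = F (B.ι x)
    rw [B.smul_ι, hF, hF]
  exact DFunLike.congr_fun h a

theorem not_hasCharacter_restrict [Finite G] (B : BraceAction G A X) {p α m k : ℕ}
    [hp : Fact p.Prime] (hG : Nat.card G = p ^ α * m) (hm : ¬ p ∣ m) (hX : Nat.card X = p ^ 2)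
    (hlat : ∀ z : X, Function.Surjective fun x => B.s (B.ι x) • z)
    (hk : ∀ a : A, k • k • a = k • a)
    (hcard : Nat.card (B.nsmulSubgroup k) = p ^ α)
    [MulAction.IsPretransitive (B.nsmulSubgroup k) X] : ¬ (B.restrict k).HasCharacter p := by
  rintro ⟨f, u, hu, hfι, hstab⟩
  obtain ⟨⟨z⟩, -⟩ := Nat.card_pos_iff.1 (hX ▸ pow_pos hp.out.pos 2)
  let F : A →+ ZMod p := f.comp (nsmulAddMonoidHom k : A →+ A).rangeRestrict
  have hFι (x : X) : F (B.ι x) = u := hfι x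
  let e := Equiv.ofBijective B.s B.bij
  have he (a : A) : e.symm (B.s a) = a := e.symm_apply_apply a
  let ψ : G →* Multiplicative (ZMod p) :=
    { toFun g := Multiplicative.ofAdd (F (e.symm g))
      map_one' := by rw [← B.s_zero, he, map_zero, ofAdd_zero]
      map_mul' g h := by
        obtain ⟨b, rfl⟩ := B.bij.2 h
        obtain ⟨c, rfl⟩ := B.bij.2 g
        have := B.s_add b ((B.s b)⁻¹ • c)
        rw [smul_inv_smul] at this
        rw [← this, he, he, he, map_add, B.map_smul_of_const hFι, ofAdd_add, mul_comm] }
  have hψ (a : A) : ψ (B.s a) = Multiplicative.ofAdd (F a) := by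
    change Multiplicative.ofAdd (F (e.symm (B.s a))) = _
    rw [he]
  have hidx : ψ.ker.index = p := by
    have hdvd : ψ.ker.index ∣ p := by
      rw [Subgroup.index_ker]
      simpa using Subgroup.card_subgroup_dvd_card ψ.range
    refine ((Nat.dvd_prime hp.out).1 hdvd).resolve_left fun h => ?_
    rw [Subgroup.index_eq_one] at h
    have : B.s (B.ι z) ∈ ψ.ker := h ▸ Subgroup.mem_top _
    rw [MonoidHom.mem_ker, hψ, hFι] at this
    exact hu this
  have htrans : MulAction.IsPretransitive ψ.ker X := by
    refine ⟨fun x y => ?_⟩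
    obtain ⟨v, hv⟩ := hlat ((B.s (B.ι z))⁻¹ • x) y
    refine ⟨⟨B.s (B.ι v) * (B.s (B.ι z))⁻¹, ?_⟩, ?_⟩
    · rw [MonoidHom.mem_ker, map_mul, map_inv, hψ, hψ, hFι, hFι, mul_inv_cancel]
    · exact (mul_smul _ _ _).trans hv
  have h1 : Nat.card (MulAction.stabilizer ψ.ker z) * p ^ 2 * p = p ^ α * m := by
    rw [← hX, ← MulAction.index_stabilizer_of_transitive ψ.ker z, Subgroup.card_mul_index, ← hG,
      ← ψ.ker.card_mul_index, hidx]
  have h2 : Nat.card (MulAction.stabilizer (B.nsmulSubgroup k) z) * p ^ 2 = p ^ α := by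
    rw [← hX, ← MulAction.index_stabilizer_of_transitive (B.nsmulSubgroup k) z,
      Subgroup.card_mul_index, hcard]
  have h3 : Nat.card (MulAction.stabilizer (B.nsmulSubgroup k) z) ∣
      Nat.card (MulAction.stabilizer ψ.ker z) := by
    rw [← Subgroup.card_map_of_injective (B.nsmulSubgroup k).subtype_injective,
      ← Subgroup.card_map_of_injective ψ.ker.subtype_injective]
    refine Subgroup.card_dvd_of_le ?_
    rintro _ ⟨⟨_, a, ha, rfl⟩, hg, rfl⟩
    have hfa : f ⟨a, ha⟩ = 0 := hstab ⟨a, ha⟩ z hg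
    refine ⟨⟨B.s a, ?_⟩, hg, rfl⟩
    have hka : (nsmulAddMonoidHom k : A →+ A).rangeRestrict a = ⟨a, ha⟩ := by
      obtain ⟨b, rfl⟩ := ha
      exact Subtype.ext (hk b)
    rw [MonoidHom.mem_ker, hψ]
    change Multiplicative.ofAdd (f _) = 1
    rw [hka, hfa, ofAdd_zero]
  have h4 : p ^ α * p ∣ p ^ α * m := by
    rw [← h1, ← h2]
    exact mul_dvd_mul_right (mul_dvd_mul_right h3 _) _
  exact hm (Nat.dvd_of_mul_dvd_mul_left (pow_pos hp.out.pos α) h4)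

end BraceAction

namespace BraceAction.Coordinates

variable {G A X : Type*} [Group G] [AddCommGroup A] [MulAction G X] [DistribMulAction G A]
  {p : ℕ} {B : BraceAction G A X} {k : ℕ} (C : (B.restrict k).Coordinates p)

/-- The subgroup of order `p` of `A` spanned by the fixed vector of the coordinates. -/
def line : AddSubgroup A :=
  ((nsmulAddMonoidHom k : A →+ A).range.subtype.comp C.e).range

theorem e_mem_line (i : ZMod p) : (C.e i : A) ∈ C.line := ⟨i, rfl⟩

theorem coe_mem_line {a : (nsmulAddMonoidHom k : A →+ A).range} :
    (a : A) ∈ C.line ↔ a ∈ C.e.range := by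
  constructor
  · rintro ⟨i, hi⟩
    exact ⟨i, Subtype.ext hi⟩
  · rintro ⟨i, rfl⟩
    exact C.e_mem_line i

theorem line_le : C.line ≤ (nsmulAddMonoidHom k : A →+ A).range := by
  rintro _ ⟨i, rfl⟩
  exact (C.e i).2

theorem smul_eq_self_of_mem_line {g : G} (hg : g ∈ B.nsmulSubgroup k) {a : A} (ha : a ∈ C.line) :
    g • a = a := by
  obtain ⟨i, rfl⟩ := ha
  exact congrArg Subtype.val (C.smul_e ⟨g, hg⟩ i)

theorem card_line : Nat.card C.line = p := by
  have h : Function.Injective ((nsmulAddMonoidHom k : A →+ A).range.subtype.comp C.e) :=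
    Subtype.val_injective.comp C.e_injective
  exact (Nat.card_congr (AddMonoidHom.ofInjective h).toEquiv).symm.trans (Nat.card_zmod p)

theorem nsmul_eq_zero_of_mem_line {a : A} (ha : a ∈ C.line) : p • a = 0 := by
  obtain ⟨i, rfl⟩ := ha
  rw [← map_nsmul, nsmul_eq_mul, CharP.cast_eq_zero, zero_mul, map_zero]

theorem eq_nsmul_of_mem_line [NeZero p] {a : A} (ha : a ∈ C.line) :
    ∃ n : ℕ, a = n • (C.e 1 : A) := by
  obtain ⟨i, rfl⟩ := ha
  refine ⟨i.val, ?_⟩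
  rw [← AddSubgroup.coe_nsmul, ← map_nsmul, nsmul_one, ZMod.natCast_zmod_val]
  rfl

variable [hp : Fact p.Prime]

/-- The kernel of the block action of `nsmulSubgroup`, as a subgroup of `G`. -/
def blockKernel : Subgroup G where
  carrier := {g | ∃ h : g ∈ B.nsmulSubgroup k, C.c ⟨g, h⟩ = 0}
  one_mem' := ⟨one_mem _, C.c_one⟩
  mul_mem' := by
    rintro g g' ⟨h, hg⟩ ⟨h', hg'⟩
    refine ⟨mul_mem h h', ?_⟩
    have := C.c_mul ⟨g, h⟩ ⟨g', h'⟩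
    rwa [hg, hg', add_zero] at this
  inv_mem' := by
    rintro g ⟨h, hg⟩
    refine ⟨inv_mem h, ?_⟩
    have := C.c_mul ⟨g, h⟩ ⟨g⁻¹, inv_mem h⟩
    rw [hg, zero_add] at this
    rw [← this]
    exact (congrArg C.c (mul_inv_cancel (⟨g, h⟩ : B.nsmulSubgroup k))).trans C.c_one

theorem card_blockKernel_mul : Nat.card C.blockKernel * p = Nat.card (B.nsmulSubgroup k) := by
  let ψ : B.nsmulSubgroup k →* Multiplicative (ZMod p) :=
    { toFun g := Multiplicative.ofAdd (C.c g)
      map_one' := by rw [C.c_one, ofAdd_zero]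
      map_mul' g h := by rw [C.c_mul, ofAdd_add] }
  have hsurj : Function.Surjective ψ := fun i => C.surj i.toAdd
  have hker : ψ.ker.map (B.nsmulSubgroup k).subtype = C.blockKernel := by
    ext g
    constructor
    · rintro ⟨g, hg, rfl⟩
      exact ⟨g.2, hg⟩
    · rintro ⟨h, hg⟩
      exact ⟨⟨g, h⟩, hg, rfl⟩
  rw [← hker, Subgroup.card_map_of_injective (B.nsmulSubgroup k).subtype_injective,
    ← ψ.ker.card_mul_index, Subgroup.index_ker, MonoidHom.range_eq_top.2 hsurj]
  simp

variable [FaithfulSMul G X]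

theorem nsmul_ι_sub_mem_line_iff (x y : X) :
    k • B.ι x - k • B.ι y ∈ C.line ↔ C.b x = C.b y := by
  rw [← C.ι_sub_ι_mem_range_iff, ← C.coe_mem_line]
  rfl

theorem smul_sub_mem_line [Finite A] {g : B.nsmulSubgroup k} (hg : C.c g = 0) {v : A}
    (hv : v ∈ (nsmulAddMonoidHom k : A →+ A).range) : (g : G) • v - v ∈ C.line :=
  C.coe_mem_line.2 (C.smul_sub_mem_range hg ⟨v, hv⟩)

theorem eq_one_of_smul_eq (C : (B.restrict k).Coordinates p) {g : G}
    (hg : ∀ v ∈ (nsmulAddMonoidHom k : A →+ A).range, g • v = v) : g = 1 := by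
  refine FaithfulSMul.eq_of_smul_eq_smul (α := X) fun x => ?_
  rw [one_smul]
  have h : k • B.ι (g • x) = k • B.ι x := by
    rw [← B.smul_ι, ← smul_nsmul_comm]
    exact hg _ ⟨B.ι x, rfl⟩
  refine C.coord_ext _ _ ((C.nsmul_ι_sub_mem_line_iff _ _).1 ?_) ?_
  · rw [h, sub_self]
    exact zero_mem _
  · have : (B.restrict k).ι (g • x) = (B.restrict k).ι x := Subtype.ext h
    rw [this]

/-- The line of the coordinates is invariant under the whole group. -/
theorem smul_mem_line [Finite G] (hp2 : p ≠ 2) {α m : ℕ} (hG : Nat.card G = p ^ α * m)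
    (hm : ¬ p ∣ m) (hcard : Nat.card (B.nsmulSubgroup k) = p ^ α) (h : G) {a : A}
    (ha : a ∈ C.line) : h • a ∈ C.line := by
  have : Finite A := Finite.of_injective _ B.bij.1
  by_contra hne
  have hα : 4 ≤ α := by
    have h4 := C.pow_four_le_card hp2
    rw [← B.card_image _ smul_mem_range_nsmul, hcard] at h4
    exact (Nat.pow_le_pow_iff_right hp.out.one_lt).1 h4
  have hw : h • (C.e 1 : A) ∉ C.line := by
    intro hmem
    obtain ⟨n, rfl⟩ := C.eq_nsmul_of_mem_line ha
    rw [smul_nsmul_comm] at hne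
    exact hne (nsmul_mem hmem n)
  let E' : AddSubgroup A := C.line.map (DistribSMul.toAddMonoidHom A h)
  have hEE' : C.line ⊓ E' = ⊥ := by
    have hE' : Nat.card E' = p := by
      rw [← C.card_line]
      exact Nat.card_image_of_injective (MulAction.injective h) _
    have : Fact (Nat.card E').Prime := by rwa [hE']
    rcases (C.line.addSubgroupOf E').eq_bot_or_eq_top_of_prime_card with h' | h'
    · rw [AddSubgroup.addSubgroupOf_eq_bot, disjoint_iff] at h'
      exact h'
    · rw [AddSubgroup.addSubgroupOf_eq_top] at h'
      exact absurd (h' ⟨_, C.e_mem_line 1, rfl⟩) hw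
  let V := (nsmulAddMonoidHom k : A →+ A).range
  have hE'V : E' ≤ V := by
    rintro _ ⟨a, ha, rfl⟩
    exact smul_mem_range_nsmul _ _ (C.line_le ha)
  have hEM : C.line ≤ C.line ⊔ E' := le_sup_left
  let U : Subgroup G := unipotentSubgroup hEM V
  have hM : ∀ a ∈ C.line ⊔ E', p • a = 0 := by
    intro a ha
    obtain ⟨y, hy, _, ⟨z, hz, rfl⟩, rfl⟩ := AddSubgroup.mem_sup.1 ha
    rw [nsmul_add, C.nsmul_eq_zero_of_mem_line hy, DistribSMul.toAddMonoidHom_apply,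
      ← smul_nsmul_comm, C.nsmul_eq_zero_of_mem_line hz, smul_zero, add_zero]
  have hU : Nat.card U ∣ p ^ α := by
    have hUp : IsPGroup p U := fun g => ⟨1, Subtype.ext (C.eq_one_of_smul_eq fun v hv => by
      rw [pow_one]
      exact pow_smul_of_mem_unipotentSubgroup hEM hp.out hp2 hM g.2 hv)⟩
    obtain ⟨n, hn⟩ := IsPGroup.iff_card.1 hUp
    have hdvd := Subgroup.card_subgroup_dvd_card U
    rw [hG] at hdvd
    refine Nat.Coprime.dvd_of_dvd_mul_right ?_ hdvd
    rw [hn]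
    exact (hp.out.coprime_iff_not_dvd.2 hm).pow_left n
  let N := C.blockKernel
  have hNV (g : G) (hg : g ∈ N) (v : A) (hv : v ∈ V) : g • v - v ∈ C.line := by
    obtain ⟨h1, h2⟩ := hg
    exact C.smul_sub_mem_line h2 hv
  have hNE (g : G) (hg : g ∈ N) (v : A) (hv : v ∈ C.line) : g • v = v :=
    C.smul_eq_self_of_mem_line hg.choose hv
  have hMV : C.line ⊔ E' ≤ V := sup_le C.line_le hE'V
  have hNU : N ≤ U := fun g hg =>
    ⟨hNE g hg, fun a ha => hNV g hg a (hMV ha), fun a ha => hEM (hNV g hg a ha)⟩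
  let v : A := h⁻¹ • (C.e 1 : A)
  have hvV : v ∈ V := smul_mem_range_nsmul _ _ (C.line_le (C.e_mem_line 1))
  let S : Subgroup N := MulAction.stabilizer N v
  let N₁ : Subgroup G := (S.map N.subtype).map (MulAut.conj h).toMonoidHom
  have hN₁ : Nat.card N₁ = Nat.card S := by
    rw [Subgroup.card_map_of_injective (MulAut.conj h).injective,
      Subgroup.card_map_of_injective N.subtype_injective]
  have hS : Nat.card N ≤ Nat.card S * p := by
    rw [← S.card_mul_index, MulAction.index_stabilizer]
    refine Nat.mul_le_mul_left _ ?_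
    have hsub : MulAction.orbit N v ⊆ (fun a => a + v) '' (C.line : Set A) := by
      rintro _ ⟨g, rfl⟩
      exact ⟨_, hNV g g.2 v hvV, sub_add_cancel _ _⟩
    refine (Set.ncard_le_ncard hsub (Set.toFinite _)).trans ((Set.ncard_image_le).trans ?_)
    exact C.card_line.le
  have hN₁E' (g : G) (hg : g ∈ N₁) (a : A) (ha : a ∈ V) : g • a - a ∈ E' := by
    obtain ⟨_, ⟨n, hn, rfl⟩, rfl⟩ := hg
    refine ⟨(n : G) • h⁻¹ • a - h⁻¹ • a, hNV n n.2 _ (smul_mem_range_nsmul _ _ ha), ?_⟩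
    change h • ((n : G) • h⁻¹ • a - h⁻¹ • a) = (h * (n : G) * h⁻¹) • a - a
    rw [smul_sub, smul_inv_smul, mul_smul, mul_smul]
  have hN₁M (g : G) (hg : g ∈ N₁) (a : A) (ha : a ∈ C.line ⊔ E') : g • a = a := by
    obtain ⟨_, ⟨n, hn, rfl⟩, rfl⟩ := hg
    obtain ⟨y, hy, _, ⟨z, hz, rfl⟩, rfl⟩ := AddSubgroup.mem_sup.1 ha
    change (h * (n : G) * h⁻¹) • (y + h • z) = y + h • z
    have hn' : (n : G) • v = v := hn
    obtain ⟨l, rfl⟩ := C.eq_nsmul_of_mem_line hy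
    rw [mul_smul, mul_smul, smul_add, smul_add, smul_add, inv_smul_smul, hNE n n.2 z hz,
      smul_nsmul_comm, smul_nsmul_comm]
    change h • l • (n : G) • v + _ = _
    rw [hn', smul_nsmul_comm, smul_inv_smul]
  have hN₁U : N₁ ≤ U := fun g hg =>
    ⟨fun a ha => hN₁M g hg a (hEM ha), fun a ha => by
      rw [hN₁M g hg a ha, sub_self]
      exact zero_mem _,
      fun a ha => (le_sup_right : E' ≤ _) (hN₁E' g hg a ha)⟩
  have hdisj : Disjoint N N₁ := by
    rw [Subgroup.disjoint_def]
    intro g hg hg₁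
    refine C.eq_one_of_smul_eq fun a ha => sub_eq_zero.1 ?_
    have : g • a - a ∈ C.line ⊓ E' := ⟨hNV g hg a ha, hN₁E' g hg₁ a ha⟩
    rwa [hEE'] at this
  have hle : Nat.card N * Nat.card N₁ ≤ Nat.card U := by
    rw [← Nat.card_prod]
    refine Nat.card_le_card_of_injective
      (fun q : N × N₁ => (⟨q.1 * q.2, mul_mem (hNU q.1.2) (hN₁U q.2.2)⟩ : U)) ?_
    intro q q' hq
    exact Subgroup.mul_injective_of_disjoint hdisj (Subtype.ext_iff.1 hq)
  have hN : Nat.card N * p = p ^ α := by rw [C.card_blockKernel_mul, hcard]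
  have hfinal : p ^ α * p ^ α ≤ p ^ (α + 3) := by
    calc p ^ α * p ^ α = Nat.card N * Nat.card N * p ^ 2 := by rw [← hN]; ring
      _ ≤ Nat.card N * (Nat.card N₁ * p) * p ^ 2 := by
        rw [hN₁]
        gcongr
      _ = Nat.card N * Nat.card N₁ * p ^ 3 := by ring
      _ ≤ p ^ α * p ^ 3 := by
        gcongr
        exact hle.trans (Nat.le_of_dvd (pow_pos hp.out.pos α) hU)
      _ = p ^ (α + 3) := (pow_add _ _ _).symm
  rw [← pow_add, Nat.pow_le_pow_iff_right hp.out.one_lt] at hfinal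
  lia

end BraceAction.Coordinates

namespace BraceAction.Coordinates

variable {G A X : Type*} [Group G] [AddCommGroup A] [MulAction G X] [DistribMulAction G A]
  {p : ℕ} {B : BraceAction G A X} {k : ℕ} (C : (B.restrict k).Coordinates p)

theorem b_s_smul {a : A} (ha : a ∈ (nsmulAddMonoidHom k : A →+ A).range) (x : X) :
    C.b (B.s a • x) = C.b x + C.c ((B.restrict k).s ⟨a, ha⟩) :=
  C.b_smul ((B.restrict k).s ⟨a, ha⟩) x

theorem s_mem_nsmulSubgroup {a : A} (ha : a ∈ (nsmulAddMonoidHom k : A →+ A).range) :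
    B.s a ∈ B.nsmulSubgroup k := B.s_mem_image.2 ha

variable [hp : Fact p.Prime] [FaithfulSMul G X]

theorem b_smul_congr (hE : ∀ (g : G), ∀ a ∈ C.line, g • a ∈ C.line) (g : G) {x y : X}
    (h : C.b x = C.b y) : C.b (g • x) = C.b (g • y) := by
  rw [← C.nsmul_ι_sub_mem_line_iff] at h ⊢
  have := hE g _ h
  rwa [smul_sub, smul_nsmul_comm, smul_nsmul_comm, B.smul_ι, B.smul_ι] at this

/-- Elements of the complement `ker k` which fix the line act trivially on the blocks. -/
theorem b_smul_of_mem_ker (hE : ∀ (g : G), ∀ a ∈ C.line, g • a ∈ C.line)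
    (hker : ¬ p ∣ Nat.card (nsmulAddMonoidHom k : A →+ A).ker) {u : A}
    (hu : u ∈ (nsmulAddMonoidHom k : A →+ A).ker) (hfix : B.s u • (C.e 1 : A) = C.e 1) (x : X) :
    C.b (B.s u • x) = C.b x := by
  let Q : Subgroup G := B.image (nsmulAddMonoidHom k : A →+ A).ker smul_mem_ker_nsmul ⊓
    MulAction.stabilizer G (C.e 1 : A)
  have hQ : ¬ p ∣ Nat.card Q := fun h => by
    refine hker (h.trans ?_)
    rw [← B.card_image _ smul_mem_ker_nsmul]
    exact Subgroup.card_dvd_of_le inf_le_left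
  have hr (i : ZMod p) : ∃ x, C.b x = i := (C.exists_coord i 0).imp fun _ h => h.1
  choose r hr using hr
  let _ : MulAction Q (ZMod p) :=
    { smul q i := C.b ((q : G) • r i)
      one_smul i := (congrArg C.b (one_smul G (r i))).trans (hr i)
      mul_smul q q' i := by
        change C.b (((q * q' : Q) : G) • r i) = C.b ((q : G) • r (C.b ((q' : G) • r i)))
        rw [Subgroup.coe_mul, mul_smul]
        exact C.b_smul_congr hE _ (hr _).symm }
  have hb (q : Q) (x : X) : C.b ((q : G) • x) = q • C.b x := C.b_smul_congr hE _ (hr _).symm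
  have hnorm (i : ZMod p) (q : Q) : ∃ q' : Q, ∀ j, q' • j = q • (j - i) + i := by
    obtain ⟨⟨_, ⟨v, hv, rfl⟩, hqs⟩, hq⟩ : ∃ q' : Q, q' = q := ⟨q, rfl⟩
    have hei : B.s v • (C.e i : A) = C.e i := by
      obtain ⟨n, hn⟩ := C.eq_nsmul_of_mem_line (C.e_mem_line i)
      rw [hn, smul_nsmul_comm, show B.s v • (C.e 1 : A) = C.e 1 from hqs]
    have hconj := B.s_smul_of_smul_eq hei
    have ht (a : A) (ha : a ∈ C.line) : B.s (C.e i) • a = a :=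
      C.smul_eq_self_of_mem_line (s_mem_nsmulSubgroup (C.e i).2) ha
    refine ⟨⟨B.s (B.s (C.e i) • v), B.s_mem_image.2 (smul_mem_ker_nsmul _ _ hv), ?_⟩, fun j => ?_⟩
    · change B.s (B.s (C.e i) • v) • (C.e 1 : A) = C.e 1
      have h1 := ht _ (C.e_mem_line 1)
      rw [hconj, mul_smul, mul_smul, inv_smul_eq_iff.2 h1.symm,
        show B.s v • (C.e 1 : A) = C.e 1 from hqs, h1]
    · have hbt (y : X) : C.b (B.s (C.e i) • y) = C.b y + i := by
        rw [C.b_s_smul (C.e i).2]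
        exact congrArg _ (C.c_e i)
      have hbt' : C.b ((B.s (C.e i))⁻¹ • r j) = j - i := by
        rw [eq_sub_iff_add_eq, ← hbt, smul_inv_smul, hr]
      change C.b (B.s (B.s (C.e i) • v) • r j) = _
      rw [hconj, mul_smul, mul_smul, hbt, ← hq, ← hbt', ← hb]
  exact (hb ⟨B.s u, B.s_mem_image.2 hu, hfix⟩ x).trans (smul_eq_self_of_normalized hQ hnorm _ _)

/-- An element of the complement `ker k` which fixes the line is trivial. -/
theorem eq_zero_of_mem_ker (hE : ∀ (g : G), ∀ a ∈ C.line, g • a ∈ C.line)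
    (hker : ¬ p ∣ Nat.card (nsmulAddMonoidHom k : A →+ A).ker) {u : A}
    (hu : u ∈ (nsmulAddMonoidHom k : A →+ A).ker) (hfix : B.s u • (C.e 1 : A) = C.e 1) :
    u = 0 := by
  refine B.bij.1 (FaithfulSMul.eq_of_smul_eq_smul (α := X) fun x => ?_)
  rw [B.s_zero, one_smul]
  have hx : k • B.ι x ∈ (nsmulAddMonoidHom k : A →+ A).range := ⟨B.ι x, rfl⟩
  have hgx : k • B.ι (B.s u • x) ∈ (nsmulAddMonoidHom k : A →+ A).range := ⟨_, rfl⟩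
  have hcomm := B.s_comm (k • B.ι x) u
  rw [smul_nsmul_comm (B.s u), B.smul_ι] at hcomm
  have hfix' : B.s (B.s (k • B.ι x) • u) • (C.e 1 : A) = C.e 1 := by
    have := congrArg (fun g : G => g • (C.e 1 : A)) hcomm
    simp only [mul_smul, hfix] at this
    rwa [C.smul_eq_self_of_mem_line (s_mem_nsmulSubgroup hx) (C.e_mem_line 1),
      C.smul_eq_self_of_mem_line (s_mem_nsmulSubgroup hgx) (C.e_mem_line 1)] at this
  refine C.coord_ext _ _ (C.b_smul_of_mem_ker hE hker hu hfix x) ?_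
  have := congrArg (fun g : G => C.b (g • x)) hcomm
  simp only [mul_smul] at this
  rw [C.b_smul_of_mem_ker hE hker (smul_mem_ker_nsmul _ _ hu) hfix', C.b_s_smul hx,
    C.b_s_smul hgx, C.b_smul_of_mem_ker hE hker hu hfix] at this
  exact (add_left_cancel this).symm

/-- The `p`-part of the group fixes the complement `ker k` pointwise. -/
theorem smul_eq_self_of_mem_ker (hE : ∀ (g : G), ∀ a ∈ C.line, g • a ∈ C.line)
    (hker : ¬ p ∣ Nat.card (nsmulAddMonoidHom k : A →+ A).ker) {g : G}
    (hg : g ∈ B.nsmulSubgroup k) {u : A} (hu : u ∈ (nsmulAddMonoidHom k : A →+ A).ker) :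
    g • u = u := by
  obtain ⟨a, ha, rfl⟩ := hg
  have hcomm := congrArg (fun g : G => g • (C.e 1 : A)) (B.s_comm a u)
  simp only [mul_smul] at hcomm
  rw [C.smul_eq_self_of_mem_line (s_mem_nsmulSubgroup ha) (C.e_mem_line 1),
    C.smul_eq_self_of_mem_line (s_mem_nsmulSubgroup (smul_mem_range_nsmul _ _ ha))
      (hE _ _ (C.e_mem_line 1))] at hcomm
  have hmem : (B.s u)⁻¹ * B.s (B.s a • u) ∈
      B.image (nsmulAddMonoidHom k : A →+ A).ker smul_mem_ker_nsmul :=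
    mul_mem (inv_mem (B.s_mem_image.2 hu)) (B.s_mem_image.2 (smul_mem_ker_nsmul _ _ hu))
  obtain ⟨v, hv, hveq⟩ := hmem
  have hv0 : v = 0 := C.eq_zero_of_mem_ker hE hker hv (by
    rw [hveq, mul_smul, hcomm, inv_smul_smul])
  rw [hv0, B.s_zero, eq_comm, inv_mul_eq_one] at hveq
  exact (B.bij.1 hveq).symm

theorem false_of_latin [Finite G] (C : (B.restrict k).Coordinates p) (hp2 : p ≠ 2) {α m : ℕ}
    (hG : Nat.card G = p ^ α * m)
    (hm : ¬ p ∣ m) (hcard : Nat.card (B.nsmulSubgroup k) = p ^ α)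
    (hk : ∀ a : A, k • k • a = k • a)
    (hker : ¬ p ∣ Nat.card (nsmulAddMonoidHom k : A →+ A).ker)
    [MulAction.IsPretransitive (B.nsmulSubgroup k) X]
    (hlat : ∀ z : X, Function.Injective fun x => B.s (B.ι x) • z) : False := by
  have hE (g : G) (a : A) (ha : a ∈ C.line) : g • a ∈ C.line :=
    C.smul_mem_line hp2 hG hm hcard g ha
  have hmem (x : X) : B.ι x - k • B.ι x ∈ (nsmulAddMonoidHom k : A →+ A).ker := by
    change k • (B.ι x - k • B.ι x) = 0
    rw [nsmul_sub, hk, sub_self]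
  have hconst (x y : X) : B.ι x - k • B.ι x = B.ι y - k • B.ι y := by
    obtain ⟨g, rfl⟩ := MulAction.exists_smul_eq (B.nsmulSubgroup k) x y
    rw [← C.smul_eq_self_of_mem_ker hE hker g.2 (hmem x), smul_sub, smul_nsmul_comm, B.smul_ι]
    rfl
  have hs (x y : X) : B.s (B.ι x) = B.s (B.ι y - k • B.ι y) * B.s (k • B.ι x) := by
    have hx : B.s (k • B.ι x) ∈ B.nsmulSubgroup k := s_mem_nsmulSubgroup ⟨_, rfl⟩
    have := B.s_add (k • B.ι x) (B.ι x - k • B.ι x)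
    rwa [C.smul_eq_self_of_mem_ker hE hker hx (hmem x), add_sub_cancel, hconst x y] at this
  obtain ⟨y, hyb, hyc⟩ := C.exists_coord 0 0
  obtain ⟨x, hxb, hxc⟩ := C.exists_coord (-1) 0
  obtain ⟨x', hxb', hxc'⟩ := C.exists_coord 1 0
  have hxx : x = x' := by
    refine hlat y ?_
    change B.s (B.ι x) • y = B.s (B.ι x') • y
    rw [hs x y, hs x' y, mul_smul, mul_smul]
    congr 1
    refine C.coord_ext _ _ ?_ ?_
    · exact (C.b_s_smul ⟨_, rfl⟩ y).trans
        ((congrArg _ (hxc.trans hxc'.symm)).trans (C.b_s_smul ⟨_, rfl⟩ y).symm)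
    · refine (C.c_smul ((B.restrict k).ι x) y).trans
        (Eq.trans ?_ (C.c_smul ((B.restrict k).ι x') y).symm)
      rw [C.T_ι, C.T_ι, hxb, hxb', ← C.τ_neg, hyb]
      ring_nf
  rw [hxx, hxb'] at hxb
  have := Fact.mk (lt_of_le_of_ne hp.out.two_le hp2.symm)
  exact ZMod.neg_one_ne_one hxb.symm

end BraceAction.Coordinates

/-- A brace action of latin type on a set of cardinality `p ^ 2` exists only for `p = 2`. -/
theorem BraceAction.eq_two_of_latin {G A X : Type*} [Group G] [AddCommGroup A] [MulAction G X]
    [DistribMulAction G A] [Finite G] [FaithfulSMul G X] [MulAction.IsPretransitive G X]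
    (B : BraceAction G A X) {p : ℕ} (hp : p.Prime) (hX : Nat.card X = p ^ 2)
    (hlat : ∀ z : X, Function.Bijective fun x => B.s (B.ι x) • z) : p = 2 := by
  by_contra hp2
  have := Fact.mk hp
  have : Finite A := Finite.of_injective _ B.bij.1
  obtain ⟨α, m, hm, hG⟩ := Nat.exists_eq_pow_mul_and_not_dvd (Nat.card_pos (α := G)).ne' p hp.ne_one
  have hA : Nat.card A = p ^ α * m := (Nat.card_eq_of_bijective _ B.bij).trans hG
  obtain ⟨k, hk, hran, hker⟩ := AddCommGroup.exists_nsmul_projection hp hA hm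
  have hcard : Nat.card (B.nsmulSubgroup k) = p ^ α := (B.card_image _ _).trans hran
  have := Subgroup.isPretransitive_of_card_eq hp hG hm hX (B.nsmulSubgroup k) hcard
  rcases (B.restrict k).hasCharacter_or_coordinates hcard hX with h | ⟨⟨C⟩⟩
  · exact B.not_hasCharacter_restrict hG hm hX (fun z => (hlat z).2) hk hcard h
  · exact C.false_of_latin hp2 hG hm hcard hk hker fun z => (hlat z).1

namespace CycleSetLaw

variable {X : Type*} {σ : X → Equiv.Perm X}

theorem sigmaG_mul (hlaw : CycleSetLaw σ) (x y : X) :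
    sigmaG σ (σ x y) * sigmaG σ x = sigmaG σ (σ y x) * sigmaG σ y :=
  Subtype.ext (Equiv.ext fun z => hlaw x y z)

theorem injective_sigmaG_mul (hnd : Nondeg σ) (x : X) :
    Function.Injective fun h : permGroup σ => sigmaG σ (h • x) * h := by
  intro h h' hh
  have hx : h • x = h' • x := hnd.1 (congrArg (fun g : permGroup σ => g • x) hh)
  simpa only [hx, mul_right_inj] using hh

variable [Finite X]

/-- The permutation `h ↦ σ_{h x} ∘ h` of the permutation group, for `x` in the cycle set. -/
noncomputable def twist (hnd : Nondeg σ) (x : X) : Equiv.Perm (permGroup σ) :=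
  Equiv.ofBijective _ (Finite.injective_iff_bijective.1 (injective_sigmaG_mul hnd x))

theorem twist_apply (hnd : Nondeg σ) (x : X) (h : permGroup σ) :
    twist hnd x h = sigmaG σ (h • x) * h := rfl

theorem twist_comm (hlaw : CycleSetLaw σ) (hnd : Nondeg σ) (x y : X) :
    twist hnd x * twist hnd y = twist hnd y * twist hnd x := by
  ext1 h
  have := hlaw.sigmaG_mul (h • y) (h • x)
  rw [Equiv.Perm.mul_apply, Equiv.Perm.mul_apply, twist_apply, twist_apply, twist_apply,
    twist_apply, ← mul_assoc, ← mul_assoc, mul_smul, mul_smul]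
  exact congrArg (· * h) this

theorem conj_twist (hnd : Nondeg σ) (g : permGroup σ) (x : X) :
    (Equiv.mulRight g)⁻¹ * twist hnd x * Equiv.mulRight g = twist hnd (g • x) := by
  ext1 h
  change sigmaG σ ((h * g) • x) * (h * g) * g⁻¹ = sigmaG σ (h • g • x) * h
  rw [mul_smul, ← mul_assoc, mul_inv_cancel_right]

/-- The group generated by the permutations `twist`. -/
noncomputable abbrev twistGroup (hnd : Nondeg σ) : Subgroup (Equiv.Perm (permGroup σ)) :=
  Subgroup.closure (Set.range (twist hnd))

theorem conj_mem_twistGroup (hnd : Nondeg σ) (g : permGroup σ) {a : Equiv.Perm (permGroup σ)}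
    (ha : a ∈ twistGroup hnd) :
    (Equiv.mulRight g)⁻¹ * a * Equiv.mulRight g ∈ twistGroup hnd := by
  induction ha using Subgroup.closure_induction with
  | mem a ha =>
    obtain ⟨x, rfl⟩ := ha
    rw [conj_twist]
    exact Subgroup.subset_closure ⟨_, rfl⟩
  | one => rw [mul_one, inv_mul_cancel]; exact one_mem _
  | mul a b _ _ ha hb =>
    generalize Equiv.mulRight g = t at *
    simpa [mul_assoc] using mul_mem ha hb
  | inv a _ ha =>
    generalize Equiv.mulRight g = t at *
    simpa [mul_assoc] using inv_mem ha

theorem isMulCommutative_twistGroup (hlaw : CycleSetLaw σ) (hnd : Nondeg σ) :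
    IsMulCommutative (twistGroup hnd) :=
  Subgroup.isMulCommutative_closure (by
    rintro _ ⟨x, rfl⟩ _ ⟨y, rfl⟩
    exact hlaw.twist_comm hnd x y)

/-- The conjugation action of the permutation group on the twist group. -/
noncomputable instance (hnd : Nondeg σ) :
    DistribMulAction (permGroup σ) (Additive (twistGroup hnd)) where
  smul g a := Additive.ofMul ⟨_, conj_mem_twistGroup hnd g a.toMul.2⟩
  one_smul a := Subtype.ext (Equiv.ext fun h => by
    change a.toMul.1 (h * 1) * 1⁻¹ = a.toMul.1 h
    simp)
  mul_smul g g' a := Subtype.ext (Equiv.ext fun h => by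
    change a.toMul.1 (h * (g * g')) * (g * g')⁻¹ = a.toMul.1 (h * g * g') * g'⁻¹ * g⁻¹
    simp [mul_assoc])
  smul_zero g := Subtype.ext (Equiv.ext fun h => by
    change h * g * g⁻¹ = h
    simp)
  smul_add g a b := Subtype.ext (Equiv.ext fun h => by
    change a.toMul.1 (b.toMul.1 (h * g)) * g⁻¹ =
      a.toMul.1 (b.toMul.1 (h * g) * g⁻¹ * g) * g⁻¹
    simp)

theorem apply_eq_smul_apply_one_mul (hnd : Nondeg σ) (a : Additive (twistGroup hnd))
    (h : permGroup σ) : a.toMul.1 h = (h • a).toMul.1 1 * h := by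
  change _ = a.toMul.1 (1 * h) * h⁻¹ * h
  simp

theorem surjective_apply_one (hnd : Nondeg σ) :
    Function.Surjective fun a : Additive (twistGroup hnd) => a.toMul.1 1 := by
  have hmul (y : X) (g : permGroup σ) : sigmaG σ y * g = twist hnd (g⁻¹ • y) g := by
    rw [twist_apply, smul_inv_smul]
  have hleft (y : X) (g : permGroup σ) (hg : ∃ a ∈ twistGroup hnd, a 1 = g) :
      ∃ a ∈ twistGroup hnd, a 1 = sigmaG σ y * g := by
    obtain ⟨a, ha, rfl⟩ := hg
    exact ⟨twist hnd ((a 1)⁻¹ • y) * a, mul_mem (Subgroup.subset_closure ⟨_, rfl⟩) ha,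
      (hmul y (a 1)).symm⟩
  have hleft_inv (y : X) (g : permGroup σ) (hg : ∃ a ∈ twistGroup hnd, a 1 = g) :
      ∃ a ∈ twistGroup hnd, a 1 = (sigmaG σ y)⁻¹ * g := by
    obtain ⟨a, ha, h⟩ := hg
    obtain ⟨g', rfl⟩ : ∃ g', g = sigmaG σ y * g' := ⟨_, (mul_inv_cancel_left _ g).symm⟩
    refine ⟨(twist hnd (g'⁻¹ • y))⁻¹ * a, mul_mem (inv_mem (Subgroup.subset_closure ⟨_, rfl⟩)) ha,
      ?_⟩
    rw [Equiv.Perm.mul_apply, h, inv_mul_cancel_left, Equiv.Perm.inv_eq_iff_eq, hmul]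
  have hmem (g : permGroup σ) : ∃ a ∈ twistGroup hnd, a 1 = g := by
    obtain ⟨g, hg⟩ := g
    induction hg using Subgroup.closure_induction_left with
    | one => exact ⟨1, one_mem _, rfl⟩
    | mul_left x hx y hy ih =>
      obtain ⟨z, rfl⟩ := hx
      exact hleft z ⟨y, hy⟩ ih
    | inv_mul_cancel x hx y hy ih =>
      obtain ⟨z, rfl⟩ := hx
      exact hleft_inv z ⟨y, hy⟩ ih
  intro g
  obtain ⟨a, ha, h⟩ := hmem g
  exact ⟨Additive.ofMul ⟨a, ha⟩, h⟩

theorem injective_apply_one (hlaw : CycleSetLaw σ) (hnd : Nondeg σ) :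
    Function.Injective fun a : Additive (twistGroup hnd) => a.toMul.1 1 := by
  intro a b hab
  refine Subtype.ext (Equiv.ext fun g => ?_)
  obtain ⟨c, rfl⟩ := surjective_apply_one hnd g
  have hcomm (d : Additive (twistGroup hnd)) :
      d.toMul.1 (c.toMul.1 1) = c.toMul.1 (d.toMul.1 1) := by
    have := (hlaw.isMulCommutative_twistGroup hnd).is_comm.comm d.toMul c.toMul
    exact congrArg (fun f : twistGroup hnd => f.1 1) this
  exact (hcomm a).trans ((congrArg c.toMul.1 hab).trans (hcomm b).symm)

open scoped IsMulCommutative in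
/-- The brace action of the permutation group of a finite non-degenerate cycle set. -/
theorem exists_braceAction.{u} {X : Type u} [Finite X] {σ : X → Equiv.Perm X}
    (hlaw : CycleSetLaw σ) (hnd : Nondeg σ) :
    ∃ (A : Type u) (_ : AddCommGroup A) (_ : DistribMulAction (permGroup σ) A)
      (B : BraceAction (permGroup σ) A X), ∀ x, B.s (B.ι x) = sigmaG σ x := by
  have := hlaw.isMulCommutative_twistGroup hnd
  let B : BraceAction (permGroup σ) (Additive (twistGroup hnd)) X :=
    { s a := a.toMul.1 1
      ι x := Additive.ofMul ⟨twist hnd x, Subgroup.subset_closure ⟨x, rfl⟩⟩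
      bij := ⟨hlaw.injective_apply_one hnd, surjective_apply_one hnd⟩
      s_add a b := by
        rw [add_comm]
        exact apply_eq_smul_apply_one_mul hnd b (a.toMul.1 1)
      smul_ι g x := Subtype.ext (conj_twist hnd g x)
      closure_ι := by
        rw [eq_top_iff]
        rintro ⟨a, ha⟩ -
        induction ha using Subgroup.closure_induction with
        | mem a ha =>
          obtain ⟨x, rfl⟩ := ha
          exact AddSubgroup.subset_closure ⟨x, rfl⟩
        | one => exact zero_mem _
        | mul a b _ _ ha hb => exact add_mem ha hb
        | inv a _ ha => exact neg_mem ha }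
  refine ⟨_, _, _, B, fun x => ?_⟩
  change sigmaG σ ((1 : permGroup σ) • x) * 1 = sigmaG σ x
  rw [one_smul, mul_one]

end CycleSetLaw

/-- if a finite latin non-degenerate cycle set has cardinality `p²` for a
prime `p`, then `p = 2`; in particular there is no latin cycle set of cardinality `p²`
for any odd prime `p`. -/
theorem stmt_11 {X : Type*} [Finite X] (p : ℕ) (hp : p.Prime) (σ : X → Equiv.Perm X)
    (hlaw : CycleSetLaw σ) (hnd : Nondeg σ) (hlatin : LatinLQ σ)
    (hcard : Nat.card X = p ^ 2) :
    p = 2 := by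
  obtain ⟨A, _, _, B, hB⟩ := hlaw.exists_braceAction hnd
  have hlat (z : X) : Function.Bijective fun x => B.s (B.ι x) • z := by
    simp only [hB]
    exact hlatin z
  have : MulAction.IsPretransitive (permGroup σ) X :=
    ⟨fun x y => ((hlat x).2 y).imp' (fun v => B.s (B.ι v)) fun _ h => h⟩
  exact B.eq_two_of_latin hp hcard hlat
end

section
/- Let p be a prime number and let X be a finite latin non-degenerate cycle set with |X| = p³. Then X is simple. -/
/-- A finite abelian group `A` with an injective cocycle `perm : A → Perm F` whose image is
transitive, generated by the differences `diff x y` of points of `F`. -/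
structure AffineCocycle (F A : Type*) [AddCommGroup A] where
  perm : A → Equiv.Perm F
  perm_injective : Function.Injective perm
  act : A → A →+ A
  perm_add : ∀ a b, perm (a + b) = perm (act a b) * perm a
  diff : F → F → A
  diff_add : ∀ x y z, diff x y + diff y z = diff x z
  act_diff : ∀ a x y, act a (diff x y) = diff (perm a x) (perm a y)
  closure_diff : AddSubgroup.closure {a | ∃ x y, diff x y = a} = ⊤
  transitive : ∀ x y, ∃ a, perm a x = y

namespace AffineCocycle

variable {F A : Type*} [AddCommGroup A] (C : AffineCocycle F A)

theorem perm_zero : C.perm 0 = 1 := by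
  have h := C.perm_add 0 0
  rw [map_zero, add_zero] at h
  exact left_eq_mul.mp h

theorem act_injective (a : A) : Function.Injective (C.act a) := by
  refine (injective_iff_map_eq_zero _).2 fun b hb => ?_
  have h := C.perm_add a b
  rw [hb, C.perm_zero, one_mul] at h
  simpa using C.perm_injective h

/-- The image under the cocycle of an invariant additive subgroup. -/
def image [Finite A] (B : AddSubgroup A) (hB : ∀ a, ∀ b ∈ B, C.act a b ∈ B) :
    Subgroup (Equiv.Perm F) where
  carrier := Set.image C.perm B
  one_mem' := ⟨0, B.zero_mem, C.perm_zero⟩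
  mul_mem' := by
    rintro _ _ ⟨v, hv, rfl⟩ ⟨w, hw, rfl⟩
    have hsurj : Function.Surjective fun b : B => (⟨C.act w b, hB w b b.2⟩ : B) :=
      Finite.surjective_of_injective fun b c h =>
        Subtype.ext (C.act_injective w (congrArg Subtype.val h))
    obtain ⟨b, hb⟩ := hsurj ⟨v, hv⟩
    refine ⟨w + b, B.add_mem hw b.2, ?_⟩
    have hb' : C.act w b = v := congrArg Subtype.val hb
    rw [C.perm_add, hb']
  inv_mem' := by
    rintro _ ⟨v, hv, rfl⟩
    refine ⟨C.act v (-v), hB _ _ (B.neg_mem hv), ?_⟩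
    have h := C.perm_add v (-v)
    rw [add_neg_cancel, C.perm_zero] at h
    exact eq_inv_of_mul_eq_one_left h.symm

theorem card_image [Finite A] (B : AddSubgroup A) (hB : ∀ a, ∀ b ∈ B, C.act a b ∈ B) :
    Nat.card (C.image B hB) = Nat.card B :=
  Nat.card_image_of_injective C.perm_injective (B : Set A)

theorem card_dvd_factorial [Finite A] [Finite F] (C : AffineCocycle F A) :
    Nat.card A ∣ (Nat.card F).factorial := by
  rw [← Nat.card_perm, ← Nat.card_congr (AddSubgroup.topEquiv (G := A)).toEquiv,
    ← C.card_image ⊤ fun _ _ _ => trivial]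
  exact Subgroup.card_subgroup_dvd_card _

theorem card_dvd_card [Finite A] [Nonempty F] (C : AffineCocycle F A) :
    Nat.card F ∣ Nat.card A := by
  let H := C.image ⊤ fun _ _ _ => trivial
  have : MulAction.IsPretransitive H F := ⟨fun x y => by
    obtain ⟨a, ha⟩ := C.transitive x y
    exact ⟨⟨C.perm a, a, trivial, rfl⟩, ha⟩⟩
  obtain ⟨x⟩ := ‹Nonempty F›
  rw [← MulAction.index_stabilizer_of_transitive H x,
    ← Nat.card_congr (AddSubgroup.topEquiv (G := A)).toEquiv,
    ← C.card_image ⊤ fun _ _ _ => trivial]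
  exact Subgroup.index_dvd_card _

end AffineCocycle

section Characters

variable {A : Type*} [AddCommGroup A] {p : ℕ} [Fact p.Prime]

theorem exists_linearMap_apply_ne_zero {K A : Type*} [AddCommGroup A] [Field K] [Module K A]
    {a : A} (ha : a ≠ 0) : ∃ f : A →ₗ[K] K, f a ≠ 0 :=
  Module.Projective.exists_dual_ne_zero K ha

theorem exists_zmod_apply_ne_zero (h : ∀ a : A, p • a = 0) {a : A} (ha : a ≠ 0) :
    ∃ f : A →+ ZMod p, f a ≠ 0 := by
  let _ : Module (ZMod p) A := AddCommGroup.zmodModule h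
  obtain ⟨f, hf⟩ := exists_linearMap_apply_ne_zero (K := ZMod p) ha
  exact ⟨f.toAddMonoidHom, hf⟩

theorem exists_surjective_zmod [Finite A] (h : p ∣ Nat.card A) :
    ∃ φ : A →+ ZMod p, Function.Surjective φ := by
  let m : A →+ A := nsmulAddMonoidHom p
  have hm : ¬ Function.Surjective m := by
    intro hs
    obtain ⟨a, ha⟩ := exists_prime_addOrderOf_dvd_card' p h
    have ha0 : a = 0 := (Finite.injective_iff_surjective.2 hs) (by
      change p • a = p • 0
      rw [← ha, addOrderOf_nsmul_eq_zero, nsmul_zero])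
    rw [ha0, addOrderOf_zero] at ha
    exact (Fact.out : p.Prime).one_lt.ne ha
  obtain ⟨a, ha⟩ : ∃ a, a ∉ m.range := by
    by_contra hc
    push Not at hc
    exact hm hc
  have ha' : (QuotientAddGroup.mk a : A ⧸ m.range) ≠ 0 :=
    fun h0 => ha ((QuotientAddGroup.eq_zero_iff a).1 h0)
  obtain ⟨f, hf⟩ := exists_zmod_apply_ne_zero (p := p) (fun q => by
    obtain ⟨b, rfl⟩ := QuotientAddGroup.mk_surjective q
    exact (QuotientAddGroup.eq_zero_iff _).2 ⟨b, rfl⟩) ha'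
  refine ⟨f.comp (QuotientAddGroup.mk' _), fun s => ?_⟩
  obtain ⟨q, hq⟩ : ∃ q, f q = s := ⟨(s / f (QuotientAddGroup.mk a)).val • QuotientAddGroup.mk a, by
    rw [map_nsmul, nsmul_eq_mul, ZMod.natCast_zmod_val, div_mul_cancel₀ _ hf]⟩
  obtain ⟨b, rfl⟩ := QuotientAddGroup.mk_surjective q
  exact ⟨b, hq⟩

theorem not_dvd_card_ker (h : ¬ p ^ 2 ∣ Nat.card A) {φ : A →+ ZMod p}
    (hφ : Function.Surjective φ) : ¬ p ∣ Nat.card φ.ker := by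
  have hc := AddSubgroup.card_eq_card_quotient_mul_card_addSubgroup φ.ker
  rw [Nat.card_congr (QuotientAddGroup.quotientKerEquivOfSurjective φ hφ).toEquiv,
    Nat.card_zmod] at hc
  intro hd
  apply h
  rw [hc, sq]
  exact mul_dvd_mul_left p hd

/-- If `p` divides `|A|` exactly once, characters of order `p` are unique up to a scalar. -/
theorem eq_const_mul_of_surjective_zmod [Finite A] (h : ¬ p ^ 2 ∣ Nat.card A) {φ : A →+ ZMod p}
    (hφ : Function.Surjective φ) (ψ : A →+ ZMod p) : ∃ b, ∀ a, ψ a = b * φ a := by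
  have hk := not_dvd_card_ker h hφ
  have hker : ∀ a, φ a = 0 → ψ a = 0 := by
    intro a ha
    have h0 : Nat.card φ.ker • a = 0 := by
      simpa using congrArg Subtype.val (card_nsmul_eq_zero' (x := (⟨a, ha⟩ : φ.ker)))
    have h1 := congrArg ψ h0
    rw [map_nsmul, map_zero, nsmul_eq_mul] at h1
    exact (mul_eq_zero.1 h1).resolve_left fun h2 => hk ((ZMod.natCast_eq_zero_iff _ _).1 h2)
  obtain ⟨e, he⟩ := hφ 1
  refine ⟨ψ e, fun a => ?_⟩
  have h1 := hker (a - (φ a).val • e) (by simp [he])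
  rw [map_sub, map_nsmul, sub_eq_zero, nsmul_eq_mul, ZMod.natCast_zmod_val] at h1
  rw [h1, mul_comm]

theorem eq_zero_of_nsmul_eq_zero [Finite A] (h : ¬ p ^ 2 ∣ Nat.card A) {φ : A →+ ZMod p}
    (hφ : Function.Surjective φ) {a : A} (ha : φ a = 0) (hpa : p • a = 0) : a = 0 := by
  have h0 : Nat.card φ.ker • a = 0 := by
    simpa using congrArg Subtype.val (card_nsmul_eq_zero' (x := (⟨a, ha⟩ : φ.ker)))
  have h1 := Nat.dvd_gcd (addOrderOf_dvd_of_nsmul_eq_zero hpa) (addOrderOf_dvd_of_nsmul_eq_zero h0)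
  rw [((Fact.out : p.Prime).coprime_iff_not_dvd.2 (not_dvd_card_ker h hφ)).gcd_eq_one] at h1
  exact AddMonoid.addOrderOf_eq_one_iff.1 (Nat.dvd_one.1 h1)

end Characters

namespace AffineCocycle

variable {F A : Type*} [AddCommGroup A] [Finite A] [Finite F]
  {p : ℕ} [Fact p.Prime]

theorem not_sq_dvd_card (C : AffineCocycle F A) (hF : Nat.card F = p) : ¬ p ^ 2 ∣ Nat.card A := by
  intro h
  have h1 := h.trans C.card_dvd_factorial
  have hp : p.Prime := Fact.out
  rw [hF, ← Nat.mul_factorial_pred hp.ne_zero, sq] at h1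
  have h2 := Nat.dvd_of_mul_dvd_mul_left hp.pos h1
  have := (hp.dvd_factorial).1 h2
  have := hp.pos
  omega

/-- Affine coordinates in `ZMod p` for an affine cocycle: `char` is a character of order `p`,
`coord` is compatible with it, and `p`-torsion elements act as translations. -/
structure Coordinates (C : AffineCocycle F A) (p : ℕ) where
  char : A →+ ZMod p
  char_surjective : Function.Surjective char
  coord : F → ZMod p
  coord_bijective : Function.Bijective coord
  char_diff : ∀ x y, char (C.diff x y) = coord x - coord y
  scale : ZMod p
  scale_ne_zero : scale ≠ 0
  exists_torsion : ∀ s, ∃ v, p • v = 0 ∧ char v = s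
  coord_perm : ∀ v, p • v = 0 → ∀ x, coord (C.perm v x) = coord x + scale * char v

theorem pow_eq_one_of_torsion (C : AffineCocycle F A) (hF : Nat.card F = p) {v : A}
    (hv : p • v = 0) : C.perm v ^ p = 1 := by
  have : Nonempty F := (Nat.card_pos_iff.1 (hF ▸ (Fact.out : p.Prime).pos)).1
  obtain ⟨φ, hφ⟩ := exists_surjective_zmod (A := A) (p := p) (hF ▸ C.card_dvd_card)
  let B : AddSubgroup A := (nsmulAddMonoidHom p : A →+ A).ker
  have hB : ∀ a, ∀ b ∈ B, C.act a b ∈ B := by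
    intro a b hb
    have hb' : p • b = 0 := hb
    change p • C.act a b = 0
    rw [← map_nsmul, hb', map_zero]
  have hinj : Function.Injective (φ.comp B.subtype) := by
    refine (injective_iff_map_eq_zero _).2 fun b hb => Subtype.ext ?_
    exact eq_zero_of_nsmul_eq_zero (C.not_sq_dvd_card hF) hφ hb b.2
  have hcard : Nat.card B ∣ p := by
    have h := AddSubgroup.card_addSubgroup_dvd_card (φ.comp B.subtype).range
    rwa [Nat.card_zmod,
      ← Nat.card_congr (AddMonoidHom.ofInjective hinj).toEquiv] at h
  have hpow : (⟨C.perm v, v, hv, rfl⟩ : C.image B hB) ^ p = 1 := by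
    apply orderOf_dvd_iff_pow_eq_one.1
    exact (orderOf_dvd_natCard _).trans (C.card_image B hB ▸ hcard)
  exact congrArg Subtype.val hpow

theorem exists_pow_apply_eq {g : Equiv.Perm F} (hF : Nat.card F = p) (hg : g ^ p = 1)
    (hg1 : g ≠ 1) (x y : F) : ∃ n : ℕ, (g ^ n) x = y := by
  classical
  have := Fintype.ofFinite F
  rw [Nat.card_eq_fintype_card] at hF
  have ho : orderOf g = Fintype.card F := hF ▸ orderOf_eq_prime hg hg1
  have hc : g.IsCycle := Equiv.Perm.isCycle_of_prime_order'' (hF ▸ Fact.out) ho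
  have hs : g.support = Finset.univ := Finset.eq_univ_of_card _ (hc.orderOf.symm.trans ho)
  have hmem : ∀ z, g z ≠ z := fun z => Equiv.Perm.mem_support.1 (hs ▸ Finset.mem_univ z)
  exact hc.exists_pow_eq (hmem x) (hmem y)

theorem nonempty_coordinates (C : AffineCocycle F A) (hF : Nat.card F = p) :
    Nonempty (C.Coordinates p) := by
  have hp : p.Prime := Fact.out
  have hne : Nonempty F := (Nat.card_pos_iff.1 (hF ▸ hp.pos)).1
  have hdvd : p ∣ Nat.card A := hF ▸ C.card_dvd_card
  obtain ⟨o⟩ := hne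
  have hsq := C.not_sq_dvd_card hF
  obtain ⟨φ, hφ⟩ := exists_surjective_zmod hdvd
  obtain ⟨η, hη⟩ : ∃ η : F → ZMod p, ∀ x y, φ (C.diff x y) = η x - η y :=
    ⟨fun x => φ (C.diff x o), fun x y => by
      simp only [← C.diff_add x y o, map_add, add_sub_cancel_right]⟩
  have hconst : ∃ x y, η x ≠ η y := by
    by_contra! hc
    have hle : AddSubgroup.closure {a | ∃ x y, C.diff x y = a} ≤ φ.ker := by
      rw [AddSubgroup.closure_le]
      rintro _ ⟨x, y, rfl⟩
      exact (hη x y).trans (sub_eq_zero.2 (hc x y))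
    obtain ⟨a, ha⟩ := hφ 1
    have ha' : φ a = 0 := hle (C.closure_diff ▸ AddSubgroup.mem_top a)
    exact one_ne_zero (ha.symm.trans ha')
  have hinv : ∀ v, p • v = 0 → ∀ a, φ (C.act v a) = φ a := by
    intro v hv
    obtain ⟨χ, hχ⟩ := eq_const_mul_of_surjective_zmod hsq hφ (φ.comp (C.act v))
    have hstep : ∀ x y, η (C.perm v x) - η (C.perm v y) = χ * (η x - η y) := fun x y => by
      rw [← hη, ← hη, ← C.act_diff]
      exact hχ _
    have hiter : ∀ (n : ℕ) x y,
        η ((C.perm v ^ n) x) - η ((C.perm v ^ n) y) = χ ^ n * (η x - η y) := by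
      intro n
      induction n with
      | zero => simp
      | succ k ih =>
        intro x y
        rw [pow_succ, Equiv.Perm.mul_apply, Equiv.Perm.mul_apply, ih, hstep, pow_succ, mul_assoc]
    obtain ⟨x, y, hxy⟩ := hconst
    have h := hiter p x y
    rw [C.pow_eq_one_of_torsion hF hv, ZMod.pow_card, Equiv.Perm.one_apply,
      Equiv.Perm.one_apply] at h
    have hχ1 : χ = 1 := (right_eq_mul₀ (sub_ne_zero.2 hxy)).1 h
    intro a
    simpa [hχ1] using hχ a
  have htrans : ∀ v, p • v = 0 → ∀ x, η (C.perm v x) = η x + (η (C.perm v o) - η o) := by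
    intro v hv x
    have h := hinv v hv (C.diff x o)
    rw [C.act_diff, hη, hη] at h
    linear_combination h
  have hfix : ∀ v, p • v = 0 → ∀ w, p • w = 0 → C.act v w = w := by
    intro v hv w hw
    rw [← sub_eq_zero]
    refine eq_zero_of_nsmul_eq_zero hsq hφ ?_ ?_
    · rw [map_sub, hinv v hv, sub_self]
    · rw [nsmul_sub, ← map_nsmul, hw, map_zero, sub_zero]
  obtain ⟨e, he⟩ := exists_prime_addOrderOf_dvd_card' p hdvd
  have hpe : p • e = 0 := he ▸ addOrderOf_nsmul_eq_zero e
  have he0 : e ≠ 0 := by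
    rintro rfl
    rw [addOrderOf_zero] at he
    exact hp.one_lt.ne he
  have hφe : φ e ≠ 0 := fun h => he0 (eq_zero_of_nsmul_eq_zero hsq hφ h hpe)
  have hpk : ∀ k : ℕ, p • k • e = 0 := fun k => by rw [smul_comm, hpe, smul_zero]
  set t := η (C.perm e o) - η o with ht
  have hmul : ∀ (k : ℕ) x, η (C.perm (k • e) x) = η x + k * t := by
    intro k
    induction k with
    | zero => simp [C.perm_zero]
    | succ k ih =>
      intro x
      rw [succ_nsmul, C.perm_add, hfix _ (hpk k) _ hpe, Equiv.Perm.mul_apply, htrans e hpe, ih]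
      push_cast
      ring
  have ht0 : t ≠ 0 := by
    intro h0
    obtain ⟨x, y, hxy⟩ := hconst
    have hne1 : C.perm e ≠ 1 := fun h => he0 (C.perm_injective (h.trans C.perm_zero.symm))
    obtain ⟨n, rfl⟩ := exists_pow_apply_eq hF (C.pow_eq_one_of_torsion hF hpe) hne1 x y
    apply hxy
    clear hxy
    induction n with
    | zero => simp
    | succ k ih => rw [pow_succ', Equiv.Perm.mul_apply, htrans e hpe, ← ht, h0, add_zero, ← ih]
  have htors : ∀ s, ∃ k : ℕ, φ (k • e) = s := fun s =>
    ⟨(s / φ e).val, by rw [map_nsmul, nsmul_eq_mul, ZMod.natCast_zmod_val, div_mul_cancel₀ _ hφe]⟩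
  refine ⟨⟨φ, hφ, η, ?_, hη, t / φ e, div_ne_zero ht0 hφe,
    fun s => (htors s).elim fun k hk => ⟨k • e, hpk k, hk⟩, fun v hv x => ?_⟩⟩
  · refine Function.Surjective.bijective_of_nat_card_le (fun s => ?_) ?_
    · refine ⟨C.perm (((s - η o) / t).val • e) o, ?_⟩
      rw [hmul, ZMod.natCast_zmod_val, div_mul_cancel₀ _ ht0, add_sub_cancel]
    · rw [hF, Nat.card_zmod]
  · obtain ⟨k, hk⟩ := htors (φ v)
    have hvk : v = k • e := sub_eq_zero.1 (eq_zero_of_nsmul_eq_zero hsq hφ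
      (by rw [map_sub, hk, sub_self]) (by rw [nsmul_sub, hv, hpk, sub_zero]))
    rw [hvk, hmul, map_nsmul, nsmul_eq_mul]
    field_simp

end AffineCocycle
/-- A family of binary operations on `F`, indexed by `ZMod ℓ`, which satisfies the identities of a
latin non-degenerate cycle set with a shift of the index at each multiplication. -/
structure GradedCycleSet (F : Type*) (ℓ : ℕ) where
  τ : ZMod ℓ → F → Equiv.Perm F
  law : ∀ i x y, τ (i + 1) (τ i x y) * τ i x = τ (i + 1) (τ i y x) * τ i y
  diag_injective : ∀ i, Function.Injective fun x => τ i x x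
  latin : ∀ i y, Function.Injective fun x => τ i x y

namespace GradedCycleSet

variable {F : Type*} {ℓ : ℕ} (G : GradedCycleSet F ℓ)

/-- Multiplication of a state `(i, g)` by a point. -/
def step (x : F) (s : ZMod ℓ × Equiv.Perm F) : ZMod ℓ × Equiv.Perm F :=
  (s.1 + 1, G.τ s.1 (s.2 x) * s.2)

instance : LeftCommutative G.step where
  left_comm x y s := by
    simp only [step, Equiv.Perm.mul_apply, ← mul_assoc, G.law]

theorem step_injective (x : F) : Function.Injective (G.step x) := by
  rintro ⟨i, g⟩ ⟨j, h⟩ hs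
  obtain ⟨hi, hg⟩ := Prod.mk.inj hs
  obtain rfl : i = j := add_right_cancel hi
  have hx : g x = h x := G.diag_injective i (congrArg (fun k : Equiv.Perm F => k x) hg)
  simp only [hx] at hg
  rw [mul_left_cancel hg]

/-- Multiplication of a state by all points of a multiset. -/
def run (s : ZMod ℓ × Equiv.Perm F) (v : Multiset F) : ZMod ℓ × Equiv.Perm F :=
  v.foldr G.step s

theorem run_zero (s : ZMod ℓ × Equiv.Perm F) : G.run s 0 = s :=
  Multiset.foldr_zero _ _

theorem run_cons (s : ZMod ℓ × Equiv.Perm F) (x : F) (v : Multiset F) :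
    G.run s (x ::ₘ v) = G.step x (G.run s v) :=
  Multiset.foldr_cons _ _ _ _

theorem run_add (s : ZMod ℓ × Equiv.Perm F) (v w : Multiset F) :
    G.run s (v + w) = G.run (G.run s w) v :=
  Multiset.foldr_add _ _ _ _

theorem run_comm (s : ZMod ℓ × Equiv.Perm F) (v w : Multiset F) :
    G.run (G.run s w) v = G.run (G.run s v) w := by
  rw [← run_add, add_comm, run_add]

theorem run_injective (v : Multiset F) : Function.Injective fun s => G.run s v := by
  induction v using Multiset.induction_on with
  | empty => simp only [run_zero]; exact Function.injective_id
  | cons x v ih =>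
    simp only [run_cons]
    exact (G.step_injective x).comp ih

theorem run_fst (s : ZMod ℓ × Equiv.Perm F) (v : Multiset F) :
    (G.run s v).1 = s.1 + (Multiset.card v : ZMod ℓ) := by
  induction v using Multiset.induction_on with
  | empty => simp [run_zero]
  | cons x v ih => simp [run_cons, step, ih, add_assoc]

theorem run_map (i : ZMod ℓ) (g : Equiv.Perm F) (v : Multiset F) :
    G.run (i, g) v = ((G.run (i, 1) (v.map g)).1, (G.run (i, 1) (v.map g)).2 * g) := by
  induction v using Multiset.induction_on with
  | empty => simp [run_zero]
  | cons x v ih => simp [run_cons, step, ih, mul_assoc]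

/-- Two multisets are equivalent at level `i` if they lead from `(i, 1)` to the same state. -/
def con (i : ZMod ℓ) : AddCon (Multiset F) where
  r v w := G.run (i, 1) v = G.run (i, 1) w
  iseqv := ⟨fun _ => rfl, Eq.symm, Eq.trans⟩
  add' {v v' w w'} hv hw := by
    change G.run (i, 1) v = G.run (i, 1) v' at hv
    change G.run (i, 1) w = G.run (i, 1) w' at hw
    rw [run_add, run_add, hw, run_comm, hv, run_comm]

/-- The structure monoid at level `i`, modulo equality of the states reached from `(i, 1)`. -/
abbrev Walks (i : ZMod ℓ) : Type _ := (G.con i).Quotient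

/-- The state reached by a walk. -/
def state {i : ZMod ℓ} (q : G.Walks i) : ZMod ℓ × Equiv.Perm F :=
  AddCon.liftOn q (G.run (i, 1)) fun _ _ h => h

theorem state_coe {i : ZMod ℓ} (v : Multiset F) :
    G.state (v : G.Walks i) = G.run (i, 1) v := rfl

theorem state_injective (i : ZMod ℓ) : Function.Injective (G.state (i := i)) := by
  intro q r
  induction q using AddCon.induction_on
  induction r using AddCon.induction_on
  exact fun h => (AddCon.eq _).2 h

instance [Finite F] [NeZero ℓ] (i : ZMod ℓ) : Finite (G.Walks i) :=
  Finite.of_injective _ (G.state_injective i)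

theorem walks_add_right_injective {i : ZMod ℓ} (a : G.Walks i) :
    Function.Injective fun q => q + a := by
  intro q r
  induction q using AddCon.induction_on with | _ q
  induction r using AddCon.induction_on with | _ r
  induction a using AddCon.induction_on with | _ a
  intro h
  have h' : G.run (i, 1) (q + a) = G.run (i, 1) (r + a) := congrArg G.state h
  rw [add_comm q, add_comm r, run_add, run_add] at h'
  exact (AddCon.eq _).2 (G.run_injective a h')

theorem exists_neg [Finite F] [NeZero ℓ] {i : ZMod ℓ} (a : G.Walks i) : ∃ q, q + a = 0 :=
  Finite.surjective_of_injective (G.walks_add_right_injective a) 0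

noncomputable instance [Finite F] [NeZero ℓ] (i : ZMod ℓ) : AddCommGroup (G.Walks i) :=
  let _ : Neg (G.Walks i) := ⟨fun a => (G.exists_neg a).choose⟩
  { (inferInstance : AddCommMonoid (G.Walks i)) with
    zsmul := zsmulRec
    neg_add_cancel := fun a => (G.exists_neg a).choose_spec }

/-- The walk made of a single point. -/
def of (i : ZMod ℓ) (x : F) : G.Walks i := (({x} : Multiset F) : G.Walks i)

theorem state_of (i : ZMod ℓ) (x : F) : G.state (G.of i x) = (i + 1, G.τ i x) := by
  change G.run (i, 1) (x ::ₘ 0) = _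
  rw [run_cons, run_zero]
  simp [step]

/-- The homomorphism between structure monoids induced by the permutation a walk leads to. -/
def push {i j : ZMod ℓ} {g : Equiv.Perm F} (u : G.Walks i) (hu : G.state u = (j, g)) :
    G.Walks i →+ G.Walks j :=
  AddCon.lift (G.con i) ((AddCon.mk' (G.con j)).comp (Multiset.mapAddMonoidHom g)) (by
    intro v w hvw
    induction u using AddCon.induction_on with | _ u
    refine (AddCon.eq _).2 ?_
    change G.run (j, 1) (v.map g) = G.run (j, 1) (w.map g)
    change G.run (i, 1) v = G.run (i, 1) w at hvw
    rw [state_coe] at hu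
    have h : G.run (j, g) v = G.run (j, g) w := by
      rw [← hu, run_comm, hvw, run_comm]
    rw [run_map, run_map G j g w] at h
    obtain ⟨h1, h2⟩ := Prod.mk.inj h
    exact Prod.ext h1 (mul_right_cancel h2))

theorem push_of {i j : ZMod ℓ} {g : Equiv.Perm F} (u : G.Walks i) (hu : G.state u = (j, g))
    (x : F) : G.push u hu (G.of i x) = G.of j (g x) := by
  simp [push, of]

theorem state_add {i j : ZMod ℓ} {g : Equiv.Perm F} (u : G.Walks i) (hu : G.state u = (j, g))
    (q : G.Walks i) :
    G.state (u + q) = ((G.state (G.push u hu q)).1, (G.state (G.push u hu q)).2 * g) := by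
  induction u using AddCon.induction_on with | _ u
  induction q using AddCon.induction_on with | _ q
  have hu' : G.run (i, 1) u = (j, g) := hu
  rw [add_comm, ← AddCon.coe_add, state_coe, run_add, hu', run_map]
  rfl

variable [Finite F] [NeZero ℓ]

/-- The group generated by the differences of points at level `i`. -/
noncomputable def displacements (i : ZMod ℓ) : AddSubgroup (G.Walks i) :=
  AddSubgroup.closure {a | ∃ x y, G.of i x - G.of i y = a}

/-- The difference of two points. -/
noncomputable def diff (i : ZMod ℓ) (x y : F) : G.displacements i :=
  ⟨G.of i x - G.of i y, AddSubgroup.subset_closure ⟨x, y, rfl⟩⟩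

/-- The degree of a walk modulo `ℓ`. -/
noncomputable def degree (i : ZMod ℓ) : G.Walks i →+ ZMod ℓ where
  toFun q := (G.state q).1 - i
  map_zero' := by
    change (G.run (i, 1) 0).1 - i = 0
    simp [run_zero]
  map_add' q r := by
    induction q using AddCon.induction_on
    induction r using AddCon.induction_on
    rw [← AddCon.coe_add]
    simp only [state_coe, run_fst, Multiset.card_add]
    push_cast
    ring

theorem degree_of_mem {i : ZMod ℓ} {a : G.Walks i} (ha : a ∈ G.displacements i) :
    G.degree i a = 0 := by
  suffices h : G.displacements i ≤ (G.degree i).ker from h ha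
  refine (AddSubgroup.closure_le _).2 ?_
  rintro _ ⟨x, y, rfl⟩
  simp [degree, state_of, AddMonoidHom.mem_ker, map_sub]

/-- The permutation defined by a displacement. -/
noncomputable def perm (i : ZMod ℓ) (a : G.displacements i) : Equiv.Perm F := (G.state a.1).2

theorem state_displacement {i : ZMod ℓ} (a : G.displacements i) :
    G.state a.1 = (i, G.perm i a) :=
  Prod.ext (sub_eq_zero.1 (G.degree_of_mem a.2)) rfl

/-- Restriction of `push` to displacements. -/
noncomputable def pushDisplacements {i j : ZMod ℓ} {g : Equiv.Perm F} (u : G.Walks i)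
    (hu : G.state u = (j, g)) : G.displacements i →+ G.displacements j :=
  ((G.push u hu).comp (G.displacements i).subtype).codRestrict _ (by
    suffices h : G.displacements i ≤ (G.displacements j).comap (G.push u hu) from fun a => h a.2
    refine (AddSubgroup.closure_le _).2 ?_
    rintro _ ⟨x, y, rfl⟩
    change G.push u hu _ ∈ G.displacements j
    rw [map_sub, push_of, push_of]
    exact (G.diff j (g x) (g y)).2)

theorem pushDisplacements_diff {i j : ZMod ℓ} {g : Equiv.Perm F} (u : G.Walks i)
    (hu : G.state u = (j, g)) (x y : F) :
    G.pushDisplacements u hu (G.diff i x y) = G.diff j (g x) (g y) := by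
  apply Subtype.ext
  change G.push u hu (G.of i x - G.of i y) = G.of j (g x) - G.of j (g y)
  rw [map_sub, push_of, push_of]

theorem state_add_displacement {i j : ZMod ℓ} {g : Equiv.Perm F} (u : G.Walks i)
    (hu : G.state u = (j, g)) (a : G.displacements i) :
    G.state (u + a.1) = (j, G.perm j (G.pushDisplacements u hu a) * g) := by
  rw [G.state_add u hu]
  have h := congrArg Prod.fst (G.state_displacement (G.pushDisplacements u hu a))
  exact Prod.ext h rfl

/-- The map between displacements of consecutive levels induced by `τ i x`. -/
noncomputable def shift (i : ZMod ℓ) (x : F) : G.displacements i →+ G.displacements (i + 1) :=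
  G.pushDisplacements (G.of i x) (G.state_of i x)

theorem shift_diff (i : ZMod ℓ) (x y z : F) :
    G.shift i x (G.diff i y z) = G.diff (i + 1) (G.τ i x y) (G.τ i x z) :=
  G.pushDisplacements_diff _ _ y z

theorem τ_perm_mul_perm (i : ZMod ℓ) (x : F) (a : G.displacements i) :
    G.τ i (G.perm i a x) * G.perm i a = G.perm (i + 1) (G.shift i x a) * G.τ i x := by
  have h1 := G.state_add_displacement (G.of i x) (G.state_of i x) a
  rw [add_comm, G.state_add a.1 (G.state_displacement a), push_of, state_of] at h1
  exact congrArg Prod.snd h1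

theorem τ_eq (i : ZMod ℓ) (x y : F) :
    G.τ i y = G.perm (i + 1) (G.shift i x (G.diff i y x)) * G.τ i x := by
  have h1 := G.state_add_displacement (G.of i x) (G.state_of i x) (G.diff i y x)
  have h2 : G.of i x + (G.diff i y x : G.Walks i) = G.of i y := add_sub_cancel _ _
  rw [h2, state_of] at h1
  exact congrArg Prod.snd h1

theorem perm_transitive (i : ZMod ℓ) (x y : F) : ∃ a, G.perm i a x = y := by
  obtain ⟨j, rfl⟩ : ∃ j, i = j + 1 := ⟨i - 1, by ring⟩
  obtain ⟨z, hz⟩ := (G.τ j x).surjective x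
  obtain ⟨w, hw⟩ := Finite.surjective_of_injective (G.latin j z) y
  refine ⟨G.shift j x (G.diff j w x), ?_⟩
  have h := congrArg (fun g : Equiv.Perm F => g z) (G.τ_eq j x w)
  simp only [Equiv.Perm.mul_apply, hz] at h
  exact h.symm.trans hw

/-- The affine cocycle of displacements at level `i`. -/
noncomputable def cocycle (i : ZMod ℓ) : AffineCocycle F (G.displacements i) where
  perm := G.perm i
  perm_injective a b h := Subtype.ext (G.state_injective i (by
    rw [G.state_displacement, G.state_displacement, h]))
  act a := G.pushDisplacements a.1 (G.state_displacement a)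
  perm_add a b := congrArg Prod.snd (G.state_add_displacement a.1 (G.state_displacement a) b)
  diff := G.diff i
  diff_add x y z := Subtype.ext (sub_add_sub_cancel _ _ _)
  act_diff a x y := G.pushDisplacements_diff a.1 (G.state_displacement a) x y
  closure_diff := by
    have h := AddSubgroup.closure_closure_coe_preimage
      (k := {a : G.Walks i | ∃ x y, G.of i x - G.of i y = a})
    refine (congrArg AddSubgroup.closure ?_).trans h
    ext a
    exact exists_congr fun x => exists_congr fun y => Subtype.ext_iff
  transitive := G.perm_transitive i

variable {p : ℕ} [Fact p.Prime]

/-- In affine coordinates, the operations of a graded cycle set are affine maps. -/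
theorem coord_τ (hF : Nat.card F = p) {i : ZMod ℓ} (C : (G.cocycle i).Coordinates p)
    (C' : (G.cocycle (i + 1)).Coordinates p) :
    C'.scale ≠ C.scale ∧ ∃ b c, b ≠ 0 ∧ ∀ x y, C'.coord (G.τ i x y) =
      c + b * (C'.scale / C.scale - 1) * C.coord x + b * C.coord y := by
  have hκ := C.scale_ne_zero
  obtain ⟨o, ho⟩ := C.coord_bijective.2 0
  obtain ⟨e, he⟩ := C.coord_bijective.2 1
  have hoe : e ≠ o := by
    rintro rfl
    exact zero_ne_one (ho.symm.trans he)
  obtain ⟨b, hb⟩ := eq_const_mul_of_surjective_zmod ((G.cocycle i).not_sq_dvd_card hF)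
    C.char_surjective (C'.char.comp (G.shift i o))
  obtain ⟨c, hdiff⟩ : ∃ c, ∀ y, C'.coord (G.τ i o y) = c + b * C.coord y := by
    refine ⟨C'.coord (G.τ i o o), fun y => ?_⟩
    have h := hb (G.diff i y o)
    rw [AddMonoidHom.comp_apply, shift_diff] at h
    have h1 := C'.char_diff (G.τ i o y) (G.τ i o o)
    have h2 := C.char_diff y o
    simp only [cocycle] at h1 h2
    rw [h1, h2, ho] at h
    linear_combination h
  have hform : ∀ x y, C'.coord (G.τ i x y) = c +
      b * (C'.scale / C.scale - 1) * C.coord x + b * C.coord y := by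
    intro x y
    obtain ⟨v, hv, hφ⟩ := C.exists_torsion (C.coord x / C.scale)
    have hperm : ∀ z, C.coord (G.perm i v z) = C.coord z + C.coord x := fun z => by
      refine (C.coord_perm v hv z).trans ?_
      rw [hφ, mul_div_cancel₀ _ hκ]
    have hx : G.perm i v o = x := C.coord_bijective.1 (by rw [hperm, ho, zero_add])
    obtain ⟨z, rfl⟩ := (G.perm i v).surjective y
    have h := congrArg (fun g : Equiv.Perm F => g z) (G.τ_perm_mul_perm i o v)
    simp only [Equiv.Perm.mul_apply, hx] at h
    have h1 := C'.coord_perm (G.shift i o v) (by rw [← map_nsmul, hv, map_zero]) (G.τ i o z)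
    have h2 : C'.char (G.shift i o v) = b * C.char v := hb v
    simp only [cocycle] at h1
    rw [h, h1, h2, hφ, hdiff, hperm]
    field_simp
    ring
  refine ⟨fun h => hoe (G.latin i o (C'.coord_bijective.1 ?_)), b, c, ?_, hform⟩
  · simp only [hform, h, div_self hκ]
    ring
  · rintro rfl
    exact hoe ((G.τ i o).injective (C'.coord_bijective.1 (by simp only [hform]; ring)))

theorem inv_scale_sub (hF : Nat.card F = p) {i : ZMod ℓ} (C : (G.cocycle i).Coordinates p)
    (C' : (G.cocycle (i + 1)).Coordinates p) (C'' : (G.cocycle (i + 1 + 1)).Coordinates p) :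
    C''.scale⁻¹ - C'.scale⁻¹ = C'.scale⁻¹ - C.scale⁻¹ := by
  have hκ := C.scale_ne_zero
  have hκ' := C'.scale_ne_zero
  have hκ'' := C''.scale_ne_zero
  obtain ⟨-, b, c, hb, h⟩ := G.coord_τ hF C C'
  obtain ⟨-, b', c', hb₁, h'⟩ := G.coord_τ hF C' C''
  obtain ⟨x, hx⟩ := C.coord_bijective.2 0
  obtain ⟨y, hy⟩ := C.coord_bijective.2 1
  have hl := congrArg (fun g : Equiv.Perm F => C''.coord (g x)) (G.law i x y)
  simp only [Equiv.Perm.mul_apply, h', h, hx, hy] at hl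
  have hbb : b * b' * (C''.scale⁻¹ - C'.scale⁻¹ - (C'.scale⁻¹ - C.scale⁻¹)) = 0 := by
    field_simp at hl ⊢
    linear_combination -hl
  exact sub_eq_zero.1 ((mul_eq_zero.1 hbb).resolve_left (mul_ne_zero hb hb₁))

/-- There is no graded cycle set of prime cardinality. -/
theorem card_ne_prime (G : GradedCycleSet F ℓ) : Nat.card F ≠ p := by
  intro hF
  let C := fun i => ((G.cocycle i).nonempty_coordinates hF).some
  obtain ⟨u, hu⟩ : ∃ u : ZMod ℓ → ZMod p, ∀ i, u i = (C i).scale⁻¹ := ⟨_, fun _ => rfl⟩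
  have hne : u (0 + 1) - u 0 ≠ 0 := by
    rw [hu, hu]
    exact fun h => (G.coord_τ hF (C 0) (C (0 + 1))).1 (inv_injective (sub_eq_zero.1 h))
  have hd : ∀ n : ℕ, u (n + 1) - u n = u (0 + 1) - u 0 := by
    intro n
    induction n with
    | zero => rw [Nat.cast_zero]
    | succ k ih =>
      rw [← ih, Nat.cast_succ, hu, hu, hu]
      exact G.inv_scale_sub hF (C k) (C (k + 1)) (C (k + 1 + 1))
  have hlin : ∀ n : ℕ, u n = u 0 + n * (u (0 + 1) - u 0) := by
    intro n
    induction n with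
    | zero => simp
    | succ k ih =>
      rw [Nat.cast_succ, Nat.cast_succ]
      linear_combination hd k + ih
  have h0 := hlin (-u 0 / (u (0 + 1) - u 0)).val
  rw [ZMod.natCast_zmod_val, div_mul_cancel₀ _ hne, add_neg_cancel, hu] at h0
  exact inv_ne_zero (C _).scale_ne_zero h0

end GradedCycleSet

section Congruence

variable {X : Type*} {σ : X → Equiv.Perm X} {r : X → X → Prop}

theorem IsCongruence.rel_apply_iff (hr : IsCongruence σ r) (w x y : X) :
    r (σ w x) (σ w y) ↔ r x y := by
  refine ⟨fun h => ?_, hr.2.1 w w x y (hr.1.refl w)⟩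
  simpa using hr.2.2 w w _ _ (hr.1.refl w) h

theorem IsCongruence.card_block_eq (hr : IsCongruence σ r) (hlatin : LatinLQ σ) (x y : X) :
    Nat.card {z // r x z} = Nat.card {z // r y z} := by
  obtain ⟨w, rfl⟩ := (hlatin x).2 y
  exact Nat.card_congr ((σ w).subtypeEquiv fun z => (hr.rel_apply_iff w x z).symm)

/-- The left quasigroup structure on the quotient by a congruence. -/
def quotientLQ (s : Setoid X) (hs : IsCongruence σ s.r) (q : Quotient s) :
    Equiv.Perm (Quotient s) where
  toFun := Quotient.map₂ (fun x y => σ x y) (fun x x' hx y y' hy => hs.2.1 x x' y y' hx hy) q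
  invFun := Quotient.map₂ (fun x y => (σ x).symm y)
    (fun x x' hx y y' hy => hs.2.2 x x' y y' hx hy) q
  left_inv := by
    refine fun a => Quotient.inductionOn₂ q a fun x y => ?_
    simp only [Quotient.map₂_mk, Equiv.symm_apply_apply]
  right_inv := by
    refine fun a => Quotient.inductionOn₂ q a fun x y => ?_
    simp only [Quotient.map₂_mk, Equiv.apply_symm_apply]

theorem quotientLQ_mk (s : Setoid X) (hs : IsCongruence σ s.r) (x y : X) :
    quotientLQ s hs (Quotient.mk s x) (Quotient.mk s y) = Quotient.mk s (σ x y) := rfl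

variable [Finite X]

/-- The blocks of a congruence along an orbit of the squaring map form a graded cycle set. -/
theorem IsCongruence.exists_gradedCycleSet (hr : IsCongruence σ r) (hlaw : CycleSetLaw σ)
    (hnd : Nondeg σ) (hlatin : LatinLQ σ) (x₀ : X) :
    ∃ ℓ, NeZero ℓ ∧ Nonempty (GradedCycleSet {z // r x₀ z} ℓ) := by
  let T : Equiv.Perm X := Equiv.ofBijective _ hnd
  have hℓ : NeZero (orderOf T) := ⟨(orderOf_pos T).ne'⟩
  refine ⟨orderOf T, hℓ, ?_⟩
  let c : ZMod (orderOf T) → X := fun i => (T ^ i.val) x₀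
  have hc : ∀ i, c (i + 1) = σ (c i) (c i) := by
    intro i
    have h : T ^ (i + 1).val = T ^ (i.val + 1) := by
      rw [pow_eq_pow_iff_modEq, ← ZMod.natCast_eq_natCast_iff]
      simp
    change (T ^ (i + 1).val) x₀ = T ((T ^ i.val) x₀)
    rw [h, pow_succ', Equiv.Perm.mul_apply]
  let e : ∀ i, {z // r x₀ z} ≃ {z // r (c i) z} := fun i =>
    (Finite.card_eq.1 (hr.card_block_eq hlatin x₀ (c i))).some
  have hmem : ∀ i (x y : {z // r (c i) z}), r (c (i + 1)) (σ x y) := fun i x y => by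
    rw [hc]
    exact hr.2.1 _ _ _ _ x.2 y.2
  let τ : ZMod (orderOf T) → {z // r x₀ z} → {z // r x₀ z} → {z // r x₀ z} := fun i x y =>
    (e (i + 1)).symm ⟨σ (e i x) (e i y), hmem i _ _⟩
  have hτ : ∀ i x y, (e (i + 1) (τ i x y)).1 = σ (e i x) (e i y) := fun i x y => by simp [τ]
  have hext : ∀ i x y, (e i x).1 = (e i y).1 → x = y := fun i x y h =>
    (e i).injective (Subtype.ext h)
  have hinj : ∀ i x, Function.Injective (τ i x) := fun i x y z h => by
    have h' := congrArg (fun t => (e (i + 1) t).1) h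
    simp only [hτ] at h'
    exact hext i y z ((σ (e i x)).injective h')
  refine ⟨⟨fun i x => Equiv.ofBijective (τ i x) (Finite.injective_iff_bijective.1 (hinj i x)),
    fun i x y => ?_, fun i x y h => ?_, fun i y x z h => ?_⟩⟩
  · ext1 z
    apply hext (i + 1 + 1)
    simp only [Equiv.Perm.mul_apply, Equiv.ofBijective_apply, hτ]
    exact hlaw _ _ _
  · have h' := congrArg (fun t => (e (i + 1) t).1) h
    simp only [Equiv.ofBijective_apply, hτ] at h'
    exact hext i x y (hnd.1 h')
  · have h' := congrArg (fun t => (e (i + 1) t).1) h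
    simp only [Equiv.ofBijective_apply, hτ] at h'
    exact hext i x z ((hlatin _).1 h')

theorem IsCongruence.card_block_ne_prime (hr : IsCongruence σ r) (hlaw : CycleSetLaw σ)
    (hnd : Nondeg σ) (hlatin : LatinLQ σ) (x : X) {p : ℕ} (hp : p.Prime) :
    Nat.card {z // r x z} ≠ p := by
  have : Fact p.Prime := ⟨hp⟩
  obtain ⟨ℓ, hℓ, ⟨G⟩⟩ := hr.exists_gradedCycleSet hlaw hnd hlatin x
  exact G.card_ne_prime

theorem card_ne_prime_of_latin (hlaw : CycleSetLaw σ) (hnd : Nondeg σ) (hlatin : LatinLQ σ)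
    {p : ℕ} (hp : p.Prime) : Nat.card X ≠ p := by
  intro h
  obtain ⟨x⟩ : Nonempty X := (Nat.card_pos_iff.1 (h ▸ hp.pos)).1
  have hr : IsCongruence σ fun _ _ => True :=
    ⟨⟨fun _ => trivial, fun _ => trivial, fun _ _ => trivial⟩,
      fun _ _ _ _ _ _ => trivial, fun _ _ _ _ _ _ => trivial⟩
  refine hr.card_block_ne_prime hlaw hnd hlatin x hp ?_
  rw [← h]
  exact Nat.card_congr (Equiv.subtypeUnivEquiv fun _ => trivial)

theorem card_quotient_ne_prime (s : Setoid X) (hs : IsCongruence σ s.r) (hlaw : CycleSetLaw σ)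
    (hnd : Nondeg σ) (hlatin : LatinLQ σ) {p : ℕ} (hp : p.Prime) :
    Nat.card (Quotient s) ≠ p := by
  refine card_ne_prime_of_latin (σ := quotientLQ s hs) ?_ ?_ ?_ hp
  · intro a b c
    induction a using Quotient.inductionOn with | _ x
    induction b using Quotient.inductionOn with | _ y
    induction c using Quotient.inductionOn with | _ z
    simp only [quotientLQ_mk, hlaw x y z]
  · refine Function.Surjective.bijective_of_finite fun a => ?_
    induction a using Quotient.inductionOn with | _ x
    obtain ⟨y, hy⟩ := hnd.2 x
    exact ⟨Quotient.mk s y, congrArg _ hy⟩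
  · refine fun b => Function.Surjective.bijective_of_finite fun a => ?_
    induction a using Quotient.inductionOn with | _ x
    induction b using Quotient.inductionOn with | _ y
    obtain ⟨z, hz⟩ := (hlatin y).2 x
    exact ⟨Quotient.mk s z, congrArg _ hz⟩

theorem card_quotient_mul_card_block (s : Setoid X) (k : ℕ)
    (hk : ∀ x, Nat.card {z // s.r x z} = k) : Nat.card (Quotient s) * k = Nat.card X := by
  have := Fintype.ofFinite (Quotient s)
  rw [← Nat.card_congr (Equiv.sigmaFiberEquiv (Quotient.mk s)), Nat.card_sigma,
    Nat.card_eq_fintype_card]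
  rw [Finset.sum_congr rfl (g := fun _ => k), Finset.sum_const, Finset.card_univ, smul_eq_mul]
  intro q _
  induction q using Quotient.inductionOn with | _ x
  rw [← hk x]
  exact Nat.card_congr (Equiv.subtypeEquivRight fun z =>
    Quotient.eq.trans ⟨s.symm, s.symm⟩)

end Congruence

/-- every finite latin non-degenerate cycle set of cardinality `p³`,
`p` a prime, is simple. -/
theorem stmt_12 {X : Type*} [Finite X] (p : ℕ) (hp : p.Prime) (σ : X → Equiv.Perm X)
    (hlaw : CycleSetLaw σ) (hnd : Nondeg σ) (hlatin : LatinLQ σ)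
    (hcard : Nat.card X = p ^ 3) :
    SimpleLQ σ := by
  refine ⟨fun x y => ?_, fun r hr => ?_⟩
  · obtain ⟨w, hw⟩ := (hlatin x).2 y
    exact ⟨σ w, Subgroup.subset_closure ⟨w, rfl⟩, hw⟩
  obtain ⟨x₀⟩ : Nonempty X := (Nat.card_pos_iff.1 (hcard ▸ pow_pos hp.pos 3)).1
  let s : Setoid X := ⟨r, hr.1⟩
  have hmul := card_quotient_mul_card_block s (Nat.card {z // r x₀ z})
    fun x => hr.card_block_eq hlatin x x₀
  rw [hcard] at hmul
  obtain ⟨j, hj, hk⟩ := (Nat.dvd_prime_pow hp).1 (Dvd.intro_left _ hmul)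
  rw [hk] at hmul
  interval_cases j
  · refine Or.inl fun a b => ⟨fun hab => ?_, fun hab => hab ▸ hr.1.refl a⟩
    have h1 : Nat.card {z // r a z} = 1 := by rw [hr.card_block_eq hlatin a x₀, hk, pow_zero]
    have := (Nat.card_eq_one_iff_unique.1 h1).1
    exact congrArg Subtype.val (Subsingleton.elim (⟨a, hr.1.refl a⟩ : {z // r a z}) ⟨b, hab⟩)
  · exact (hr.card_block_ne_prime hlaw hnd hlatin x₀ hp (hk.trans (pow_one p))).elim
  · refine (card_quotient_ne_prime s hr hlaw hnd hlatin hp ?_).elim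
    exact Nat.eq_of_mul_eq_mul_right (pow_pos hp.pos 2) (hmul.trans (pow_succ' p 2))
  · have h1 : Nat.card (Quotient s) = 1 :=
      Nat.eq_of_mul_eq_mul_right (pow_pos hp.pos 3) (hmul.trans (one_mul _).symm)
    have := (Nat.card_eq_one_iff_unique.1 h1).1
    exact Or.inr fun a b => Quotient.exact (Subsingleton.elim (Quotient.mk s a) (Quotient.mk s b))
end

section
/- Let p be a prime, (G,∘) a finite group of order p^k (k ≥ 1), φ a bijection of G and ψ an automorphism of (G,∘) such that φ(φ(y)∘ψ(x)) ∘ ψ(φ(y)) = φ(φ(x)∘ψ(y)) ∘ ψ(φ(x)) for all x,y ∈ G. Suppose that every normal subgroup H of G with 1 < H < G satisfying ψ(H) = H fails to be invariant under φ (i.e. there exist x,y with x⁻¹∘y ∈ H but φ(x)⁻¹∘φ(y) ∉ H). Then the pair (X,•) with X = G and x • y = φ(x) ∘ ψ(y) is a non-degenerate cycle set that is simple and non-trivial, and its displacement group Dis(X) is isomorphic to G (acting regularly on X). -/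
/-- The left translations of the right linear left quasigroup `x·y = φ(x) ∘ ψ(y)`
over a group `(G,∘)`. -/
def rlSigma {G : Type*} [Group G] (φ : G ≃ G) (ψ : G ≃* G) (x : G) : Equiv.Perm G :=
  ψ.toEquiv.trans (Equiv.mulLeft (φ x))

section CycleSet

variable {X : Type*}

/-- The permutation attached to a word in a left quasigroup: the word `x₁ … xₙ` acts as
`σ x₁` followed by the permutation attached to `x₁·x₂ … x₁·xₙ`. -/
def wordPerm (σ : X → Equiv.Perm X) : List X → Equiv.Perm X
  | [] => 1
  | x :: l => wordPerm σ (l.map (σ x)) * σ x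
  termination_by l => l.length

theorem wordPerm_nil (σ : X → Equiv.Perm X) : wordPerm σ [] = 1 := by
  rw [wordPerm]

theorem wordPerm_cons (σ : X → Equiv.Perm X) (x : X) (l : List X) :
    wordPerm σ (x :: l) = wordPerm σ (l.map (σ x)) * σ x := by
  rw [wordPerm]

theorem wordPerm_concat (σ : X → Equiv.Perm X) (y : X) (l : List X) :
    wordPerm σ (l ++ [y]) = σ (wordPerm σ l y) * wordPerm σ l := by
  induction hn : l.length generalizing l y with
  | zero =>
    obtain rfl := List.length_eq_zero_iff.mp hn
    simp [wordPerm_cons, wordPerm_nil]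
  | succ n ih =>
    cases l with
    | nil => simp at hn
    | cons x l =>
      have hl : (l.map (σ x)).length = n := by simpa using hn
      have := ih (σ x y) (l.map (σ x)) hl
      simp only [List.cons_append, wordPerm_cons, List.map_append, List.map_cons, List.map_nil,
        this, Equiv.Perm.mul_apply, mul_assoc]

/-- In a cycle set the permutation attached to a word does not depend on the order of letters. -/
theorem wordPerm_map_perm {σ : X → Equiv.Perm X} (hσ : CycleSetLaw σ) {l₁ l₂ : List X}
    (h : l₁.Perm l₂) (g : Equiv.Perm X) :
    wordPerm σ (l₁.map g) = wordPerm σ (l₂.map g) := by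
  induction h generalizing g with
  | nil => rfl
  | cons x _ ih =>
    have := ih (σ (g x) * g)
    simp only [Equiv.Perm.coe_mul] at this
    simp only [List.map_cons, wordPerm_cons, List.map_map, this]
  | swap x y l =>
    have key : σ (σ (g y) (g x)) * σ (g y) = σ (σ (g x) (g y)) * σ (g x) :=
      Equiv.ext fun z => hσ (g y) (g x) z
    have key' : (σ (σ (g y) (g x)) ∘ σ (g y)) = (σ (σ (g x) (g y)) ∘ σ (g x)) :=
      funext fun z => hσ (g y) (g x) z
    simp only [List.map_cons, wordPerm_cons, List.map_map, mul_assoc, key]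
    simp only [← Function.comp_assoc, key']
  | trans _ _ ih₁ ih₂ => exact (ih₁ g).trans (ih₂ g)

theorem exists_wordPerm_eq_pow (σ : X → Equiv.Perm X) (x : X) (n : ℕ) :
    ∃ l, wordPerm σ l = σ x ^ n := by
  induction n with
  | zero => exact ⟨[], by rw [wordPerm_nil, pow_zero]⟩
  | succ n ih =>
    obtain ⟨l, hl⟩ := ih
    refine ⟨x :: l.map (σ x).symm, ?_⟩
    rw [wordPerm_cons, List.map_map, Equiv.self_comp_symm, List.map_id, hl, pow_succ]

/-- A finite cycle set is non-degenerate. -/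
theorem CycleSetLaw.nondeg [Finite X] {σ : X → Equiv.Perm X} (hσ : CycleSetLaw σ) :
    Nondeg σ := by
  refine Finite.surjective_iff_bijective.mp fun x => ?_
  obtain ⟨c, hc⟩ := exists_wordPerm_eq_pow σ x (orderOf (σ x) - 1)
  set b := c.map (σ x).symm with hb
  have hxb : wordPerm σ (x :: b) = 1 := by
    rw [wordPerm_cons, hb, List.map_map, Equiv.self_comp_symm, List.map_id, hc, ← pow_succ,
      Nat.sub_add_cancel (orderOf_pos (σ x)), pow_orderOf_eq_one]
  have hperm : wordPerm σ (b ++ [x]) = wordPerm σ (x :: b) := by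
    simpa using wordPerm_map_perm hσ (List.perm_append_singleton x b) 1
  rw [wordPerm_concat, hxb] at hperm
  exact ⟨wordPerm σ b x, by simpa using DFunLike.congr_fun hperm x⟩

end CycleSet

section RightLinear

variable {G : Type*} [Group G] (φ : G ≃ G) (ψ : G ≃* G)

theorem rlSigma_apply (x y : G) : rlSigma φ ψ x y = φ x * ψ y := rfl

theorem rlSigma_symm_apply (x y : G) : (rlSigma φ ψ x).symm y = ψ.symm ((φ x)⁻¹ * y) := rfl

theorem rlSigma_mul_inv (x y : G) :
    rlSigma φ ψ x * (rlSigma φ ψ y)⁻¹ = MulAction.toPermHom G G (φ x * (φ y)⁻¹) := by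
  ext z
  change φ x * ψ (ψ.symm ((φ y)⁻¹ * z)) = φ x * (φ y)⁻¹ * z
  simp [mul_assoc]

theorem toPermHom_mem_permGroup (g : G) :
    MulAction.toPermHom G G g ∈ permGroup (rlSigma φ ψ) := by
  have h := rlSigma_mul_inv φ ψ (φ.symm g) (φ.symm 1)
  rw [Equiv.apply_symm_apply, Equiv.apply_symm_apply, inv_one, mul_one] at h
  rw [← h]
  exact mul_mem (Subgroup.subset_closure ⟨_, rfl⟩) (inv_mem (Subgroup.subset_closure ⟨_, rfl⟩))

theorem permGroup_le_normalizer :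
    permGroup (rlSigma φ ψ) ≤ Subgroup.normalizer (MulAction.toPermHom G G).range := by
  refine (Subgroup.closure_le _).mpr ?_
  rintro _ ⟨x, rfl⟩
  refine Subgroup.mem_normalizer_iff.mpr fun h => ⟨?_, ?_⟩
  · rintro ⟨g, rfl⟩
    refine ⟨φ x * ψ g * (φ x)⁻¹, Equiv.ext fun z => ?_⟩
    change φ x * ψ g * (φ x)⁻¹ * z = φ x * ψ (g * ψ.symm ((φ x)⁻¹ * z))
    simp [mul_assoc]
  · rintro ⟨g, hg⟩
    refine ⟨ψ.symm ((φ x)⁻¹ * g * φ x), ?_⟩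
    have hh : h = (rlSigma φ ψ x)⁻¹ * MulAction.toPermHom G G g * rlSigma φ ψ x := by
      rw [hg]; group
    rw [hh]
    ext z
    change ψ.symm ((φ x)⁻¹ * g * φ x) * z = ψ.symm ((φ x)⁻¹ * (g * (φ x * ψ z)))
    simp [mul_assoc]

/-- The displacement group of a right linear left quasigroup consists of the left
multiplications of the underlying group. -/
theorem dis_rlSigma :
    dis (rlSigma φ ψ) = (MulAction.toPermHom G G).range.subgroupOf (permGroup (rlSigma φ ψ)) := by
  apply le_antisymm
  · have := Subgroup.normal_subgroupOf_of_le_normalizer (permGroup_le_normalizer φ ψ)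
    refine Subgroup.normalClosure_le_normal ?_
    rintro g ⟨x, y, hg⟩
    exact ⟨φ x * (φ y)⁻¹, (rlSigma_mul_inv φ ψ x y).symm.trans hg.symm⟩
  · rintro g ⟨a, ha⟩
    refine Subgroup.subset_normalClosure ⟨φ.symm a, φ.symm 1, ?_⟩
    rw [rlSigma_mul_inv, Equiv.apply_symm_apply, Equiv.apply_symm_apply, inv_one, mul_one]
    exact ha.symm

/-- The left regular representation, as an isomorphism onto the displacement group. -/
noncomputable def disEquiv : G ≃* dis (rlSigma φ ψ) :=
  MulEquiv.ofBijective
    (((MulAction.toPermHom G G).codRestrict _ (toPermHom_mem_permGroup φ ψ)).codRestrict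
      (dis (rlSigma φ ψ)) fun g => by
        rw [dis_rlSigma]
        exact ⟨g, rfl⟩)
    ⟨fun a b hab => by
      have h : MulAction.toPermHom G G a = MulAction.toPermHom G G b :=
        congrArg Subtype.val (congrArg Subtype.val hab)
      simpa using DFunLike.congr_fun h (1 : G),
    fun g => by
      obtain ⟨a, ha⟩ := (dis_rlSigma φ ψ).le g.2
      exact ⟨a, Subtype.ext (Subtype.ext ha)⟩⟩

theorem disEquiv_apply (g x : G) :
    ((disEquiv φ ψ g : permGroup (rlSigma φ ψ)) : Equiv.Perm G) x = g * x := rfl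

variable {φ ψ} {r : G → G → Prop}

theorem IsCongruence.map_iff (hr : IsCongruence (rlSigma φ ψ) r) (c a b : G) :
    r (c * ψ a) (c * ψ b) ↔ r a b := by
  obtain ⟨he, hmul, hsymm⟩ := hr
  refine ⟨fun h => ?_, fun h => ?_⟩
  · simpa [rlSigma_symm_apply] using hsymm (φ.symm c) (φ.symm c) _ _ (he.refl _) h
  · simpa [rlSigma_apply] using hmul (φ.symm c) (φ.symm c) _ _ (he.refl _) h

theorem IsCongruence.mul_left_iff (hr : IsCongruence (rlSigma φ ψ) r) (c a b : G) :
    r (c * a) (c * b) ↔ r a b := by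
  have h₁ := hr.map_iff c (ψ.symm a) (ψ.symm b)
  have h₂ := hr.map_iff 1 (ψ.symm a) (ψ.symm b)
  simp only [MulEquiv.apply_symm_apply, one_mul] at h₁ h₂
  exact h₁.trans h₂.symm

/-- The class of the identity under a congruence of a right linear left quasigroup. -/
def IsCongruence.kernel (hr : IsCongruence (rlSigma φ ψ) r) : Subgroup G where
  carrier := {g | r 1 g}
  one_mem' := hr.1.refl 1
  mul_mem' {a b} ha hb := hr.1.trans ha (by simpa using (hr.mul_left_iff a 1 b).mpr hb)
  inv_mem' {a} ha := hr.1.symm (by simpa using (hr.mul_left_iff a⁻¹ 1 a).mpr ha)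

theorem IsCongruence.mem_kernel (hr : IsCongruence (rlSigma φ ψ) r) {g : G} :
    g ∈ hr.kernel ↔ r 1 g := Iff.rfl

theorem IsCongruence.inv_mul_mem_kernel (hr : IsCongruence (rlSigma φ ψ) r) {a b : G} :
    a⁻¹ * b ∈ hr.kernel ↔ r a b := by
  rw [hr.mem_kernel, ← hr.mul_left_iff a]
  simp

theorem IsCongruence.conj_mem_kernel (hr : IsCongruence (rlSigma φ ψ) r) {a b : G}
    (hab : r a b) (c : G) : c⁻¹ * ((φ a)⁻¹ * φ b) * c ∈ hr.kernel := by
  have h := hr.2.1 a b (ψ.symm c) (ψ.symm c) hab (hr.1.refl _)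
  simp only [rlSigma_apply, MulEquiv.apply_symm_apply, ← hr.inv_mul_mem_kernel] at h
  simpa [mul_assoc] using h

theorem IsCongruence.kernel_normal [Finite G] (hr : IsCongruence (rlSigma φ ψ) r) :
    hr.kernel.Normal := by
  let f : hr.kernel → hr.kernel := fun h =>
    ⟨(φ 1)⁻¹ * φ h, by simpa using hr.conj_mem_kernel (hr.mem_kernel.mp h.2) 1⟩
  have hf : Function.Injective f := fun a b hab =>
    Subtype.ext (φ.injective (mul_left_cancel (congrArg Subtype.val hab)))
  refine ⟨fun n hn c => ?_⟩
  obtain ⟨m, hm⟩ := Finite.surjective_of_injective hf ⟨n, hn⟩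
  have hm' : (φ 1)⁻¹ * φ m = n := congrArg Subtype.val hm
  have h := hr.conj_mem_kernel (hr.mem_kernel.mp m.2) c⁻¹
  rwa [hm', inv_inv] at h

theorem simpleLQ_rlSigma [Finite G]
    (hH : ∀ H : Subgroup G, H.Normal → H ≠ ⊥ → H ≠ ⊤ → (∀ g : G, g ∈ H ↔ ψ g ∈ H) →
      ∃ x y : G, x⁻¹ * y ∈ H ∧ (φ x)⁻¹ * φ y ∉ H) :
    SimpleLQ (rlSigma φ ψ) := by
  refine ⟨fun x y => ⟨_, toPermHom_mem_permGroup φ ψ (y * x⁻¹), by simp⟩, fun r hr => ?_⟩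
  by_cases hbot : hr.kernel = ⊥
  · left
    intro a b
    rw [← hr.inv_mul_mem_kernel, hbot, Subgroup.mem_bot, inv_mul_eq_one]
  by_cases htop : hr.kernel = ⊤
  · right
    intro a b
    rw [← hr.inv_mul_mem_kernel, htop]
    exact Subgroup.mem_top _
  obtain ⟨x, y, hxy, hφ⟩ := hH _ hr.kernel_normal hbot htop fun g => by
    simpa [hr.mem_kernel] using (hr.map_iff 1 1 g).symm
  exact (hφ (by simpa using hr.conj_mem_kernel (hr.inv_mul_mem_kernel.mp hxy) 1)).elim

end RightLinear

/-- let `p` be a prime, `G` a group of order `p^k` (`k ≥ 1`), `φ` a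
bijection of `G` and `ψ` an automorphism satisfying the right linear cycle set
condition, and suppose every proper nontrivial normal subgroup invariant under `ψ`
fails to be invariant under `φ`.  Then `x • y = φ(x) ∘ ψ(y)` makes `G` a
non-degenerate cycle set which is simple and non-trivial, whose displacement group is
isomorphic to `G` and acts regularly (simply transitively) on `X = G`. -/
theorem stmt_13 {G : Type*} [Group G] [Finite G] (p k : ℕ) (hp : p.Prime) (hk : 1 ≤ k)
    (hG : Nat.card G = p ^ k) (φ : G ≃ G) (ψ : G ≃* G)
    (hlaw : ∀ x y : G, φ (φ y * ψ x) * ψ (φ y) = φ (φ x * ψ y) * ψ (φ x))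
    (hH : ∀ H : Subgroup G, H.Normal → H ≠ ⊥ → H ≠ ⊤ → (∀ g : G, g ∈ H ↔ ψ g ∈ H) →
      ∃ x y : G, x⁻¹ * y ∈ H ∧ (φ x)⁻¹ * φ y ∉ H) :
    CycleSetLaw (rlSigma φ ψ) ∧ Nondeg (rlSigma φ ψ) ∧ SimpleLQ (rlSigma φ ψ) ∧
    (∃ x y : G, rlSigma φ ψ x ≠ rlSigma φ ψ y) ∧
    Nonempty (↥(dis (rlSigma φ ψ)) ≃* G) ∧
    (∀ x y : G, ∃! g : ↥(dis (rlSigma φ ψ)),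
      ((g : ↥(permGroup (rlSigma φ ψ))) : Equiv.Perm G) x = y) := by
  have hcs : CycleSetLaw (rlSigma φ ψ) := fun x y z => by
    simp only [rlSigma_apply, map_mul, ← mul_assoc, hlaw y x]
  refine ⟨hcs, hcs.nondeg, simpleLQ_rlSigma hH, ?_, ⟨(disEquiv φ ψ).symm⟩, fun x y => ?_⟩
  · have : Nontrivial G := Finite.one_lt_card_iff_nontrivial.mp
      (hG ▸ Nat.one_lt_pow (by lia) hp.one_lt)
    obtain ⟨x, y, hxy⟩ := exists_pair_ne G
    refine ⟨x, y, fun h => hxy (φ.injective ?_)⟩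
    simpa [rlSigma_apply] using DFunLike.congr_fun h (1 : G)
  · refine ⟨disEquiv φ ψ (y * x⁻¹), inv_mul_cancel_right y x, fun g hg => ?_⟩
    obtain ⟨a, rfl⟩ := (disEquiv φ ψ).surjective g
    simp only [disEquiv_apply] at hg
    rw [← hg, mul_inv_cancel_right]
end

section
/- Let X be a finite simple non-degenerate cycle set whose permutation group G(X) is a p-group for a prime p, and let α be an automorphism of (X,·) whose order is coprime to p and which fixes some element x ∈ X. Then the deformation X_α, i.e. the set X with operation x ·_α y = α(x·y), is a simple cycle set. -/
/-- A subgroup containing the product of two commuting elements of coprime orders contains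
the left factor. -/
theorem Commute.left_mem_of_mul_mem_of_coprime {G : Type*} [Group G] {H : Subgroup G} {a b : G}
    (hab : Commute a b) (hco : (orderOf b).Coprime (orderOf a)) (h : a * b ∈ H) : a ∈ H := by
  obtain ⟨m, hm⟩ := exists_pow_eq_self_of_coprime hco
  have hpow : (a * b) ^ orderOf b = a ^ orderOf b := by
    rw [hab.mul_pow, pow_orderOf_eq_one, mul_one]
  rw [← hm, ← hpow]
  exact pow_mem (pow_mem h _) _

/-- The subgroup of permutations `g` with `r a b ↔ r (g a) (g b)`. -/
def relPreserving {X : Type*} (r : X → X → Prop) : Subgroup (Equiv.Perm X) where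
  carrier := {g | ∀ a b, r (g a) (g b) ↔ r a b}
  mul_mem' {g h} hg hh a b := (hg (h a) (h b)).trans (hh a b)
  one_mem' _ _ := Iff.rfl
  inv_mem' {g} hg a b := by simpa using (hg (g⁻¹ a) (g⁻¹ b)).symm

theorem CycleSetLaw.deformation {X : Type*} {σ : X → Equiv.Perm X} (hlaw : CycleSetLaw σ)
    {α : Equiv.Perm X} (hα : ∀ x y : X, α (σ x y) = σ (α x) (α y)) :
    CycleSetLaw (fun x => (σ x).trans α) := by
  intro x y z
  simp only [Equiv.trans_apply]
  rw [← hα, ← hα, hlaw]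

theorem Nondeg.deformation {X : Type*} {σ : X → Equiv.Perm X} (hnd : Nondeg σ)
    (α : Equiv.Perm X) : Nondeg (fun x => (σ x).trans α) :=
  α.bijective.comp hnd

/-- If a deforming automorphism `α` itself lies in the permutation group of the deformation,
then that group contains the original permutation group. -/
theorem permGroup_le_permGroup_deformation {X : Type*} {σ : X → Equiv.Perm X}
    {α : Equiv.Perm X} (hmem : α ∈ permGroup (fun x => (σ x).trans α)) :
    permGroup σ ≤ permGroup (fun x => (σ x).trans α) := by
  refine (Subgroup.closure_le _).2 ?_
  rintro _ ⟨x, rfl⟩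
  have hx : α * σ x ∈ permGroup (fun x => (σ x).trans α) :=
    Subgroup.subset_closure ⟨x, rfl⟩
  exact (Subgroup.mul_mem_cancel_left _ hmem).1 hx

/-- A congruence of the deformation by `α` which is preserved by `α` is a congruence. -/
theorem IsCongruence.of_deformation {X : Type*} {σ : X → Equiv.Perm X} {α : Equiv.Perm X}
    {r : X → X → Prop} (hr : IsCongruence (fun x => (σ x).trans α) r)
    (hαr : α ∈ relPreserving r) : IsCongruence σ r := by
  refine ⟨hr.1, fun x x' y y' hx hy => (hαr _ _).1 (hr.2.1 x x' y y' hx hy),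
    fun x x' y y' hx hy => ?_⟩
  simpa using hr.2.2 x x' (α y) (α y') hx ((hαr _ _).2 hy)

/-- let `X` be a finite simple non-degenerate cycle set whose
permutation group is a `p`-group, and let `α` be an automorphism of `(X,·)` of order
coprime to `p` fixing some element.  Then the deformation `X_α`, with operation
`x ·_α y = α(x·y)` (i.e. left translations `α ∘ σ_x`), is a simple cycle set. -/
theorem stmt_14 {X : Type*} [Finite X] (p : ℕ) (hp : p.Prime) (σ : X → Equiv.Perm X)
    (hlaw : CycleSetLaw σ) (hnd : Nondeg σ) (hs : SimpleLQ σ)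
    (hpg : IsPGroup p ↥(permGroup σ))
    (α : Equiv.Perm X) (hα : ∀ x y : X, α (σ x y) = σ (α x) (α y))
    (hord : Nat.Coprime (orderOf α) p) (hfix : ∃ x : X, α x = x) :
    CycleSetLaw (fun x => (σ x).trans α) ∧ Nondeg (fun x => (σ x).trans α) ∧
    SimpleLQ (fun x => (σ x).trans α) := by
  obtain ⟨x₀, hx₀⟩ := hfix
  have hcomm : Commute α (σ x₀) := by
    ext y
    simp [hα, hx₀]
  have hco : (orderOf (σ x₀)).Coprime (orderOf α) := by
    obtain ⟨k, hk⟩ := hpg (sigmaG σ x₀)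
    have hdvd : orderOf (σ x₀) ∣ p ^ k :=
      orderOf_dvd_of_pow_eq_one (congrArg Subtype.val hk)
    exact Nat.Coprime.coprime_dvd_left hdvd (hord.symm.pow_left k)
  refine ⟨hlaw.deformation hα, hnd.deformation α, fun x y => ?_, fun r hr => ?_⟩
  · obtain ⟨g, hg, hgx⟩ := hs.1 x y
    have hmem : α ∈ permGroup (fun x => (σ x).trans α) :=
      hcomm.left_mem_of_mul_mem_of_coprime hco (Subgroup.subset_closure ⟨x₀, rfl⟩)
    exact ⟨g, permGroup_le_permGroup_deformation hmem hg, hgx⟩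
  · refine hs.2 r (hr.of_deformation (hcomm.left_mem_of_mul_mem_of_coprime hco fun a b => ?_))
    refine ⟨fun h => ?_, hr.2.1 x₀ x₀ a b (hr.1.refl x₀)⟩
    simpa using hr.2.2 x₀ x₀ _ _ (hr.1.refl x₀) h
end

section
/- Let X be a finite simple latin affine non-degenerate cycle set with |X| > 1. Then the displacement group Dis(X) is an elementary abelian p-group of order p^k for some prime p and natural number k with p dividing k. -/
section AffineLeftQuasigroup

variable {X : Type*} [AddCommGroup X] {σ : X → Equiv.Perm X} {φ ψ : X ≃+ X} {c : X}

/-- Every element of the permutation group of an affine left quasigroup is an affine map. -/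
theorem exists_addEquiv_of_mem_permGroup (hform : ∀ x y : X, σ x y = φ x + ψ y + c)
    {g : Equiv.Perm X} (hg : g ∈ permGroup σ) :
    ∃ h : X ≃+ X, ∀ z a : X, g (z + a) = g z + h a := by
  induction hg using Subgroup.closure_induction with
  | mem g hg =>
    obtain ⟨x, rfl⟩ := hg
    refine ⟨ψ, fun z a => ?_⟩
    rw [hform, hform, map_add]
    abel
  | one => exact ⟨AddEquiv.refl X, fun _ _ => rfl⟩
  | mul f g _ _ hf hg =>
    obtain ⟨h, hh⟩ := hf
    obtain ⟨k, hk⟩ := hg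
    exact ⟨k.trans h, fun z a => by simp [hk, hh]⟩
  | inv g _ hg =>
    obtain ⟨h, hh⟩ := hg
    refine ⟨h.symm, fun z a => ?_⟩
    rw [Equiv.Perm.inv_eq_iff_eq, hh]
    simp

/-- Elements of the displacement group of an affine left quasigroup are translations. -/
theorem exists_translation_of_mem_dis (hform : ∀ x y : X, σ x y = φ x + ψ y + c)
    {g : permGroup σ} (hg : g ∈ dis σ) :
    ∃ a : X, ∀ z : X, (g : Equiv.Perm X) z = z + a := by
  induction hg using Subgroup.closure_induction with
  | mem g hg =>
    obtain ⟨g₀, ⟨x, y, hg₀⟩, hconj⟩ := Group.mem_conjugatesOfSet_iff.1 hg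
    obtain ⟨u, rfl⟩ := isConj_iff.1 hconj
    have ht : ∀ z, (g₀ : Equiv.Perm X) z = z + (φ x - φ y) := fun z => by
      obtain ⟨w, rfl⟩ := (σ y).surjective z
      rw [hg₀, Equiv.Perm.mul_apply, Equiv.Perm.inv_def, Equiv.symm_apply_apply, hform, hform]
      abel
    obtain ⟨h, hh⟩ := exists_addEquiv_of_mem_permGroup hform u.2
    exact ⟨h (φ x - φ y), fun z => by simp [ht, hh]⟩
  | one => exact ⟨0, fun z => by simp⟩
  | mul f g _ _ hf hg =>
    obtain ⟨a, ha⟩ := hf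
    obtain ⟨b, hb⟩ := hg
    exact ⟨b + a, fun z => by simp [ha, hb, add_assoc]⟩
  | inv g _ hg =>
    obtain ⟨a, ha⟩ := hg
    refine ⟨-a, fun z => ?_⟩
    rw [Subgroup.coe_inv, Equiv.Perm.inv_eq_iff_eq, ha]
    abel

/-- Every translation belongs to the displacement group of an affine left quasigroup. -/
theorem exists_mem_dis_translation (hform : ∀ x y : X, σ x y = φ x + ψ y + c) (a : X) :
    ∃ g ∈ dis σ, ∀ z : X, (g : Equiv.Perm X) z = z + a := by
  refine ⟨sigmaG σ (φ.symm a) * (sigmaG σ 0)⁻¹,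
    Subgroup.subset_normalClosure ⟨φ.symm a, 0, rfl⟩, fun z => ?_⟩
  obtain ⟨w, rfl⟩ := (σ 0).surjective z
  simp only [sigmaG, Subgroup.coe_mul, Subgroup.coe_inv, Equiv.Perm.mul_apply,
    Equiv.Perm.inv_def, Equiv.symm_apply_apply]
  rw [hform, hform, map_zero, AddEquiv.apply_symm_apply]
  abel

theorem card_dis_of_affine (hform : ∀ x y : X, σ x y = φ x + ψ y + c) :
    Nat.card (dis σ) = Nat.card X := by
  refine Nat.card_eq_of_bijective (fun g : dis σ => ((g : permGroup σ) : Equiv.Perm X) 0) ⟨?_, ?_⟩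
  · intro f g hfg
    obtain ⟨a, ha⟩ := exists_translation_of_mem_dis hform f.2
    obtain ⟨b, hb⟩ := exists_translation_of_mem_dis hform g.2
    have hab : a = b := by simpa [ha, hb] using hfg
    ext z
    rw [ha, hb, hab]
  · intro a
    obtain ⟨g, hg, ha⟩ := exists_mem_dis_translation hform a
    exact ⟨⟨g, hg⟩, by simp [ha]⟩

/-- The cycle set law for an affine operation is a Weyl algebra relation between `ψ` and `φ⁻¹`. -/
theorem CycleSetLaw.commutator_of_affine (hlaw : CycleSetLaw σ)
    (hform : ∀ x y : X, σ x y = φ x + ψ y + c) (x : X) :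
    ψ (φ.symm x) - φ.symm (ψ x) = x := by
  have key : ∀ y, φ (ψ (φ.symm y)) = φ y + ψ y := fun y => by
    have h := hlaw (φ.symm y) 0 0
    simp only [hform, map_add, map_zero, AddEquiv.apply_symm_apply] at h
    rw [← sub_eq_zero] at h ⊢
    rw [← neg_eq_zero, ← h]
    abel
  apply φ.injective
  rw [map_sub, key, AddEquiv.apply_symm_apply]
  abel

/-- A finite simple affine left quasigroup with more than one element has prime exponent. -/
theorem SimpleLQ.exists_prime_nsmul_eq_zero [Finite X] (hs : SimpleLQ σ)
    (hcard : 1 < Nat.card X) (hform : ∀ x y : X, σ x y = φ x + ψ y + c) :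
    ∃ p : ℕ, p.Prime ∧ ∀ x : X, p • x = 0 := by
  obtain ⟨p, hp, hdvd⟩ := Nat.exists_prime_and_dvd hcard.ne'
  have : Fact p.Prime := ⟨hp⟩
  refine ⟨p, hp, ?_⟩
  have hσ : ∀ x y : X, p • σ x y = φ (p • x) + ψ (p • y) + p • c := fun x y => by
    simp [hform]
  have hcong : IsCongruence σ fun a b => p • a = p • b := by
    refine ⟨⟨fun _ => rfl, Eq.symm, Eq.trans⟩, fun x x' y y' hx hy => ?_,
      fun x x' y y' hx hy => ?_⟩
    · change p • _ = p • _
      rw [hσ, hσ, hx, hy]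
    · obtain ⟨z, rfl⟩ := (σ x).surjective y
      obtain ⟨z', rfl⟩ := (σ x').surjective y'
      rw [hσ, hσ, hx] at hy
      simpa only [Equiv.symm_apply_apply] using
        ψ.injective (add_left_cancel (add_right_cancel hy))
  rcases hs.2 _ hcong with h | h
  · obtain ⟨x, hx⟩ := exists_prime_addOrderOf_dvd_card' p hdvd
    have hx0 : x = 0 := (h x 0).1 (by rw [← hx, addOrderOf_nsmul_eq_zero, smul_zero])
    rw [hx0, addOrderOf_zero] at hx
    exact absurd hx.symm hp.ne_one
  · intro x
    simpa using h x 0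

end AffineLeftQuasigroup

/-- Over a field of characteristic `p`, the Weyl algebra relation `[S, T] = 1` forces `p` to divide
the dimension. -/
theorem dvd_finrank_of_commutator_eq_one {K V : Type*} [Field K] (p : ℕ) [CharP K p]
    [AddCommGroup V] [Module K V] [Module.Finite K V] (S T : Module.End K V)
    (h : S * T - T * S = 1) : p ∣ Module.finrank K V := by
  rw [← CharP.cast_eq_zero_iff K p, ← LinearMap.trace_one, ← h, map_sub,
    LinearMap.trace_mul_comm, sub_self]

/-- the displacement group of a finite simple latin affine
non-degenerate cycle set with `|X| > 1` (with `x·y = φ(x) + ψ(y) + c` over an abelian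
group `(X,+)`, `φ, ψ` automorphisms) is an elementary abelian `p`-group of order
`p^k` for some prime `p` and natural number `k` with `p ∣ k`. -/
theorem stmt_15 {X : Type*} [Finite X] [AddCommGroup X] (σ : X → Equiv.Perm X)
    (hlaw : CycleSetLaw σ) (hnd : Nondeg σ) (hlatin : LatinLQ σ) (hs : SimpleLQ σ)
    (hcard : 1 < Nat.card X)
    (φ ψ : X ≃+ X) (c : X) (hform : ∀ x y : X, σ x y = φ x + ψ y + c) :
    ∃ p k : ℕ, p.Prime ∧ p ∣ k ∧ Nat.card ↥(dis σ) = p ^ k ∧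
      (∀ a b : ↥(dis σ), a * b = b * a) ∧ (∀ a : ↥(dis σ), a ^ p = 1) := by
  obtain ⟨p, hp, hp0⟩ := hs.exists_prime_nsmul_eq_zero hcard hform
  have : Fact p.Prime := ⟨hp⟩
  obtain ⟨_⟩ : Nonempty (Module (ZMod p) X) := ⟨AddCommGroup.zmodModule hp0⟩
  refine ⟨p, Module.finrank (ZMod p) X, hp, ?_, ?_, fun f g => ?_, fun g => ?_⟩
  · refine dvd_finrank_of_commutator_eq_one (K := ZMod p) p
      ((ψ : X →+ X).toZModLinearMap p) ((φ.symm : X →+ X).toZModLinearMap p) ?_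
    ext x
    exact hlaw.commutator_of_affine hform x
  · rw [card_dis_of_affine hform, Module.natCard_eq_pow_finrank (K := ZMod p) (V := X),
      Nat.card_zmod]
  · obtain ⟨a, ha⟩ := exists_translation_of_mem_dis hform f.2
    obtain ⟨b, hb⟩ := exists_translation_of_mem_dis hform g.2
    ext z
    simp [ha, hb, add_right_comm]
  · obtain ⟨a, ha⟩ := exists_translation_of_mem_dis hform g.2
    have hpow : ∀ (n : ℕ) (z : X), ((g : permGroup σ) ^ n : Equiv.Perm X) z = z + n • a := by
      intro n
      induction n with
      | zero => simp
      | succ n ih =>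
        intro z
        rw [pow_succ, Equiv.Perm.mul_apply, ih, ha, succ_nsmul, add_assoc, add_comm a]
    ext z
    simp [hpow, hp0]
end

section
/- Let p be a prime, n ≥ 1, and let A, B be invertible n×n matrices over ℤ/pℤ with AB − BA = I, and suppose the representation is irreducible, i.e. the only subspaces of (ℤ/pℤ)^n invariant under both A and B are 0 and the whole space. Set ψ = A and φ = B⁻¹. Then for every c ∈ (ℤ/pℤ)^n, the set X = (ℤ/pℤ)^n with operation x·y = φ(x) + ψ(y) + c is a simple latin affine non-degenerate cycle set. Moreover, the permutation group G(X) is a p-group if and only if ψ = A has order a power of p in GL_n(ℤ/pℤ). -/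
open Matrix

/-- The permutation `y ↦ φ x + ψ y + c`, where `φ` and `ψ` are invertible matrices. -/
def affineLeftTranslation {ι R : Type*} [Fintype ι] [DecidableEq ι] [CommRing R]
    (φ ψ : (Matrix ι ι R)ˣ) (c x : ι → R) : Equiv.Perm (ι → R) where
  toFun y := φ.val *ᵥ x + ψ.val *ᵥ y + c
  invFun z := ψ⁻¹.val *ᵥ (z - c - φ.val *ᵥ x)
  left_inv y := by
    have h : φ.val *ᵥ x + ψ.val *ᵥ y + c - c - φ.val *ᵥ x = ψ.val *ᵥ y := by abel
    simp only [h, mulVec_mulVec, Units.inv_mul, one_mulVec]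
  right_inv z := by
    simp only [mulVec_mulVec, Units.mul_inv, one_mulVec]
    abel

section Affine

variable {ι R : Type*} [Fintype ι] [DecidableEq ι] [CommRing R]

theorem units_mulVec_bijective (M : (Matrix ι ι R)ˣ) :
    Function.Bijective fun v : ι → R => M.val *ᵥ v :=
  Function.bijective_iff_has_inverse.2 ⟨fun v => M⁻¹.val *ᵥ v,
    fun v => by simp only [mulVec_mulVec, Units.inv_mul, one_mulVec],
    fun v => by simp only [mulVec_mulVec, Units.mul_inv, one_mulVec]⟩

variable (φ ψ : (Matrix ι ι R)ˣ) (c : ι → R)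

theorem affineLeftTranslation_apply (x y : ι → R) :
    affineLeftTranslation φ ψ c x y = φ.val *ᵥ x + ψ.val *ᵥ y + c := rfl

theorem affineLeftTranslation_mul_inv_zero_apply (x z : ι → R) :
    affineLeftTranslation φ ψ c x ((affineLeftTranslation φ ψ c 0).symm z)
      = z + φ.val *ᵥ x := by
  have h := (affineLeftTranslation φ ψ c 0).apply_symm_apply z
  rw [affineLeftTranslation_apply, mulVec_zero, zero_add] at h
  rw [affineLeftTranslation_apply, add_assoc, h, add_comm]

theorem cycleSetLaw_affineLeftTranslation
    (h : φ.val * ψ.val - ψ.val * φ.val = φ.val * φ.val) :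
    CycleSetLaw (affineLeftTranslation φ ψ c) := by
  intro x y z
  have key (v : ι → R) : φ.val *ᵥ ψ.val *ᵥ v
      = φ.val *ᵥ φ.val *ᵥ v + ψ.val *ᵥ φ.val *ᵥ v := by
    rw [mulVec_mulVec, mulVec_mulVec, mulVec_mulVec, ← add_mulVec, ← h, sub_add_cancel]
  simp only [affineLeftTranslation_apply, mulVec_add, key]
  abel

theorem nondeg_affineLeftTranslation (h : IsUnit (φ.val + ψ.val)) :
    Nondeg (affineLeftTranslation φ ψ c) := by
  obtain ⟨M, hM⟩ := h
  have : (fun x => affineLeftTranslation φ ψ c x x)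
      = Equiv.addRight c ∘ fun x => M.val *ᵥ x := by
    ext1 x
    simp [affineLeftTranslation_apply, hM, add_mulVec]
  rw [Nondeg, this]
  exact (Equiv.addRight c).bijective.comp (units_mulVec_bijective M)

theorem latinLQ_affineLeftTranslation : LatinLQ (affineLeftTranslation φ ψ c) := by
  intro x
  have : (fun y => affineLeftTranslation φ ψ c y x)
      = Equiv.addRight (ψ.val *ᵥ x + c) ∘ fun y => φ.val *ᵥ y := by
    ext1 y
    simp [affineLeftTranslation_apply, add_assoc]
  rw [this]
  exact (Equiv.addRight _).bijective.comp (units_mulVec_bijective φ)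

theorem indecomposable_affineLeftTranslation :
    Indecomposable (affineLeftTranslation φ ψ c) := by
  intro x y
  obtain ⟨w, hw⟩ := (units_mulVec_bijective φ).surjective (y - x)
  refine ⟨affineLeftTranslation φ ψ c w * (affineLeftTranslation φ ψ c 0)⁻¹,
    mul_mem (Subgroup.subset_closure ⟨w, rfl⟩)
      (inv_mem (Subgroup.subset_closure ⟨0, rfl⟩)), ?_⟩
  refine (affineLeftTranslation_mul_inv_zero_apply φ ψ c w x).trans ?_
  simp only at hw
  rw [hw, add_sub_cancel]

variable {φ ψ c}

theorem IsCongruence.add_right {r : (ι → R) → (ι → R) → Prop}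
    (hr : IsCongruence (affineLeftTranslation φ ψ c) r) {u v : ι → R} (huv : r u v)
    (t : ι → R) : r (u + t) (v + t) := by
  obtain ⟨w, rfl⟩ := (units_mulVec_bijective φ).surjective t
  have h := hr.2.1 w w _ _ (hr.1.refl w) (hr.2.2 0 0 u v (hr.1.refl 0) huv)
  rwa [affineLeftTranslation_mul_inv_zero_apply, affineLeftTranslation_mul_inv_zero_apply] at h

theorem IsCongruence.sub_iff {r : (ι → R) → (ι → R) → Prop}
    (hr : IsCongruence (affineLeftTranslation φ ψ c) r) {u v : ι → R} :
    r (u - v) 0 ↔ r u v := by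
  constructor <;> intro h
  · simpa using hr.add_right h v
  · simpa [sub_eq_add_neg] using hr.add_right h (-v)

theorem IsCongruence.mulVec_right {r : (ι → R) → (ι → R) → Prop}
    (hr : IsCongruence (affineLeftTranslation φ ψ c) r) {u : ι → R} (hu : r u 0) :
    r (ψ.val *ᵥ u) 0 := by
  have h := hr.sub_iff.2 (hr.2.1 0 0 u 0 (hr.1.refl 0) hu)
  simpa [affineLeftTranslation_apply] using h

theorem IsCongruence.mulVec_left {r : (ι → R) → (ι → R) → Prop}
    (hr : IsCongruence (affineLeftTranslation φ ψ c) r) {u : ι → R} (hu : r u 0) :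
    r (φ.val *ᵥ u) 0 := by
  have h := hr.sub_iff.2 (hr.2.1 u 0 0 0 hu (hr.1.refl 0))
  simpa [affineLeftTranslation_apply] using h

/-- The class of `0` under a congruence of an affine left quasigroup. -/
def IsCongruence.zeroClass {r : (ι → R) → (ι → R) → Prop}
    (hr : IsCongruence (affineLeftTranslation φ ψ c) r) : AddSubgroup (ι → R) where
  carrier := {v | r v 0}
  zero_mem' := hr.1.refl 0
  add_mem' {u v} hu hv := by
    have h := hr.add_right hu v
    rw [zero_add] at h
    exact hr.1.trans h hv
  neg_mem' {u} hu := by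
    have h := hr.sub_iff.2 (hr.1.symm hu)
    rwa [zero_sub] at h

theorem exists_zpowers_sub_eq_mulVec {g : Equiv.Perm (ι → R)}
    (hg : g ∈ permGroup (affineLeftTranslation φ ψ c)) :
    ∃ M ∈ Subgroup.zpowers ψ, ∀ u v, g u - g v = M.val *ᵥ (u - v) := by
  induction hg using Subgroup.closure_induction with
  | mem g hg =>
    obtain ⟨x, rfl⟩ := hg
    refine ⟨ψ, Subgroup.mem_zpowers ψ, fun u v => ?_⟩
    rw [affineLeftTranslation_apply, affineLeftTranslation_apply, mulVec_sub]
    abel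
  | one => exact ⟨1, one_mem _, fun u v => by simp⟩
  | mul g h _ _ hg hh =>
    obtain ⟨M, hM, hg⟩ := hg
    obtain ⟨N, hN, hh⟩ := hh
    refine ⟨M * N, mul_mem hM hN, fun u v => ?_⟩
    rw [Equiv.Perm.mul_apply, Equiv.Perm.mul_apply, hg, hh, mulVec_mulVec, Units.val_mul]
  | inv g _ hg =>
    obtain ⟨M, hM, hg⟩ := hg
    refine ⟨M⁻¹, inv_mem hM, fun u v => ?_⟩
    have h := hg (g⁻¹ u) (g⁻¹ v)
    have hinv (w : ι → R) : g (g⁻¹ w) = w := g.apply_symm_apply w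
    rw [hinv, hinv] at h
    rw [h, mulVec_mulVec, Units.inv_mul, one_mulVec]

theorem perm_pow_sub_eq_mulVec {g : Equiv.Perm (ι → R)} {M : Matrix ι ι R}
    (hg : ∀ u v, g u - g v = M *ᵥ (u - v)) (k : ℕ) (u v : ι → R) :
    (g ^ k) u - (g ^ k) v = (M ^ k) *ᵥ (u - v) := by
  induction k generalizing u v with
  | zero => simp
  | succ k ih =>
    rw [pow_succ, Equiv.Perm.mul_apply, Equiv.Perm.mul_apply, ih, hg, mulVec_mulVec, pow_succ]

end Affine

theorem perm_pow_char_eq_one {ι : Type*} {p : ℕ} {g : Equiv.Perm (ι → ZMod p)}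
    (hg : ∀ u v, g u - g v = u - v) : g ^ p = 1 := by
  have hk (k : ℕ) (u : ι → ZMod p) : (g ^ k) u = u + k • g 0 := by
    induction k with
    | zero => simp
    | succ k ih =>
      have h := hg ((g ^ k) u) 0
      rw [sub_eq_iff_eq_add, sub_zero] at h
      rw [pow_succ', Equiv.Perm.mul_apply, h, ih, succ_nsmul, add_assoc]
  ext1 u
  rw [hk, ← Nat.cast_smul_eq_nsmul (ZMod p), CharP.cast_eq_zero, zero_smul, add_zero,
    Equiv.Perm.one_apply]

section ZModPrime

variable {ι : Type*} [Fintype ι] [DecidableEq ι] {p : ℕ}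
  {φ ψ : (Matrix ι ι (ZMod p))ˣ} {c : ι → ZMod p}

theorem isPGroup_permGroup_affineLeftTranslation [Fact p.Prime] :
    IsPGroup p (permGroup (affineLeftTranslation φ ψ c)) ↔ ∃ m : ℕ, orderOf ψ = p ^ m := by
  constructor
  · intro h
    obtain ⟨k, hk⟩ := h (sigmaG (affineLeftTranslation φ ψ c) 0)
    have hk' : affineLeftTranslation φ ψ c 0 ^ p ^ k = 1 := congrArg Subtype.val hk
    have hsub (u v : ι → ZMod p) : affineLeftTranslation φ ψ c 0 u
        - affineLeftTranslation φ ψ c 0 v = ψ.val *ᵥ (u - v) := by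
      rw [affineLeftTranslation_apply, affineLeftTranslation_apply, mulVec_sub]
      abel
    have hψ : ψ ^ p ^ k = 1 := by
      refine Units.ext (ext_of_mulVec_single fun i => ?_)
      have h := perm_pow_sub_eq_mulVec hsub (p ^ k) (Pi.single i 1) 0
      rw [hk', sub_zero] at h
      rw [Units.val_pow_eq_pow_val, ← h, Units.val_one, one_mulVec]
      simp
    obtain ⟨m, -, hm⟩ := (Nat.dvd_prime_pow Fact.out).1 (orderOf_dvd_of_pow_eq_one hψ)
    exact ⟨m, hm⟩
  · rintro ⟨m, hm⟩ ⟨g, hg⟩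
    obtain ⟨M, hM, hgM⟩ := exists_zpowers_sub_eq_mulVec hg
    have hMp : M.val ^ p ^ m = 1 := by
      rw [← Units.val_pow_eq_pow_val, ← hm,
        orderOf_dvd_iff_pow_eq_one.1 (orderOf_dvd_of_mem_zpowers hM), Units.val_one]
    refine ⟨m + 1, Subtype.ext ?_⟩
    refine (pow_mul g (p ^ m) p).trans (perm_pow_char_eq_one fun u v => ?_)
    rw [perm_pow_sub_eq_mulVec hgM, hMp, one_mulVec]

theorem inv_mulVec_mem [NeZero p] (M : (Matrix ι ι (ZMod p))ˣ)
    {W : AddSubgroup (ι → ZMod p)} (hW : ∀ v ∈ W, M.val *ᵥ v ∈ W) {v : ι → ZMod p}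
    (hv : v ∈ W) : M⁻¹.val *ᵥ v ∈ W := by
  have hinj : Function.Injective fun w : W => (⟨M.val *ᵥ w.1, hW _ w.2⟩ : W) :=
    fun a b hab => Subtype.ext
      ((units_mulVec_bijective M).injective (congrArg Subtype.val hab))
  obtain ⟨w, hw⟩ := Finite.surjective_of_injective hinj ⟨v, hv⟩
  have hw' : M.val *ᵥ w.1 = v := congrArg Subtype.val hw
  rw [← hw', mulVec_mulVec, Units.inv_mul, one_mulVec]
  exact w.2

theorem simpleLQ_affineLeftTranslation [NeZero p]
    (hirr : ∀ W : Submodule (ZMod p) (ι → ZMod p), (∀ v ∈ W, ψ.val *ᵥ v ∈ W) →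
      (∀ v ∈ W, φ⁻¹.val *ᵥ v ∈ W) → W = ⊥ ∨ W = ⊤) :
    SimpleLQ (affineLeftTranslation φ ψ c) := by
  refine ⟨indecomposable_affineLeftTranslation φ ψ c, fun r hr => ?_⟩
  have hmem (u v : ι → ZMod p) : u - v ∈ AddSubgroup.toZModSubmodule p hr.zeroClass ↔ r u v :=
    hr.sub_iff
  rcases hirr (AddSubgroup.toZModSubmodule p hr.zeroClass) (fun v hv => hr.mulVec_right hv)
    (fun v hv => inv_mulVec_mem φ (fun w hw => hr.mulVec_left hw) hv) with h | h
  · left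
    intro a b
    rw [← hmem, h, Submodule.mem_bot, sub_eq_zero]
  · right
    intro a b
    rw [← hmem, h]
    exact Submodule.mem_top

end ZModPrime

/-- let `A, B` be invertible `n×n` matrices over `ℤ/pℤ` with
`AB − BA = I`, giving an irreducible representation of the first Weyl algebra.
With `ψ = A`, `φ = B⁻¹`, for every `c` the operation `x·y = φ(x) + ψ(y) + c` on
`(ℤ/pℤ)^n` is a simple latin affine non-degenerate cycle set; moreover its permutation
group is a `p`-group iff the order of `A` in `GLₙ(ℤ/pℤ)` is a power of `p`. -/
theorem stmt_16 (p n : ℕ) (hp : p.Prime) (hn : 1 ≤ n)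
    (A B : Matrix (Fin n) (Fin n) (ZMod p)) (hA : IsUnit A) (hB : IsUnit B)
    (hweyl : A * B - B * A = 1)
    (hirr : ∀ W : Submodule (ZMod p) (Fin n → ZMod p),
      (∀ v ∈ W, A.mulVec v ∈ W) → (∀ v ∈ W, B.mulVec v ∈ W) → W = ⊥ ∨ W = ⊤)
    (c : Fin n → ZMod p) :
    ∃ σ : (Fin n → ZMod p) → Equiv.Perm (Fin n → ZMod p),
      (∀ x y : Fin n → ZMod p, σ x y = B⁻¹.mulVec x + A.mulVec y + c) ∧
      CycleSetLaw σ ∧ Nondeg σ ∧ LatinLQ σ ∧ SimpleLQ σ ∧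
      (IsPGroup p ↥(permGroup σ) ↔ ∃ m : ℕ, orderOf hA.unit = p ^ m) := by
  have := Fact.mk hp
  obtain ⟨ψ, rfl⟩ := hA
  obtain ⟨β, rfl⟩ := hB
  have hinv : (β : Matrix (Fin n) (Fin n) (ZMod p))⁻¹ = β⁻¹.val := (coe_units_inv β).symm
  have hweyl' : ψ.val * β.val = β.val * ψ.val + 1 := by rw [← hweyl]; abel
  have hconj : β⁻¹.val * ψ.val * β.val = β⁻¹.val + ψ.val := by
    rw [mul_assoc, hweyl', mul_add, ← mul_assoc, Units.inv_mul, one_mul, mul_one, add_comm]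
  have hunit : ψ.isUnit.unit = ψ := Units.ext rfl
  rw [hinv, hunit]
  refine ⟨affineLeftTranslation β⁻¹ ψ c, affineLeftTranslation_apply β⁻¹ ψ c,
    cycleSetLaw_affineLeftTranslation _ _ _ ?_, nondeg_affineLeftTranslation _ _ _ ?_,
    latinLQ_affineLeftTranslation _ _ _, simpleLQ_affineLeftTranslation ?_,
    isPGroup_permGroup_affineLeftTranslation⟩
  · have h : β⁻¹.val * ψ.val = (β⁻¹.val + ψ.val) * β⁻¹.val := by
      rw [← hconj, mul_assoc, Units.mul_inv, mul_one]
    rw [h, add_mul, add_sub_cancel_right]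
  · rw [← hconj]
    exact (β⁻¹ * ψ * β).isUnit
  · simpa only [inv_inv] using hirr
end
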